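/- arXiv:1203.2363 — 3 statements merged into one kernel-verified Lean document; each statement's English description precedes it below -/
import Mathlib

section
/- Let α = (α, α₁,…,α_r) with α < α_i for all i (so k = 1), β = (α₁,…,α_r). Then σ_α(x) = α x^{1/α}/log x · ∑_{m ∈ 𝒫_β^σ} m^{-1/α} + O(x^{1/α}/(log x)²). -/
open Filter Asymptotics Real

/-- The set of integers expressible as `p₁^{β 0} ⋯ p_r^{β (r-1)}` for primes `pᵢ`
(repetitions allowed). -/
def Psigma {r : ℕ} (β : Fin r → ℕ) : Set ℕ :=
  {n | ∃ p : Fin r → ℕ, (∀ i, (p i).Prime) ∧ n = ∏ i, p i ^ β i}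

/-- The set of integers expressible as `p₁^{β 0} ⋯ p_r^{β (r-1)}` for pairwise distinct
primes `pᵢ`. -/
def Ppi {r : ℕ} (β : Fin r → ℕ) : Set ℕ :=
  {n | ∃ p : Fin r → ℕ, (∀ i, (p i).Prime) ∧ Function.Injective p ∧ n = ∏ i, p i ^ β i}

/-- The number of `n ∈ S` with `n ≤ x`. -/
noncomputable def countIn (S : Set ℕ) (x : ℝ) : ℕ :=
  Nat.card {n : ℕ | (n : ℝ) ≤ x ∧ n ∈ S}

section PrimeNumberTheorem

open ZetaAsymptotics Topology

/-- The local Euler–Maclaurin error, multiplied by `s - 1`, in comparing `∑ n ^ (-s)` with the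
integral of `x ^ (-s)`. -/
noncomputable def zetaErr (n : ℕ) (s : ℂ) : ℂ :=
  (s - 1) * (n : ℂ) ^ (-s) + ((n + 1 : ℕ) : ℂ) ^ (1 - s) - (n : ℂ) ^ (1 - s)

lemma norm_natCast_cpow_neg_sub_le {n : ℕ} (hn : 0 < n) {s : ℂ} (hs : 0 < s.re) {x : ℝ}
    (hx : x ∈ Set.Icc (n : ℝ) (n + 1)) :
    ‖(n : ℂ) ^ (-s) - (x : ℂ) ^ (-s)‖ ≤ ‖s‖ * (n : ℝ) ^ (-s.re - 1) := by
  have hn' : (0 : ℝ) < n := by exact_mod_cast hn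
  have key := (convex_Icc (n : ℝ) (n + 1)).norm_image_sub_le_of_norm_hasDerivWithin_le
    (f := fun y : ℝ => (y : ℂ) ^ (-s)) (f' := fun y : ℝ => -s * (y : ℂ) ^ (-s - 1))
    (C := ‖s‖ * (n : ℝ) ^ (-s.re - 1)) (x := x) (y := n)
    (fun y hy => by
      have hy0 : 0 < y := hn'.trans_le hy.1
      have := (Complex.hasStrictDerivAt_cpow_const (c := -s)
        (Complex.ofReal_mem_slitPlane.2 hy0)).hasDerivAt.comp_ofReal
      exact this.hasDerivWithinAt)
    (fun y hy => by
      have hy0 : 0 < y := hn'.trans_le hy.1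
      rw [norm_mul, norm_neg, Complex.norm_cpow_eq_rpow_re_of_pos hy0]
      gcongr 1
      simp only [Complex.sub_re, Complex.neg_re, Complex.one_re]
      exact Real.rpow_le_rpow_of_nonpos hn' hy.1 (by linarith))
    hx ⟨le_rfl, by linarith⟩
  refine (by simpa using key : _ ≤ _).trans ?_
  have : |(n : ℝ) - x| ≤ 1 := by rw [abs_le]; constructor <;> linarith [hx.1, hx.2]
  exact mul_le_of_le_one_right (by positivity) this

lemma norm_zetaErr_le {n : ℕ} (hn : 0 < n) {s : ℂ} (hs : 0 < s.re) :
    ‖zetaErr n s‖ ≤ ‖s - 1‖ * ‖s‖ * (n : ℝ) ^ (-s.re - 1) := by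
  have hn' : (0 : ℝ) < n := by exact_mod_cast hn
  have key := (convex_Icc (n : ℝ) (n + 1)).norm_image_sub_le_of_norm_hasDerivWithin_le
    (f := fun y : ℝ => (s - 1) * (n : ℂ) ^ (-s) * y + (y : ℂ) ^ (1 - s))
    (f' := fun y : ℝ => (s - 1) * ((n : ℂ) ^ (-s) - (y : ℂ) ^ (-s)))
    (C := ‖s - 1‖ * ‖s‖ * (n : ℝ) ^ (-s.re - 1)) (x := n) (y := n + 1)
    (fun y hy => by
      have hy0 : 0 < y := hn'.trans_le hy.1
      have h1 := (Complex.hasStrictDerivAt_cpow_const (c := 1 - s)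
        (Complex.ofReal_mem_slitPlane.2 hy0)).hasDerivAt.comp_ofReal
      have h2 : HasDerivAt (fun y : ℝ => (s - 1) * (n : ℂ) ^ (-s) * y)
        ((s - 1) * (n : ℂ) ^ (-s) * 1) y :=
        ((hasDerivAt_id (y : ℂ)).comp_ofReal).const_mul _
      refine (h2.fun_add h1).hasDerivWithinAt.congr_deriv ?_
      rw [show 1 - s - 1 = -s by ring]
      ring)
    (fun y hy => by
      rw [norm_mul, mul_assoc]
      gcongr
      exact norm_natCast_cpow_neg_sub_le hn hs hy)
    ⟨le_rfl, by linarith⟩ ⟨by linarith, le_rfl⟩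
  simp only [add_sub_cancel_left, norm_one, mul_one] at key
  refine le_of_eq_of_le ?_ key
  congr 1
  rw [zetaErr]
  push_cast
  ring

lemma differentiable_zetaErr {n : ℕ} (hn : 0 < n) : Differentiable ℂ (zetaErr n) := by
  have hn' : (n : ℂ) ≠ 0 := by exact_mod_cast hn.ne'
  have hn1 : ((n + 1 : ℕ) : ℂ) ≠ 0 := by exact_mod_cast n.succ_ne_zero
  unfold zetaErr
  intro s
  have h1 : DifferentiableAt ℂ (fun s : ℂ => (n : ℂ) ^ (-s)) s :=
    DifferentiableAt.const_cpow (by fun_prop) (Or.inl hn')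
  have h2 : DifferentiableAt ℂ (fun s : ℂ => ((n + 1 : ℕ) : ℂ) ^ (1 - s)) s :=
    DifferentiableAt.const_cpow (by fun_prop) (Or.inl hn1)
  have h3 : DifferentiableAt ℂ (fun s : ℂ => (n : ℂ) ^ (1 - s)) s :=
    DifferentiableAt.const_cpow (by fun_prop) (Or.inl hn')
  fun_prop

lemma summable_natCast_add_one_rpow {a : ℝ} (ha : a < -1) :
    Summable fun n : ℕ => ((n + 1 : ℕ) : ℝ) ^ a :=
  (summable_nat_add_iff 1).2 (Real.summable_nat_rpow.2 ha)

lemma summable_zetaErr {s : ℂ} (hs : 0 < s.re) : Summable fun n : ℕ => zetaErr (n + 1) s :=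
  Summable.of_norm_bounded ((summable_natCast_add_one_rpow (a := -s.re - 1)
    (by linarith)).mul_left (‖s - 1‖ * ‖s‖)) fun n => norm_zetaErr_le n.succ_pos hs

lemma riemannZeta₁_eq_sub_one_mul {s : ℂ} (hs : s ≠ 1) :
    riemannZeta₁ s = (s - 1) * riemannZeta s := by
  rw [riemannZeta_eq_inv_sub_mul hs, mul_inv_cancel_left₀ (sub_ne_zero.2 hs)]

lemma riemannZeta₁_eq_tsum_of_one_lt_re {s : ℂ} (hs : 1 < s.re) :
    riemannZeta₁ s = 1 + ∑' n : ℕ, zetaErr (n + 1) s := by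
  have hs1 : s ≠ 1 := by rintro rfl; simp at hs
  have hz : HasSum (fun n : ℕ => ((n + 1 : ℕ) : ℂ) ^ (-s)) (riemannZeta s) := by
    rw [zeta_eq_tsum_one_div_nat_add_one_cpow hs]
    have := (summable_nat_add_iff 1).2 (Complex.summable_one_div_nat_cpow.2 hs)
    simp only [Nat.cast_add, Nat.cast_one] at this ⊢
    exact this.hasSum.congr_fun fun n => by rw [Complex.cpow_neg, one_div]
  have hE := (summable_zetaErr (s := s) (by linarith)).hasSum
  have hdiff := hE.sub (hz.mul_left (s - 1))
  have hlim : Tendsto (fun N : ℕ => ((N + 1 : ℕ) : ℂ) ^ (1 - s) - 1) atTop (𝓝 (0 - 1)) := by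
    refine Tendsto.sub_const ?_ _
    rw [tendsto_zero_iff_norm_tendsto_zero]
    have h1 : Tendsto (fun N : ℕ => ((N + 1 : ℕ) : ℝ) ^ (-(s.re - 1))) atTop (𝓝 0) :=
      (tendsto_rpow_neg_atTop (by linarith)).comp
        (tendsto_natCast_atTop_atTop.comp (tendsto_add_atTop_nat 1))
    refine h1.congr fun N => ?_
    rw [Complex.norm_natCast_cpow_of_pos N.succ_pos]
    simp
  have hpart : ∀ N : ℕ, ∑ n ∈ Finset.range N,
      (zetaErr (n + 1) s - (s - 1) * ((n + 1 : ℕ) : ℂ) ^ (-s)) =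
        ((N + 1 : ℕ) : ℂ) ^ (1 - s) - 1 := by
    intro N
    have := Finset.sum_range_sub (fun n : ℕ => ((n + 1 : ℕ) : ℂ) ^ (1 - s)) N
    simp only [zero_add, Nat.cast_one, Complex.one_cpow] at this
    rw [← this]
    refine Finset.sum_congr rfl fun n _ => ?_
    rw [zetaErr]
    ring
  have := tendsto_nhds_unique (hdiff.tendsto_sum_nat.congr hpart) hlim
  rw [riemannZeta₁_eq_sub_one_mul hs1]
  linear_combination -this

lemma riemannZeta₁_eq_tsum {s : ℂ} (hs : 1 / 2 < s.re) :
    riemannZeta₁ s = 1 + ∑' n : ℕ, zetaErr (n + 1) s := by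
  set R : ℝ := ‖s‖ + 3
  set U : Set ℂ := {z | 1 / 2 < z.re} ∩ Metric.ball 0 R
  have hUo : IsOpen U := (isOpen_lt continuous_const Complex.continuous_re).inter Metric.isOpen_ball
  have hUc : IsPreconnected U :=
    ((convex_halfSpace_re_gt _).inter (convex_ball _ _)).isPreconnected
  have hR : 3 ≤ R := by simp [R]
  have h2 : (2 : ℂ) ∈ U := by
    refine ⟨by simp; norm_num, ?_⟩
    simp only [Metric.mem_ball, dist_zero_right, Complex.norm_ofNat]
    linarith
  have hsU : s ∈ U := ⟨hs, by simp [R]⟩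
  have hd : DifferentiableOn ℂ (fun z => ∑' n : ℕ, zetaErr (n + 1) z) U := by
    refine Complex.differentiableOn_tsum_of_summable_norm
      (u := fun n : ℕ => (R + 1) * R * ((n + 1 : ℕ) : ℝ) ^ (-(3 / 2) : ℝ))
      ((summable_natCast_add_one_rpow (by norm_num)).mul_left _)
      (fun n => (differentiable_zetaErr n.succ_pos).differentiableOn) hUo ?_
    intro n w hw
    have hw1 : ‖w‖ ≤ R := (mem_ball_zero_iff.1 hw.2).le
    have hw2 : 1 / 2 < w.re := hw.1
    refine (norm_zetaErr_le n.succ_pos (by linarith)).trans ?_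
    gcongr
    · exact (norm_sub_le _ _).trans (by simpa using hw1)
    · simp
    · linarith
  refine AnalyticOnNhd.eqOn_of_preconnected_of_eventuallyEq
    (differentiable_riemannZeta₁.differentiableOn.analyticOnNhd hUo)
    ((hd.const_add 1).analyticOnNhd hUo) hUc h2 ?_ hsU
  filter_upwards [(isOpen_lt continuous_const Complex.continuous_re).mem_nhds
    (show (1 : ℝ) < (2 : ℂ).re by simp)] with z hz
  exact riemannZeta₁_eq_tsum_of_one_lt_re hz

lemma riemannZeta₁_eq_sum_add_tsum {s : ℂ} (hs : 1 / 2 < s.re) (N : ℕ) :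
    riemannZeta₁ s = (s - 1) * ∑ n ∈ Finset.range N, ((n + 1 : ℕ) : ℂ) ^ (-s) +
      ((N + 1 : ℕ) : ℂ) ^ (1 - s) + ∑' n : ℕ, zetaErr (n + N + 1) s := by
  rw [riemannZeta₁_eq_tsum hs, ← (summable_zetaErr (by linarith)).sum_add_tsum_nat_add N]
  have := Finset.sum_range_sub (fun n : ℕ => ((n + 1 : ℕ) : ℂ) ^ (1 - s)) N
  simp only [zero_add, Nat.cast_one, Complex.one_cpow] at this
  have h2 : ∑ n ∈ Finset.range N, zetaErr (n + 1) s =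
      (s - 1) * ∑ n ∈ Finset.range N, ((n + 1 : ℕ) : ℂ) ^ (-s) +
        (((N + 1 : ℕ) : ℂ) ^ (1 - s) - 1) := by
    rw [← this, Finset.mul_sum, ← Finset.sum_add_distrib]
    refine Finset.sum_congr rfl fun n _ => ?_
    rw [zetaErr]
    ring
  rw [h2]
  ring

lemma riemannZeta_eq_sum_add_tsum {s : ℂ} (hs : 1 / 2 < s.re) (hs1 : s ≠ 1) (N : ℕ) :
    riemannZeta s = ∑ n ∈ Finset.range N, ((n + 1 : ℕ) : ℂ) ^ (-s) +
      (s - 1)⁻¹ * ((N + 1 : ℕ) : ℂ) ^ (1 - s) +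
        (s - 1)⁻¹ * ∑' n : ℕ, zetaErr (n + N + 1) s := by
  have h := sub_ne_zero.2 hs1
  rw [riemannZeta_eq_inv_sub_mul hs1, riemannZeta₁_eq_sum_add_tsum hs N]
  field_simp

lemma exists_norm_riemannZeta_le : ∃ C : ℝ, 0 < C ∧ ∀ s : ℂ, 127 / 128 ≤ s.re → s.re ≤ 3 →
    1 ≤ |s.im| → ‖riemannZeta s‖ ≤ C * |s.im| ^ (1 / 16 : ℝ) := by
  have hsum := summable_natCast_add_one_rpow (a := -(129 / 128)) (by norm_num)
  set K : ℝ := ∑' n : ℕ, ((n + 1 : ℕ) : ℝ) ^ (-(129 / 128) : ℝ) with hK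
  have hK0 : 0 ≤ K := tsum_nonneg fun n => by positivity
  refine ⟨2 * K + 4 + 4 * K, by positivity, fun s h1 h3 ht => ?_⟩
  set t : ℝ := |s.im| with htdef
  have ht0 : 0 < t := by linarith
  have hs1 : s ≠ 1 := by rintro rfl; norm_num [htdef] at ht
  set M : ℕ := ⌈t⌉₊
  have hM1 : t ≤ M := Nat.le_ceil t
  have hM2 : (M : ℝ) ≤ 2 * t := by linarith [Nat.ceil_lt_add_one ht0.le]
  have hM0 : (0 : ℝ) < M := by linarith
  set N : ℕ := M ^ 4
  have hN1 : 1 ≤ (N : ℝ) := by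
    simp only [N, Nat.cast_pow]; exact one_le_pow₀ (by linarith)
  have hN0 : 0 < N := by exact_mod_cast hN1
  have hNpow : (N : ℝ) ^ (1 / 64 : ℝ) ≤ 2 * t ^ (1 / 16 : ℝ) := by
    calc (N : ℝ) ^ (1 / 64 : ℝ) = (M : ℝ) ^ (1 / 16 : ℝ) := by
          simp only [N, Nat.cast_pow]
          rw [← Real.rpow_natCast, ← Real.rpow_mul hM0.le]; norm_num
      _ ≤ (2 * t) ^ (1 / 16 : ℝ) := by gcongr
      _ = 2 ^ (1 / 16 : ℝ) * t ^ (1 / 16 : ℝ) := Real.mul_rpow (by norm_num) ht0.le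
      _ ≤ 2 * t ^ (1 / 16 : ℝ) := by
          gcongr
          calc (2 : ℝ) ^ (1 / 16 : ℝ) ≤ 2 ^ (1 : ℝ) :=
                Real.rpow_le_rpow_of_exponent_le (by norm_num) (by norm_num)
            _ = 2 := by norm_num
  have htpow : 1 ≤ t ^ (1 / 16 : ℝ) := Real.one_le_rpow ht (by norm_num)
  have hst : t ≤ ‖s - 1‖ := by
    simpa [htdef] using Complex.abs_im_le_norm (s - 1)
  have hst0 : 0 < ‖s - 1‖ := by linarith
  have hsn : ‖s‖ ≤ 4 * t := by
    have := Complex.norm_le_abs_re_add_abs_im s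
    rw [abs_of_nonneg (by linarith : 0 ≤ s.re)] at this
    linarith
  have hhead : ‖∑ n ∈ Finset.range N, ((n + 1 : ℕ) : ℂ) ^ (-s)‖ ≤ 2 * K * t ^ (1 / 16 : ℝ) := by
    calc ‖∑ n ∈ Finset.range N, ((n + 1 : ℕ) : ℂ) ^ (-s)‖
        ≤ ∑ n ∈ Finset.range N, (N : ℝ) ^ (1 / 64 : ℝ) * ((n + 1 : ℕ) : ℝ) ^ (-(129 / 128) : ℝ) := by
          refine norm_sum_le_of_le _ fun n hn => ?_
          rw [Complex.norm_natCast_cpow_of_pos n.succ_pos]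
          have hn1 : (1 : ℝ) ≤ (n + 1 : ℕ) := by simp
          have hnN : ((n + 1 : ℕ) : ℝ) ≤ N := by exact_mod_cast Finset.mem_range.1 hn
          calc ((n + 1 : ℕ) : ℝ) ^ (-s).re
              ≤ ((n + 1 : ℕ) : ℝ) ^ ((1 / 64 : ℝ) + (-(129 / 128) : ℝ)) :=
                Real.rpow_le_rpow_of_exponent_le hn1 (by simp; linarith)
            _ = ((n + 1 : ℕ) : ℝ) ^ (1 / 64 : ℝ) * ((n + 1 : ℕ) : ℝ) ^ (-(129 / 128) : ℝ) :=
                Real.rpow_add (by linarith) _ _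
            _ ≤ _ := by gcongr
      _ = (N : ℝ) ^ (1 / 64 : ℝ) *
            ∑ n ∈ Finset.range N, ((n + 1 : ℕ) : ℝ) ^ (-(129 / 128) : ℝ) := by
          rw [Finset.mul_sum]
      _ ≤ (2 * t ^ (1 / 16 : ℝ)) * K := by
          gcongr
          exact hsum.sum_le_tsum _ fun n _ => by positivity
      _ = _ := by ring
  have hmid : ‖(s - 1)⁻¹ * ((N + 1 : ℕ) : ℂ) ^ (1 - s)‖ ≤ 4 * t ^ (1 / 16 : ℝ) := by
    rw [norm_mul, norm_inv, Complex.norm_natCast_cpow_of_pos N.succ_pos]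
    have hb : ((N + 1 : ℕ) : ℝ) ^ (1 - s).re ≤ 4 * t ^ (1 / 16 : ℝ) := by
      calc ((N + 1 : ℕ) : ℝ) ^ (1 - s).re ≤ ((N + 1 : ℕ) : ℝ) ^ (1 / 64 : ℝ) :=
            Real.rpow_le_rpow_of_exponent_le (by simp) (by simp; linarith)
        _ ≤ (2 * N : ℝ) ^ (1 / 64 : ℝ) := by
            gcongr; push_cast; linarith
        _ = 2 ^ (1 / 64 : ℝ) * (N : ℝ) ^ (1 / 64 : ℝ) := Real.mul_rpow (by norm_num) (by linarith)
        _ ≤ 2 * (2 * t ^ (1 / 16 : ℝ)) := by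
            gcongr
            calc (2 : ℝ) ^ (1 / 64 : ℝ) ≤ 2 ^ (1 : ℝ) :=
                  Real.rpow_le_rpow_of_exponent_le (by norm_num) (by norm_num)
              _ = 2 := by norm_num
        _ = _ := by ring
    have hi : ‖s - 1‖⁻¹ ≤ 1 := inv_le_one_of_one_le₀ (by linarith)
    calc ‖s - 1‖⁻¹ * ((N + 1 : ℕ) : ℝ) ^ (1 - s).re
        ≤ 1 * (4 * t ^ (1 / 16 : ℝ)) := by gcongr
      _ = _ := one_mul _
  have htail : ‖(s - 1)⁻¹ * ∑' n : ℕ, zetaErr (n + N + 1) s‖ ≤ 4 * K * t ^ (1 / 16 : ℝ) := by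
    have hN2 : (N : ℝ) ^ (-(1 / 2) : ℝ) ≤ t⁻¹ := by
      calc (N : ℝ) ^ (-(1 / 2) : ℝ) = ((M : ℝ) ^ 2)⁻¹ := by
            simp only [N, Nat.cast_pow]
            rw [← Real.rpow_natCast, ← Real.rpow_mul hM0.le, ← Real.rpow_natCast,
              ← Real.rpow_neg hM0.le]
            norm_num
        _ ≤ t⁻¹ := by
            gcongr
            nlinarith
    have hbound : ‖∑' n : ℕ, zetaErr (n + N + 1) s‖ ≤ ‖s - 1‖ * (4 * K) := by
      have hhs := hsum.hasSum.mul_left (‖s - 1‖ * 4)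
      rw [← hK] at hhs
      refine le_of_le_of_eq (tsum_of_norm_bounded hhs fun n => ?_) (by ring)
      refine (norm_zetaErr_le (n + N).succ_pos (by linarith)).trans ?_
      have hk1 : (1 : ℝ) ≤ (n + N + 1 : ℕ) := by exact_mod_cast Nat.le_add_left 1 (n + N)
      have hkN : (N : ℝ) ≤ (n + N + 1 : ℕ) := by push_cast; linarith [(n.cast_nonneg : (0 : ℝ) ≤ n)]
      have hkn : ((n + 1 : ℕ) : ℝ) ≤ (n + N + 1 : ℕ) := by push_cast; linarith
      have hp : ((n + N + 1 : ℕ) : ℝ) ^ (-s.re - 1) ≤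
          t⁻¹ * ((n + 1 : ℕ) : ℝ) ^ (-(129 / 128) : ℝ) := by
        calc ((n + N + 1 : ℕ) : ℝ) ^ (-s.re - 1)
            ≤ ((n + N + 1 : ℕ) : ℝ) ^ ((-(1 / 2) : ℝ) + (-(129 / 128) : ℝ)) :=
              Real.rpow_le_rpow_of_exponent_le hk1 (by linarith)
          _ = ((n + N + 1 : ℕ) : ℝ) ^ (-(1 / 2) : ℝ) *
                ((n + N + 1 : ℕ) : ℝ) ^ (-(129 / 128) : ℝ) := Real.rpow_add (by linarith) _ _
          _ ≤ (N : ℝ) ^ (-(1 / 2) : ℝ) * ((n + 1 : ℕ) : ℝ) ^ (-(129 / 128) : ℝ) := by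
              have a1 := Real.rpow_le_rpow_of_nonpos (z := -(1 / 2)) (by linarith) hkN (by norm_num)
              have a2 := Real.rpow_le_rpow_of_nonpos (z := -(129 / 128)) (by positivity) hkn
                (by norm_num)
              gcongr
          _ ≤ _ := by gcongr
      calc ‖s - 1‖ * ‖s‖ * ((n + N + 1 : ℕ) : ℝ) ^ (-s.re - 1)
          ≤ ‖s - 1‖ * (4 * t) * (t⁻¹ * ((n + 1 : ℕ) : ℝ) ^ (-(129 / 128) : ℝ)) := by gcongr
        _ = ‖s - 1‖ * 4 * ((n + 1 : ℕ) : ℝ) ^ (-(129 / 128) : ℝ) := by field_simp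
    rw [norm_mul, norm_inv]
    calc ‖s - 1‖⁻¹ * ‖∑' n : ℕ, zetaErr (n + N + 1) s‖ ≤ ‖s - 1‖⁻¹ * (‖s - 1‖ * (4 * K)) := by
          gcongr
      _ = 4 * K := by field_simp
      _ ≤ _ := le_mul_of_one_le_right (by positivity) htpow
  rw [riemannZeta_eq_sum_add_tsum (by linarith) hs1 N]
  refine (norm_add₃_le).trans ?_
  linarith

lemma rpow_one_div_sixteen_le_two_mul {x y : ℝ} (hx : 0 ≤ x) (hy : 0 ≤ y) (h : y ≤ 2 * x) :
    y ^ (1 / 16 : ℝ) ≤ 2 * x ^ (1 / 16 : ℝ) :=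
  calc y ^ (1 / 16 : ℝ) ≤ (2 * x) ^ (1 / 16 : ℝ) := by gcongr
    _ = 2 ^ (1 / 16 : ℝ) * x ^ (1 / 16 : ℝ) := Real.mul_rpow (by norm_num) hx
    _ ≤ 2 ^ (1 : ℝ) * x ^ (1 / 16 : ℝ) := by
        gcongr
        · norm_num
        · norm_num
    _ = _ := by norm_num

lemma exists_norm_deriv_riemannZeta_le : ∃ C : ℝ, 0 < C ∧ ∀ s : ℂ, 255 / 256 ≤ s.re →
    s.re ≤ 5 / 2 → 2 ≤ |s.im| → ‖deriv riemannZeta s‖ ≤ C * |s.im| ^ (1 / 16 : ℝ) := by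
  obtain ⟨C, hC, hζ⟩ := exists_norm_riemannZeta_le
  refine ⟨C * 2 * 256, by positivity, fun s h1 h2 ht => ?_⟩
  have hball : ∀ z ∈ Metric.closedBall s (1 / 256), 127 / 128 ≤ z.re ∧ z.re ≤ 3 ∧ 1 ≤ |z.im| ∧
      |z.im| ≤ 2 * |s.im| := by
    intro z hz
    rw [mem_closedBall_iff_norm] at hz
    have hr := abs_le.1 ((Complex.abs_re_le_norm (z - s)).trans hz)
    have hi := (Complex.abs_im_le_norm (z - s)).trans hz
    simp only [Complex.sub_re, Complex.sub_im] at hr hi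
    have h3 := abs_sub_abs_le_abs_sub z.im s.im
    have h4 := abs_sub_abs_le_abs_sub s.im z.im
    rw [abs_sub_comm] at h4
    exact ⟨by linarith [hr.1], by linarith [hr.2], by linarith, by linarith⟩
  have key := Complex.norm_deriv_le_of_forall_mem_sphere_norm_le (f := riemannZeta) (c := s)
    (R := 1 / 256) (C := C * (2 * |s.im| ^ (1 / 16 : ℝ))) (by norm_num)
    (DifferentiableOn.diffContOnCl (by
      rw [closure_ball _ (by norm_num)]
      intro z hz
      refine (differentiableAt_riemannZeta ?_).differentiableWithinAt
      rintro rfl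
      have := (hball _ hz).2.2.1
      norm_num at this))
    (fun z hz => by
      obtain ⟨a1, a2, a3, a4⟩ := hball z (Metric.sphere_subset_closedBall hz)
      refine (hζ z a1 a2 a3).trans ?_
      gcongr
      exact rpow_one_div_sixteen_le_two_mul (abs_nonneg _) (abs_nonneg _) a4)
  refine key.trans (le_of_eq ?_)
  ring

lemma exists_norm_riemannZeta_one_add_le : ∃ B : ℝ, 0 < B ∧ ∀ η : ℝ, 0 < η → η ≤ 3 / 2 →
    ‖riemannZeta (1 + η)‖ ≤ B / η := by
  have hcont : ContinuousOn (fun η : ℝ => riemannZeta₁ (1 + η)) (Set.Icc 0 (3 / 2)) :=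
    (differentiable_riemannZeta₁.continuous.comp (by fun_prop)).continuousOn
  obtain ⟨B, hB⟩ := isCompact_Icc.exists_bound_of_continuousOn hcont
  refine ⟨max B 1, by positivity, fun η h0 h1 => ?_⟩
  have hne : (1 + η : ℂ) ≠ 1 := by simpa using h0.ne'
  rw [riemannZeta_eq_inv_sub_mul hne, norm_mul, norm_inv, add_sub_cancel_left, Complex.norm_real,
    Real.norm_of_nonneg h0.le, inv_mul_eq_div]
  gcongr
  exact (hB η ⟨h0.le, h1⟩).trans (le_max_left _ _)

lemma one_le_norm_riemannZeta_product {η : ℝ} (hη : 0 < η) (t : ℝ) :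
    1 ≤ ‖riemannZeta (1 + η)‖ ^ 3 * ‖riemannZeta (1 + η + Complex.I * t)‖ ^ 4 *
      ‖riemannZeta (1 + η + 2 * Complex.I * t)‖ := by
  have := DirichletCharacter.norm_LFunction_product_ge_one (N := 1) 1 hη t
  rw [DirichletCharacter.LFunctionTrivChar, DirichletCharacter.LFunction_modOne_eq,
    DirichletCharacter.LFunction_modOne_eq] at this
  simpa only [norm_mul, norm_pow] using this

/-- Lower bound for `ζ` to the right of the line `Re s = 1`. -/
lemma exists_le_norm_riemannZeta_right : ∃ A : ℝ, 0 < A ∧ ∀ k : ℝ, 0 < k → ∀ s : ℂ,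
    k ^ 4 / (|s.im| ^ (1 / 16 : ℝ)) ^ 5 ≤ s.re - 1 → s.re ≤ 5 / 2 → 2 ≤ |s.im| →
      k ^ 3 * A / (|s.im| ^ (1 / 16 : ℝ)) ^ 4 ≤ ‖riemannZeta s‖ := by
  obtain ⟨C, hC, hζ⟩ := exists_norm_riemannZeta_le
  obtain ⟨B, hB, hζB⟩ := exists_norm_riemannZeta_one_add_le
  set D : ℝ := 2 * C * B ^ 3
  have hD : 0 < D := by positivity
  set A : ℝ := 1 / (D + 1)
  have hA : 0 < A := by positivity
  have hAD : A ^ 4 * D ≤ 1 := by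
    have h1 : A ≤ 1 := by
      rw [div_le_one (by positivity)]; linarith
    have h2 : A ^ 4 ≤ A := by simpa using pow_le_pow_of_le_one hA.le h1 (show 1 ≤ 4 by norm_num)
    have h3 : A * D ≤ 1 := by
      simp only [A]; rw [div_mul_eq_mul_div, div_le_one (by positivity)]; linarith
    nlinarith
  refine ⟨A, hA, fun k hk s h1 h2 ht => ?_⟩
  set τ : ℝ := |s.im| ^ (1 / 16 : ℝ)
  have hτ : 0 < τ := Real.rpow_pos_of_pos (by linarith) _
  set η : ℝ := s.re - 1
  have hη : 0 < η := lt_of_lt_of_le (by positivity) h1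
  have hs : (1 + η + Complex.I * s.im : ℂ) = s := by
    apply Complex.ext <;> simp [η]
  have hprod := one_le_norm_riemannZeta_product hη s.im
  rw [hs] at hprod
  have hb1 := hζB η hη (by simp only [η]; linarith)
  have hb2 : ‖riemannZeta (1 + η + 2 * Complex.I * s.im)‖ ≤ C * (2 * τ) := by
    have him : (1 + η + 2 * Complex.I * s.im : ℂ).im = 2 * s.im := by simp
    have hre : (1 + η + 2 * Complex.I * s.im : ℂ).re = s.re := by simp [η]
    have h2im : |2 * s.im| = 2 * |s.im| := by rw [abs_mul]; simp
    refine (hζ _ ?_ ?_ ?_).trans ?_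
    · rw [hre]; simp only [η] at hη; linarith
    · rw [hre]; linarith
    · rw [him, h2im]; linarith
    · rw [him, h2im]
      gcongr
      exact rpow_one_div_sixteen_le_two_mul (abs_nonneg _) (by positivity) le_rfl
  set X : ℝ := ‖riemannZeta s‖
  have hX : 0 ≤ X := norm_nonneg _
  have h3 : 1 ≤ (B / η) ^ 3 * X ^ 4 * (C * (2 * τ)) := hprod.trans (by gcongr)
  have h4 : η ^ 3 ≤ X ^ 4 * (D * τ) := by
    have := mul_le_mul_of_nonneg_left h3 (pow_pos hη 3).le
    calc η ^ 3 ≤ η ^ 3 * ((B / η) ^ 3 * X ^ 4 * (C * (2 * τ))) := by linarith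
      _ = _ := by simp only [D]; field_simp
  have h5 : (k ^ 4 / τ ^ 5) ^ 3 ≤ X ^ 4 * (D * τ) := le_trans (by gcongr) h4
  refine le_of_pow_le_pow_left₀ (n := 4) (by norm_num) hX ?_
  have h6 : (k ^ 3 * A / τ ^ 4) ^ 4 * (D * τ) ≤ X ^ 4 * (D * τ) := by
    refine le_trans ?_ h5
    calc (k ^ 3 * A / τ ^ 4) ^ 4 * (D * τ) = (A ^ 4 * D) * (k ^ 4 / τ ^ 5) ^ 3 := by
          field_simp
      _ ≤ 1 * (k ^ 4 / τ ^ 5) ^ 3 := by gcongr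
      _ = _ := one_mul _
  exact le_of_mul_le_mul_right h6 (by positivity)

/-- Lower bound for `ζ` in a neighbourhood of the line `Re s = 1` of polynomially small width. -/
lemma exists_le_norm_riemannZeta : ∃ κ c : ℝ, 0 < κ ∧ κ ≤ 1 / 256 ∧ 0 < c ∧ ∀ s : ℂ,
    1 - κ / (|s.im| ^ (1 / 16 : ℝ)) ^ 5 ≤ s.re → s.re ≤ 5 / 2 → 2 ≤ |s.im| →
      c / (|s.im| ^ (1 / 16 : ℝ)) ^ 4 ≤ ‖riemannZeta s‖ := by
  obtain ⟨A, hA, hright⟩ := exists_le_norm_riemannZeta_right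
  obtain ⟨C, hC, hζ'⟩ := exists_norm_deriv_riemannZeta_le
  set k : ℝ := min (A / (4 * C)) (1 / 256)
  have hk : 0 < k := by positivity
  have hk1 : k ≤ 1 / 256 := min_le_right _ _
  have hkA : 4 * C * k ≤ A := by
    have : k ≤ A / (4 * C) := min_le_left _ _
    rwa [le_div_iff₀ (by positivity), mul_comm] at this
  have hk4 : k ^ 4 ≤ 1 / 256 := by
    have : k ^ 4 ≤ k := by
      simpa using pow_le_pow_of_le_one hk.le (by linarith) (show 1 ≤ 4 by norm_num)
    linarith
  refine ⟨k ^ 4, k ^ 3 * A / 2, by positivity, hk4, by positivity, fun s h1 h2 ht => ?_⟩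
  set τ : ℝ := |s.im| ^ (1 / 16 : ℝ) with hτdef
  have hτ1 : 1 ≤ τ := Real.one_le_rpow (by linarith) (by norm_num)
  have hτ : 0 < τ := by linarith
  have hd1 : k ^ 4 / τ ^ 5 ≤ 1 / 256 :=
    (div_le_self (by positivity) (one_le_pow₀ hτ1)).trans hk4
  have hd0 : 0 < k ^ 4 / τ ^ 5 := by positivity
  rcases le_total (k ^ 4 / τ ^ 5) (s.re - 1) with h | h
  · refine le_trans ?_ (hright k hk s h h2 ht)
    rw [← hτdef]
    gcongr
    have : 0 < k ^ 3 * A := by positivity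
    linarith
  · set w : ℂ := ⟨1 + k ^ 4 / τ ^ 5, s.im⟩
    have hw : k ^ 3 * A / τ ^ 4 ≤ ‖riemannZeta w‖ :=
      hright k hk w (by simp [w, hτdef]) (by simp only [w]; linarith) ht
    have hseg : ∀ z ∈ segment ℝ s w, 255 / 256 ≤ z.re ∧ z.re ≤ 5 / 2 ∧ z.im = s.im := by
      rintro z ⟨a, b, ha, hb, hab, rfl⟩
      have hre : (a • s + b • w).re = a * s.re + b * (1 + k ^ 4 / τ ^ 5) := by simp [w]
      have him : (a • s + b • w).im = a * s.im + b * s.im := by simp [w]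
      rw [hre, him, ← add_mul, hab, one_mul]
      obtain rfl : b = 1 - a := by linarith
      refine ⟨by nlinarith, by nlinarith, rfl⟩
    have hmv := (convex_segment s w).norm_image_sub_le_of_norm_deriv_le (f := riemannZeta)
      (C := C * τ) (x := s) (y := w) (fun z hz => by
        refine differentiableAt_riemannZeta ?_
        rintro rfl
        have := (hseg _ hz).2.2
        rw [← this] at ht
        norm_num at ht)
      (fun z hz => by
        obtain ⟨a1, a2, a3⟩ := hseg z hz
        have := hζ' z a1 a2 (by rw [a3]; exact ht)
        rwa [a3] at this)
      (left_mem_segment ℝ s w) (right_mem_segment ℝ s w)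
    have hws : ‖w - s‖ ≤ 2 * (k ^ 4 / τ ^ 5) := by
      have : w - s = ((1 + k ^ 4 / τ ^ 5 - s.re : ℝ) : ℂ) := by
        apply Complex.ext
        · rw [Complex.ofReal_re, Complex.sub_re]
        · rw [Complex.ofReal_im, Complex.sub_im, sub_self]
      rw [this, Complex.norm_real, Real.norm_of_nonneg (by linarith)]
      linarith
    have h7 : ‖riemannZeta w - riemannZeta s‖ ≤ k ^ 3 * A / 2 / τ ^ 4 := by
      calc ‖riemannZeta w - riemannZeta s‖ ≤ C * τ * (2 * (k ^ 4 / τ ^ 5)) :=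
            hmv.trans (by gcongr)
        _ = (4 * C * k) * (k ^ 3 / 2 / τ ^ 4) := by field_simp; ring
        _ ≤ A * (k ^ 3 / 2 / τ ^ 4) := by gcongr
        _ = _ := by ring
    have h8 := norm_sub_norm_le (riemannZeta w) (riemannZeta s)
    have h9 : k ^ 3 * A / τ ^ 4 = k ^ 3 * A / 2 / τ ^ 4 + k ^ 3 * A / 2 / τ ^ 4 := by ring
    linarith

/-- The analytic continuation of `-logDeriv ζ - ζ`, i.e. of the Dirichlet series `∑ (Λ(n) - 1) n ^ (-s)`,
to the set where `(s - 1) ζ(s)` does not vanish. -/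
noncomputable def zetaDefect (s : ℂ) : ℂ :=
  -(deriv riemannZeta₁ s / riemannZeta₁ s) - riemannZeta₀ s

lemma zetaDefect_eq {s : ℂ} (hs : s ≠ 1) (hz : riemannZeta s ≠ 0) :
    zetaDefect s = -(deriv riemannZeta s / riemannZeta s) - riemannZeta s := by
  have h := sub_ne_zero.2 hs
  have hz1 : riemannZeta₁ s ≠ 0 := by
    rw [riemannZeta₁_eq_sub_one_mul hs]; exact mul_ne_zero h hz
  rw [deriv_riemannZeta_eq_neg_inv_sub_sq_mul_add hs, zetaDefect]
  nth_rewrite 2 [riemannZeta_eq_inv_sub_add hs]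
  rw [riemannZeta_eq_inv_sub_mul hs]
  field_simp
  ring

lemma riemannZeta₁_ne_zero {s : ℂ} (hs : 1 ≤ s.re) : riemannZeta₁ s ≠ 0 := by
  by_cases h : s = 1
  · simp [h]
  · rw [riemannZeta₁_eq_sub_one_mul h]
    exact mul_ne_zero (sub_ne_zero.2 h) (riemannZeta_ne_zero_of_one_le_re hs)

lemma differentiableAt_zetaDefect {s : ℂ} (hs : riemannZeta₁ s ≠ 0) :
    DifferentiableAt ℂ zetaDefect s := by
  have h1 : DifferentiableAt ℂ (deriv riemannZeta₁) s := differentiable_riemannZeta₁.deriv s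
  have h2 := differentiable_riemannZeta₁ s
  have h3 := differentiable_riemannZeta₀ s
  unfold zetaDefect
  exact (h1.div h2 hs).neg.sub h3

lemma continuousOn_iteratedDeriv_zetaDefect :
    ContinuousOn (iteratedDeriv 2 zetaDefect) {s | riemannZeta₁ s ≠ 0} := by
  have hopen : IsOpen {s | riemannZeta₁ s ≠ 0} :=
    isOpen_ne_fun differentiable_riemannZeta₁.continuous continuous_const
  have : AnalyticOnNhd ℂ zetaDefect {s | riemannZeta₁ s ≠ 0} :=
    DifferentiableOn.analyticOnNhd
      (fun s hs => (differentiableAt_zetaDefect hs).differentiableWithinAt) hopen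
  rw [iteratedDeriv_eq_iterate]
  exact (this.iterated_deriv 2).continuousOn

lemma exists_norm_iteratedDeriv_zetaDefect_le_of_large : ∃ C : ℝ, 0 < C ∧ ∀ s : ℂ, 1 ≤ s.re →
    s.re ≤ 2 → 3 ≤ |s.im| → ‖iteratedDeriv 2 zetaDefect s‖ ≤ C * |s.im| ^ (15 / 16 : ℝ) := by
  obtain ⟨κ, c, hκ, hκ1, hc, hlow⟩ := exists_le_norm_riemannZeta
  obtain ⟨C, hC, hζ⟩ := exists_norm_riemannZeta_le
  obtain ⟨C', hC', hζ'⟩ := exists_norm_deriv_riemannZeta_le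
  set K : ℝ := C' / c + C
  refine ⟨2 * (K * 2 ^ 5) / (κ / 64) ^ 2, by positivity, fun s h1 h2 ht => ?_⟩
  set τ : ℝ := |s.im| ^ (1 / 16 : ℝ) with hτdef
  have hτ1 : 1 ≤ τ := Real.one_le_rpow (by linarith) (by norm_num)
  have hτ : 0 < τ := by linarith
  set ρ : ℝ := κ / 64 / τ ^ 5 with hρ
  have hρ0 : 0 < ρ := by positivity
  have hρ1 : ρ ≤ 1 / 256 :=
    (div_le_self (by positivity) (one_le_pow₀ hτ1)).trans (by linarith)
  have hball : ∀ z ∈ Metric.closedBall s ρ, z ≠ 1 ∧ riemannZeta z ≠ 0 ∧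
      ‖zetaDefect z‖ ≤ K * 2 ^ 5 * τ ^ 5 := by
    intro z hz
    rw [mem_closedBall_iff_norm] at hz
    have hr := abs_le.1 ((Complex.abs_re_le_norm (z - s)).trans hz)
    have hi := (Complex.abs_im_le_norm (z - s)).trans hz
    simp only [Complex.sub_re, Complex.sub_im] at hr hi
    have h3 := abs_sub_abs_le_abs_sub z.im s.im
    have h4 := abs_sub_abs_le_abs_sub s.im z.im
    rw [abs_sub_comm] at h4
    have hz2 : 2 ≤ |z.im| := by linarith
    set τz : ℝ := |z.im| ^ (1 / 16 : ℝ) with hτzdef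
    have hτz1 : 1 ≤ τz := Real.one_le_rpow (by linarith) (by norm_num)
    have hτz0 : 0 < τz := by linarith
    have hτz : τz ≤ 2 * τ :=
      rpow_one_div_sixteen_le_two_mul (abs_nonneg _) (abs_nonneg _) (by linarith)
    have hρz : ρ ≤ κ / τz ^ 5 := by
      have h5 : τz ^ 5 ≤ (2 * τ) ^ 5 := by gcongr
      have h6 : τz ^ 5 ≤ 64 * τ ^ 5 := h5.trans (by rw [mul_pow]; gcongr; norm_num)
      calc ρ = κ / (64 * τ ^ 5) := by rw [hρ, div_div]
        _ ≤ κ / τz ^ 5 := by gcongr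
    have hz1 : z ≠ 1 := by
      rintro rfl
      norm_num at hz2
    have b1 : c / τz ^ 4 ≤ ‖riemannZeta z‖ := hlow z (by linarith) (by linarith) hz2
    have b2 : ‖riemannZeta z‖ ≤ C * τz := hζ z (by linarith) (by linarith) (by linarith)
    have b3 : ‖deriv riemannZeta z‖ ≤ C' * τz := hζ' z (by linarith) (by linarith) hz2
    have b0 : 0 < c / τz ^ 4 := by positivity
    have hz0 : riemannZeta z ≠ 0 := norm_pos_iff.1 (b0.trans_le b1)
    refine ⟨hz1, hz0, ?_⟩
    rw [zetaDefect_eq hz1 hz0]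
    calc ‖-(deriv riemannZeta z / riemannZeta z) - riemannZeta z‖
        ≤ ‖deriv riemannZeta z‖ / ‖riemannZeta z‖ + ‖riemannZeta z‖ := by
          refine (norm_sub_le _ _).trans ?_
          rw [norm_neg, norm_div]
      _ ≤ C' * τz / (c / τz ^ 4) + C * τz := by gcongr
      _ = C' / c * τz ^ 5 + C * τz := by field_simp
      _ ≤ C' / c * τz ^ 5 + C * τz ^ 5 := by
          gcongr
          exact le_self_pow₀ hτz1 (by norm_num)
      _ = K * τz ^ 5 := by simp only [K]; ring
      _ ≤ K * (2 * τ) ^ 5 := by gcongr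
      _ = _ := by ring
  have key := Complex.norm_iteratedDeriv_le_of_forall_mem_sphere_norm_le (f := zetaDefect) (c := s)
    (R := ρ) (C := K * 2 ^ 5 * τ ^ 5) 2 hρ0
    (DifferentiableOn.diffContOnCl (by
      rw [closure_ball _ hρ0.ne']
      intro z hz
      obtain ⟨a, b, -⟩ := hball z hz
      refine (differentiableAt_zetaDefect ?_).differentiableWithinAt
      rw [riemannZeta₁_eq_sub_one_mul a]
      exact mul_ne_zero (sub_ne_zero.2 a) b))
    (fun z hz => (hball z (Metric.sphere_subset_closedBall hz)).2.2)
  refine key.trans (le_of_eq ?_)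
  have : |s.im| ^ (15 / 16 : ℝ) = τ ^ 15 := by
    rw [hτdef, ← Real.rpow_natCast, ← Real.rpow_mul (abs_nonneg _)]
    norm_num
  rw [this, hρ]
  simp only [Nat.factorial]
  push_cast
  field_simp

lemma exists_norm_iteratedDeriv_zetaDefect_le : ∃ C : ℝ, 0 < C ∧ ∀ s : ℂ, 1 ≤ s.re →
    s.re ≤ 2 → ‖iteratedDeriv 2 zetaDefect s‖ ≤ C * (1 + |s.im|) ^ (15 / 16 : ℝ) := by
  obtain ⟨C, hC, hlarge⟩ := exists_norm_iteratedDeriv_zetaDefect_le_of_large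
  have hcpt : IsCompact (Set.Icc (1 : ℝ) 2 ×ℂ Set.Icc (-3 : ℝ) 3) :=
    isCompact_Icc.reProdIm isCompact_Icc
  obtain ⟨B, hB⟩ := hcpt.exists_bound_of_continuousOn
    (continuousOn_iteratedDeriv_zetaDefect.mono fun z hz => riemannZeta₁_ne_zero hz.1.1)
  refine ⟨max C B, lt_max_of_lt_left hC, fun s h1 h2 => ?_⟩
  have hC0 : 0 ≤ max C B := (lt_max_of_lt_left hC).le
  rcases le_total 3 |s.im| with h | h
  · refine (hlarge s h1 h2 h).trans ?_
    gcongr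
    · exact le_max_left _ _
    · linarith
  · refine (hB s ⟨⟨h1, h2⟩, abs_le.1 h⟩).trans ?_
    have : 1 ≤ (1 + |s.im|) ^ (15 / 16 : ℝ) :=
      Real.one_le_rpow (by linarith [abs_nonneg s.im]) (by norm_num)
    exact (le_max_right C B).trans (le_mul_of_one_le_right hC0 this)

open MeasureTheory ArithmeticFunction

/-- The coefficients `Λ(n) - 1`. -/
noncomputable def mangoldtSubOne (n : ℕ) : ℂ := (vonMangoldt n : ℂ) - 1

lemma LSeriesSummable_mangoldtSubOne {s : ℂ} (hs : 1 < s.re) :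
    LSeriesSummable mangoldtSubOne s :=
  (LSeriesSummable_vonMangoldt hs).sub (LSeriesSummable_one_iff.2 hs)

lemma LSeries_mangoldtSubOne_eq {s : ℂ} (hs : 1 < s.re) :
    LSeries mangoldtSubOne s = zetaDefect s := by
  have h1 : s ≠ 1 := by rintro rfl; simp at hs
  rw [zetaDefect_eq h1 (riemannZeta_ne_zero_of_one_lt_re hs), ← LSeries_one_eq_riemannZeta hs,
    ← neg_div]
  have := LSeries_sub (LSeriesSummable_vonMangoldt hs) (LSeriesSummable_one_iff.2 hs)
  rw [LSeries_vonMangoldt_eq_deriv_riemannZeta_div hs, ← LSeries_one_eq_riemannZeta hs] at this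
  exact this

lemma abscissaOfAbsConv_mangoldtSubOne_lt {s : ℂ} (hs : 1 < s.re) :
    LSeries.abscissaOfAbsConv mangoldtSubOne < s.re := by
  refine lt_of_le_of_lt (LSeries.abscissaOfAbsConv_le_of_forall_lt_LSeriesSummable (x := 1)
    fun y hy => LSeriesSummable_mangoldtSubOne (by simpa using hy)) ?_
  exact_mod_cast hs

/-- The coefficients `(Λ(n) - 1) (log n) ^ 2`. -/
noncomputable def mangoldtSubOneLogSq : ℕ → ℂ := LSeries.logMul (LSeries.logMul mangoldtSubOne)

lemma mangoldtSubOneLogSq_eq (n : ℕ) :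
    mangoldtSubOneLogSq n = (((vonMangoldt n - 1) * Real.log n ^ 2 : ℝ) : ℂ) := by
  simp only [mangoldtSubOneLogSq, LSeries.logMul, mangoldtSubOne]
  push_cast
  ring

lemma LSeries_mangoldtSubOneLogSq_eq {s : ℂ} (hs : 1 < s.re) :
    LSeries mangoldtSubOneLogSq s = iteratedDeriv 2 zetaDefect s := by
  have h1 := LSeries_iteratedDeriv 2 (abscissaOfAbsConv_mangoldtSubOne_lt hs)
  have h2 : LSeries mangoldtSubOne =ᶠ[𝓝 s] zetaDefect := by
    filter_upwards [(isOpen_lt continuous_const Complex.continuous_re).mem_nhds hs] with z hz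
    exact LSeries_mangoldtSubOne_eq hz
  rw [h2.iteratedDeriv_eq 2] at h1
  rw [h1]
  simp [mangoldtSubOneLogSq]

lemma LSeriesSummable_mangoldtSubOneLogSq {s : ℂ} (hs : 1 < s.re) :
    LSeriesSummable mangoldtSubOneLogSq s := by
  refine LSeriesSummable_logMul_of_lt_re ?_
  rw [LSeries.abscissaOfAbsConv_logMul]
  exact abscissaOfAbsConv_mangoldtSubOne_lt hs

/-- The weight `max 0 (1 - u)` on `(0, ∞)`, in a form adapted to Mellin transforms. -/
noncomputable def hatWeight (u : ℝ) : ℂ :=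
  (Set.Ioc (0 : ℝ) 1).indicator (fun _ => (1 : ℂ)) u -
    (Set.Ioc (0 : ℝ) 1).indicator (fun t : ℝ => (t : ℂ) ^ (1 : ℂ)) u

lemma hatWeight_eq {u : ℝ} (hu : 0 < u) : hatWeight u = ((max 0 (1 - u) : ℝ) : ℂ) := by
  by_cases h : u ≤ 1
  · have h' : u ∈ Set.Ioc (0 : ℝ) 1 := ⟨hu, h⟩
    rw [hatWeight, Set.indicator_of_mem h', Set.indicator_of_mem h',
      max_eq_right (by linarith)]
    simp
  · have h' : u ∉ Set.Ioc (0 : ℝ) 1 := fun hh => h hh.2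
    rw [hatWeight, Set.indicator_of_notMem h', Set.indicator_of_notMem h',
      max_eq_left (by linarith)]
    simp

lemma continuousAt_hatWeight {u : ℝ} (hu : 0 < u) : ContinuousAt hatWeight u := by
  have h : (fun u : ℝ => ((max 0 (1 - u) : ℝ) : ℂ)) =ᶠ[𝓝 u] hatWeight := by
    filter_upwards [lt_mem_nhds hu] with v hv using (hatWeight_eq hv).symm
  refine ContinuousAt.congr ?_ h
  fun_prop

lemma hasMellin_hatWeight {s : ℂ} (hs : 0 < s.re) :
    HasMellin hatWeight s (1 / s - 1 / (s + 1)) := by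
  have h1 := hasMellin_one_Ioc hs
  have h2 := hasMellin_cpow_Ioc 1 (s := s) (by simp; linarith)
  have := hasMellin_sub h1.1 h2.1
  rwa [h1.2, h2.2] at this

lemma norm_one_div_sub_one_div_le {c : ℝ} (hc : 1 ≤ c) (y : ℝ) :
    ‖1 / (c + y * Complex.I) - 1 / (c + y * Complex.I + 1)‖ ≤ 2 * (1 + |y|) ^ (-2 : ℝ) := by
  set s : ℂ := c + y * Complex.I with hs
  have hre : s.re = c := by simp [hs]
  have him : s.im = y := by simp [hs]
  have h0 : s ≠ 0 := by intro h; rw [h] at hre; simp at hre; linarith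
  have h1 : s + 1 ≠ 0 := by
    intro h; have := congrArg Complex.re h; simp [hre] at this; linarith
  have e : 1 / s - 1 / (s + 1) = (s * (s + 1))⁻¹ := by field_simp; ring
  have n1 : 1 + y ^ 2 ≤ ‖s‖ ^ 2 := by
    rw [← Complex.normSq_eq_norm_sq, Complex.normSq_apply, hre, him]; nlinarith
  have n2 : ‖s‖ ≤ ‖s + 1‖ := by
    rw [← sq_le_sq₀ (norm_nonneg _) (norm_nonneg _), ← Complex.normSq_eq_norm_sq,
      ← Complex.normSq_eq_norm_sq, Complex.normSq_apply, Complex.normSq_apply]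
    simp only [Complex.add_re, Complex.add_im, Complex.one_re, Complex.one_im, hre, him]
    nlinarith
  rw [e, norm_inv, norm_mul]
  have n3 : (1 + |y|) ^ 2 / 2 ≤ ‖s‖ * ‖s + 1‖ := by
    have : ‖s‖ * ‖s‖ ≤ ‖s‖ * ‖s + 1‖ := by gcongr
    nlinarith [sq_abs y, sq_nonneg (1 - |y|)]
  have hp : 0 < (1 + |y|) ^ 2 := by positivity
  calc (‖s‖ * ‖s + 1‖)⁻¹ ≤ ((1 + |y|) ^ 2 / 2)⁻¹ := by gcongr
    _ = 2 * (1 + |y|) ^ (-2 : ℝ) := by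
      rw [Real.rpow_neg (by positivity), inv_div]
      norm_cast

lemma continuous_one_div_sub_one_div {c : ℝ} (hc : 1 ≤ c) :
    Continuous fun y : ℝ =>
      (1 / (c + y * Complex.I) - 1 / (c + y * Complex.I + 1) : ℂ) := by
  have h0 : ∀ y : ℝ, (c + y * Complex.I : ℂ) ≠ 0 := fun y h => by
    have := congrArg Complex.re h; simp at this; linarith
  have h1 : ∀ y : ℝ, (c + y * Complex.I + 1 : ℂ) ≠ 0 := fun y h => by
    have := congrArg Complex.re h; simp at this; linarith
  exact (continuous_const.div (by fun_prop) h0).sub (continuous_const.div (by fun_prop) h1)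

lemma integrable_one_add_abs_rpow {r : ℝ} (hr : r < -1) :
    Integrable fun y : ℝ => (1 + |y|) ^ r := by
  have := integrable_one_add_norm (E := ℝ) (μ := volume) (r := -r) (by simp; linarith)
  simpa using this

lemma integrable_one_div_sub_one_div {c : ℝ} (hc : 1 ≤ c) :
    Integrable fun y : ℝ =>
      (1 / (c + y * Complex.I) - 1 / (c + y * Complex.I + 1) : ℂ) :=
  ((integrable_one_add_abs_rpow (r := -2) (by norm_num)).const_mul 2).mono'
    (continuous_one_div_sub_one_div hc).aestronglyMeasurable
    (Eventually.of_forall fun y => norm_one_div_sub_one_div_le hc y)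

/-- Perron's formula for the hat weight. -/
lemma integral_cpow_mul_eq_hatWeight {c : ℝ} (hc : 1 ≤ c) {u : ℝ} (hu : 0 < u) :
    ∫ y : ℝ, (u : ℂ) ^ (-(c + y * Complex.I : ℂ)) *
      (1 / (c + y * Complex.I) - 1 / (c + y * Complex.I + 1)) = 2 * π * hatWeight u := by
  have hm : ∀ y : ℝ, mellin hatWeight (c + y * Complex.I) =
      1 / (c + y * Complex.I) - 1 / (c + y * Complex.I + 1) := fun y =>
    (hasMellin_hatWeight (by simp; linarith)).2
  have key := mellinInv_mellin_eq c hatWeight hu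
    (hasMellin_hatWeight (s := (c : ℂ)) (by simp; linarith)).1
    ((integrable_one_div_sub_one_div hc).congr (Eventually.of_forall fun y => (hm y).symm))
    (continuousAt_hatWeight hu)
  simp only [mellinInv, hm, smul_eq_mul] at key
  rw [← key, Complex.real_smul]
  generalize (∫ y : ℝ, (u : ℂ) ^ (-(c + y * Complex.I : ℂ)) *
      (1 / (c + y * Complex.I) - 1 / (c + y * Complex.I + 1))) = I
  push_cast
  have : (π : ℂ) ≠ 0 := by exact_mod_cast Real.pi_ne_zero
  field_simp

lemma exists_norm_tsum_hatWeight_le : ∃ C : ℝ, 0 < C ∧ ∀ x : ℝ, 3 ≤ x →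
    ‖∑' n : ℕ, mangoldtSubOneLogSq n * hatWeight (n / x)‖ ≤ C * x := by
  obtain ⟨C, hC, hbd⟩ := exists_norm_iteratedDeriv_zetaDefect_le
  set J : ℝ := ∫ y : ℝ, (1 + |y|) ^ (-(17 / 16) : ℝ) with hJ
  have hJi := integrable_one_add_abs_rpow (r := -(17 / 16)) (by norm_num)
  have hJ0 : 0 ≤ J := integral_nonneg fun y => by positivity
  refine ⟨C * 2 * Real.exp 1 * J + 1, by positivity, fun x hx => ?_⟩
  have hx0 : 0 < x := by linarith
  have hlog : 1 ≤ Real.log x := by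
    rw [Real.le_log_iff_exp_le hx0]
    linarith [Real.exp_one_lt_d9]
  set c : ℝ := 1 + 1 / Real.log x with hcdef
  have hc1 : 1 < c := by simp only [hcdef]; linarith [one_div_pos.2 (zero_lt_one.trans_le hlog)]
  have hc2 : c ≤ 2 := by
    have : 1 / Real.log x ≤ 1 := by rw [div_le_one (by linarith)]; exact hlog
    simp only [hcdef]; linarith
  have hxc : x ^ c = Real.exp 1 * x := by
    rw [hcdef, Real.rpow_add hx0, Real.rpow_one, Real.rpow_def_of_pos hx0, mul_one_div_cancel
      (by linarith), mul_comm]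
  set k : ℝ → ℂ := fun y => 1 / (c + y * Complex.I) - 1 / (c + y * Complex.I + 1)
  have hk := integrable_one_div_sub_one_div hc1.le
  set F : ℕ → ℝ → ℂ := fun n y =>
    LSeries.term mangoldtSubOneLogSq (c + y * Complex.I) n * (x : ℂ) ^ (c + y * Complex.I : ℂ) * k y
  have hre : ∀ y : ℝ, (c + y * Complex.I : ℂ).re = c := by simp
  have hnorm : ∀ n y, ‖F n y‖ = ‖LSeries.term mangoldtSubOneLogSq c n‖ * x ^ c * ‖k y‖ := by
    intro n y
    simp only [F, norm_mul]
    rw [Complex.norm_cpow_eq_rpow_re_of_pos hx0, hre, LSeries.norm_term_eq, LSeries.norm_term_eq,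
      hre, Complex.ofReal_re]
  have hFcont : ∀ n, Continuous (F n) := by
    intro n
    refine (Continuous.mul ?_ ?_).mul (continuous_one_div_sub_one_div hc1.le)
    · rcases eq_or_ne n 0 with rfl | hn
      · simp only [LSeries.term_zero]; exact continuous_const
      · simp only [LSeries.term_of_ne_zero hn]
        have hn' : (n : ℂ) ≠ 0 := by exact_mod_cast hn
        refine continuous_const.div (Continuous.const_cpow (by fun_prop) (Or.inl hn')) ?_
        intro y
        simp [Complex.cpow_eq_zero_iff, hn']
    · exact Continuous.const_cpow (by fun_prop) (Or.inl (by exact_mod_cast hx0.ne'))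
  have hFint : ∀ n, Integrable (F n) := fun n =>
    (hk.norm.const_mul (‖LSeries.term mangoldtSubOneLogSq c n‖ * x ^ c)).mono'
      (hFcont n).aestronglyMeasurable (Eventually.of_forall fun y => (hnorm n y).le)
  have hsumm : Summable fun n => ∫ y, ‖F n y‖ := by
    simp only [hnorm, integral_const_mul]
    exact ((LSeriesSummable_mangoldtSubOneLogSq (s := c) (by simpa using hc1)).norm.mul_right
      _).mul_right _
  have hhs := hasSum_integral_of_summable_integral_norm hFint hsumm
  have hFn : ∀ n, ∫ y, F n y = 2 * π * (mangoldtSubOneLogSq n * hatWeight (n / x)) := by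
    intro n
    rcases eq_or_ne n 0 with rfl | hn
    · simp [F, mangoldtSubOneLogSq_eq]
    · have hn0 : (0 : ℝ) < n := by exact_mod_cast Nat.pos_of_ne_zero hn
      have := integral_cpow_mul_eq_hatWeight hc1.le (u := n / x) (by positivity)
      rw [mul_left_comm, ← this, ← integral_const_mul]
      refine integral_congr_ae (Eventually.of_forall fun y => ?_)
      simp only [F, LSeries.term_of_ne_zero hn, k]
      rw [Complex.ofReal_div, Complex.div_cpow_ofReal_nonneg hn0.le hx0.le,
        Complex.cpow_neg (x : ℂ), Complex.cpow_neg, Complex.ofReal_natCast]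
      field_simp
  have hbound : ‖∫ y, ∑' n, F n y‖ ≤ C * 2 * Real.exp 1 * J * x := by
    calc ‖∫ y, ∑' n, F n y‖ ≤ ∫ y, (C * 2 * Real.exp 1 * x) * (1 + |y|) ^ (-(17 / 16) : ℝ) := by
          refine norm_integral_le_of_norm_le (hJi.const_mul _) (Eventually.of_forall fun y => ?_)
          simp only [F, tsum_mul_right]
          rw [norm_mul, norm_mul, Complex.norm_cpow_eq_rpow_re_of_pos hx0, hre, hxc]
          have h1 : ‖∑' n, LSeries.term mangoldtSubOneLogSq (c + y * Complex.I) n‖ ≤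
              C * (1 + |y|) ^ (15 / 16 : ℝ) := by
            have e := LSeries_mangoldtSubOneLogSq_eq (s := c + y * Complex.I) (by rw [hre]; exact hc1)
            rw [LSeries] at e
            rw [e]
            have := hbd (c + y * Complex.I) (by rw [hre]; exact hc1.le) (by rw [hre]; exact hc2)
            simpa using this
          have h2 : ‖k y‖ ≤ 2 * (1 + |y|) ^ (-2 : ℝ) := norm_one_div_sub_one_div_le hc1.le y
          calc _ ≤ C * (1 + |y|) ^ (15 / 16 : ℝ) * (Real.exp 1 * x) * (2 * (1 + |y|) ^ (-2 : ℝ)) := by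
                gcongr
            _ = (C * 2 * Real.exp 1 * x) * ((1 + |y|) ^ (15 / 16 : ℝ) * (1 + |y|) ^ (-2 : ℝ)) := by
                ring
            _ = _ := by
                rw [← Real.rpow_add (by positivity)]
                norm_num
      _ = _ := by rw [integral_const_mul, ← hJ]; ring
  rw [← hhs.tsum_eq] at hbound
  simp only [hFn, tsum_mul_left] at hbound
  rw [norm_mul] at hbound
  have h2π : 1 ≤ ‖(2 * π : ℂ)‖ := by
    rw [norm_mul, Complex.norm_ofNat, Complex.norm_real, Real.norm_of_nonneg Real.pi_pos.le]
    linarith [Real.two_le_pi]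
  calc _ ≤ _ := le_mul_of_one_le_left (norm_nonneg _) h2π
    _ ≤ _ := hbound
    _ ≤ _ := by gcongr; linarith

/-- The summatory function of `a`. -/
noncomputable def partialSum (a : ℕ → ℝ) (x : ℝ) : ℝ := ∑ n ∈ Finset.Icc 0 ⌊x⌋₊, a n

/-- The first Riesz sum of `a`. -/
noncomputable def rieszSum (a : ℕ → ℝ) (x : ℝ) : ℝ := ∑ n ∈ Finset.Icc 0 ⌊x⌋₊, a n * (x - n)

lemma rieszSum_add_sub (a : ℕ → ℝ) {x h : ℝ} (hh : 0 ≤ h) :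
    rieszSum a (x + h) - rieszSum a x = h * partialSum a x +
      ∑ n ∈ Finset.Icc 0 ⌊x + h⌋₊ \ Finset.Icc 0 ⌊x⌋₊, a n * (x + h - n) := by
  have hsub : Finset.Icc 0 ⌊x⌋₊ ⊆ Finset.Icc 0 ⌊x + h⌋₊ :=
    Finset.Icc_subset_Icc le_rfl (Nat.floor_mono (by linarith))
  simp only [rieszSum, partialSum]
  rw [← Finset.sum_sdiff hsub, Finset.mul_sum, add_sub_assoc, ← Finset.sum_sub_distrib, add_comm]
  congr 1
  exact Finset.sum_congr rfl fun n _ => by ring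

lemma mul_partialSum_le {a : ℕ → ℝ} (ha : ∀ n, 0 ≤ a n) {x h : ℝ} (hx : 0 ≤ x) (hh : 0 ≤ h) :
    h * partialSum a x ≤ rieszSum a (x + h) - rieszSum a x := by
  rw [rieszSum_add_sub a hh]
  refine le_add_of_nonneg_right (Finset.sum_nonneg fun n hn => mul_nonneg (ha n) ?_)
  have hn' : n ≤ ⌊x + h⌋₊ := (Finset.mem_Icc.1 (Finset.mem_sdiff.1 hn).1).2
  have := (Nat.le_floor_iff (by linarith)).1 hn'
  linarith

lemma le_mul_partialSum {a : ℕ → ℝ} (ha : ∀ n, 0 ≤ a n) {x h : ℝ} (hx : 0 ≤ x) (hh : 0 ≤ h) :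
    rieszSum a (x + h) - rieszSum a x ≤ h * partialSum a (x + h) := by
  have hsub : Finset.Icc 0 ⌊x⌋₊ ⊆ Finset.Icc 0 ⌊x + h⌋₊ :=
    Finset.Icc_subset_Icc le_rfl (Nat.floor_mono (by linarith))
  rw [rieszSum_add_sub a hh]
  simp only [partialSum]
  rw [← Finset.sum_sdiff hsub, mul_add, add_comm]
  gcongr
  rw [Finset.mul_sum]
  refine Finset.sum_le_sum fun n hn => ?_
  have hn' : x ≤ n := by
    have h1 := (Finset.mem_sdiff.1 hn).2
    rw [Finset.mem_Icc] at h1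
    push Not at h1
    exact ((Nat.floor_lt hx).1 (h1 (Nat.zero_le _))).le
  rw [mul_comm h]
  exact mul_le_mul_of_nonneg_left (by linarith) (ha n)

lemma partialSum_log_sq_le {x h : ℝ} (hx : 1 ≤ x) (hh : 0 ≤ h) :
    partialSum (fun n => Real.log n ^ 2) (x + h) ≤
      partialSum (fun n => Real.log n ^ 2) x + (h + 1) * Real.log (x + h) ^ 2 := by
  have hf : ⌊x⌋₊ ≤ ⌊x + h⌋₊ := Nat.floor_mono (by linarith)
  have hsub : Finset.Icc 0 ⌊x⌋₊ ⊆ Finset.Icc 0 ⌊x + h⌋₊ := Finset.Icc_subset_Icc le_rfl hf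
  simp only [partialSum]
  rw [← Finset.sum_sdiff hsub, add_comm]
  gcongr
  calc _ ≤ ∑ n ∈ Finset.Icc 0 ⌊x + h⌋₊ \ Finset.Icc 0 ⌊x⌋₊, Real.log (x + h) ^ 2 := by
        refine Finset.sum_le_sum fun n hn => ?_
        rcases Nat.eq_zero_or_pos n with rfl | hn0
        · simp; positivity
        · have hn' : n ≤ ⌊x + h⌋₊ := (Finset.mem_Icc.1 (Finset.mem_sdiff.1 hn).1).2
          have := (Nat.le_floor_iff (by linarith)).1 hn'
          have h1 : (1 : ℝ) ≤ n := by exact_mod_cast hn0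
          have := Real.log_nonneg h1
          gcongr
    _ ≤ _ := by
        rw [Finset.sum_const, nsmul_eq_mul, Finset.card_sdiff_of_subset hsub]
        gcongr
        simp only [Nat.card_Icc]
        rw [Nat.cast_sub (by omega)]
        push_cast
        have h1 := Nat.floor_le (a := x + h) (by linarith)
        have h2 := Nat.lt_floor_add_one x
        linarith

lemma exists_abs_rieszSum_le : ∃ C : ℝ, 0 < C ∧ ∀ x : ℝ, 3 ≤ x →
    |rieszSum (fun n => vonMangoldt n * Real.log n ^ 2) x -
      rieszSum (fun n => Real.log n ^ 2) x| ≤ C * x ^ 2 := by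
  obtain ⟨C, hC, h⟩ := exists_norm_tsum_hatWeight_le
  refine ⟨C, hC, fun x hx => ?_⟩
  have hx0 : 0 < x := by linarith
  have key : ((rieszSum (fun n => vonMangoldt n * Real.log n ^ 2) x -
      rieszSum (fun n => Real.log n ^ 2) x : ℝ) : ℂ) =
      x * ∑' n : ℕ, mangoldtSubOneLogSq n * hatWeight (n / x) := by
    rw [tsum_eq_sum (s := Finset.Icc 0 ⌊x⌋₊)]
    · rw [Finset.mul_sum]
      simp only [rieszSum]
      rw [← Finset.sum_sub_distrib, Complex.ofReal_sum]
      refine Finset.sum_congr rfl fun n hn => ?_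
      rw [mangoldtSubOneLogSq_eq]
      rcases Nat.eq_zero_or_pos n with rfl | hn0
      · simp
      · have hn' := (Nat.le_floor_iff hx0.le).1 (Finset.mem_Icc.1 hn).2
        have hn1 : (0 : ℝ) < n := by exact_mod_cast hn0
        rw [hatWeight_eq (by positivity), max_eq_right
          (by rw [sub_nonneg, div_le_one hx0]; exact hn')]
        norm_cast
        field_simp
    · intro n hn
      rw [Finset.mem_Icc] at hn
      push Not at hn
      have hn' := (Nat.floor_lt hx0.le).1 (hn (Nat.zero_le _))
      rw [hatWeight_eq (div_pos (hx0.trans hn') hx0), max_eq_left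
        (by rw [sub_nonpos, one_le_div hx0]; exact hn'.le)]
      simp
  have := congrArg norm key
  rw [Complex.norm_real, Real.norm_eq_abs, norm_mul, Complex.norm_real,
    Real.norm_of_nonneg hx0.le] at this
  rw [this]
  calc x * _ ≤ x * (C * x) := by gcongr; exact h x hx
    _ = _ := by ring

/-- The summatory function of `(Λ(n) - 1) (log n) ^ 2` is `O(x log x)`. -/
lemma exists_abs_partialSum_le : ∃ C : ℝ, 0 < C ∧ ∀ x : ℝ, 8 ≤ x →
    |partialSum (fun n => (vonMangoldt n - 1) * Real.log n ^ 2) x| ≤ C * (x * Real.log x) := by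
  obtain ⟨C, hC, hS⟩ := exists_abs_rieszSum_le
  set b : ℕ → ℝ := fun n => vonMangoldt n * Real.log n ^ 2 with hb
  set l : ℕ → ℝ := fun n => Real.log n ^ 2 with hl
  have hb0 : ∀ n, 0 ≤ b n := fun n => mul_nonneg vonMangoldt_nonneg (sq_nonneg _)
  have hl0 : ∀ n, 0 ≤ l n := fun n => sq_nonneg _
  refine ⟨8 + 5 * C, by positivity, fun x hx => ?_⟩
  have hx0 : 0 < x := by linarith
  have hlog : 2 ≤ Real.log x := by
    have h1 : Real.log 8 ≤ Real.log x := Real.log_le_log (by norm_num) hx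
    have h2 : Real.log 8 = 3 * Real.log 2 := by
      rw [show (8 : ℝ) = 2 ^ 3 by norm_num, Real.log_pow]; norm_num
    linarith [Real.log_two_gt_d9]
  set h : ℝ := x / Real.log x with hh
  have hh1 : 1 ≤ h := by
    rw [hh, one_le_div (by linarith)]
    linarith [Real.log_le_sub_one_of_pos hx0]
  have hhx : h ≤ x / 2 := by rw [hh]; gcongr
  have hhl : h * Real.log x = x := by rw [hh]; field_simp
  have hD : partialSum (fun n => (vonMangoldt n - 1) * Real.log n ^ 2) x =
      partialSum b x - partialSum l x := by
    simp only [partialSum, hb, hl]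
    rw [← Finset.sum_sub_distrib]
    exact Finset.sum_congr rfl fun n _ => by ring
  have hl2 : Real.log (x + h) ≤ 2 * Real.log x := by
    have : Real.log (x + h) ≤ Real.log (x ^ 2) := Real.log_le_log (by linarith) (by nlinarith)
    rwa [Real.log_pow] at this
  have hl3 : 0 ≤ Real.log (x + h) := Real.log_nonneg (by linarith)
  have hS0 := abs_le.1 (hS x (by linarith))
  have hxh : x * h * Real.log x = x ^ 2 := by rw [mul_assoc, hhl]; ring
  have hbig : (h + 1) * Real.log (x + h) ^ 2 ≤ 8 * (x * Real.log x) := by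
    calc _ ≤ (2 * h) * (2 * Real.log x) ^ 2 := by gcongr; linarith
      _ = 8 * ((h * Real.log x) * Real.log x) := by ring
      _ = _ := by rw [hhl]
  rw [hD, abs_le]
  constructor
  · have e1 := le_mul_partialSum hb0 (x := x - h) (h := h) (by linarith) (by linarith)
    have e2 := mul_partialSum_le hl0 (x := x - h) (h := h) (by linarith) (by linarith)
    have e3 := partialSum_log_sq_le (x := x - h) (h := h) (by linarith) (by linarith)
    have e4 := abs_le.1 (hS (x - h) (by linarith))
    rw [sub_add_cancel] at e1 e2 e3
    have e5 : (h + 1) * Real.log x ^ 2 ≤ 8 * (x * Real.log x) := by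
      refine le_trans ?_ hbig
      gcongr
      linarith
    have e6 : C * (x - h) ^ 2 ≤ C * x ^ 2 := by gcongr <;> linarith
    have e7 : h * (partialSum l (x - h) - partialSum b x) ≤ h * (2 * C * (x * Real.log x)) := by
      have : h * (2 * C * (x * Real.log x)) = 2 * C * x ^ 2 := by rw [← hxh]; ring
      rw [this]
      linarith
    have e8 := le_of_mul_le_mul_left e7 (by linarith)
    have : 0 ≤ C * (x * Real.log x) := by positivity
    simp only [hl] at e3 e8 ⊢
    linarith
  · have e1 := mul_partialSum_le hb0 (x := x) (h := h) (by linarith) (by linarith)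
    have e2 := le_mul_partialSum hl0 (x := x) (h := h) (by linarith) (by linarith)
    have e3 := partialSum_log_sq_le (x := x) (h := h) (by linarith) (by linarith)
    have e4 := abs_le.1 (hS (x + h) (by linarith))
    have e6 : C * (x + h) ^ 2 ≤ C * (2 * x) ^ 2 := by gcongr; linarith
    have e7 : h * (partialSum b x - partialSum l (x + h)) ≤ h * (5 * C * (x * Real.log x)) := by
      have : h * (5 * C * (x * Real.log x)) = 5 * C * x ^ 2 := by rw [← hxh]; ring
      rw [this]
      linarith
    have e8 := le_of_mul_le_mul_left e7 (by linarith)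
    simp only [hl] at e3 e8 ⊢
    linarith

lemma exists_abs_partialSum_le_of_two_le : ∃ C : ℝ, 0 < C ∧ ∀ x : ℝ, 2 ≤ x →
    |partialSum (fun n => (vonMangoldt n - 1) * Real.log n ^ 2) x| ≤ C * (x * Real.log x) := by
  obtain ⟨C, hC, h⟩ := exists_abs_partialSum_le
  set c : ℕ → ℝ := fun n => (vonMangoldt n - 1) * Real.log n ^ 2
  have hs : 0 ≤ ∑ n ∈ Finset.Icc 0 8, |c n| := Finset.sum_nonneg fun n _ => abs_nonneg _
  refine ⟨C + ∑ n ∈ Finset.Icc 0 8, |c n|, by positivity, fun x hx => ?_⟩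
  have hlog : 1 / 2 ≤ Real.log x := by
    have h1 : Real.log 2 ≤ Real.log x := Real.log_le_log (by norm_num) hx
    linarith [Real.log_two_gt_d9]
  have hxl : 1 ≤ x * Real.log x := by nlinarith
  rcases le_total 8 x with h8 | h8
  · refine (h x h8).trans ?_
    gcongr
    linarith
  · calc _ ≤ ∑ n ∈ Finset.Icc 0 ⌊x⌋₊, |c n| := Finset.abs_sum_le_sum_abs _ _
      _ ≤ ∑ n ∈ Finset.Icc 0 8, |c n| := by
        refine Finset.sum_le_sum_of_subset_of_nonneg (Finset.Icc_subset_Icc le_rfl ?_)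
          fun n _ _ => abs_nonneg _
        exact Nat.floor_le_of_le (by exact_mod_cast h8)
      _ ≤ (C + ∑ n ∈ Finset.Icc 0 8, |c n|) * 1 := by linarith
      _ ≤ _ := by gcongr

lemma hasDerivAt_inv_log_sq {t : ℝ} (ht : 1 < t) :
    HasDerivAt (fun t => (Real.log t ^ 2)⁻¹) (-(2 * (t * Real.log t ^ 3)⁻¹)) t := by
  have hl := Real.log_pos ht
  have := ((Real.hasDerivAt_log (by linarith : t ≠ 0)).pow 2).inv (pow_ne_zero 2 hl.ne')
  refine this.congr_deriv ?_
  have : t ≠ 0 := by linarith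
  simp
  field_simp

lemma psi_sub_floor_eq {x : ℝ} (hx : 1 ≤ x) :
    Chebyshev.psi x - ⌊x⌋₊ =
      ∑ n ∈ Finset.Icc 0 ⌊x⌋₊, (Real.log n ^ 2)⁻¹ * ((vonMangoldt n - 1) * Real.log n ^ 2) - 1 := by
  have h1 : 1 ∈ Finset.Ioc 0 ⌊x⌋₊ := by
    rw [Finset.mem_Ioc]
    exact ⟨one_pos, Nat.le_floor (by simpa using hx)⟩
  have h2 : ∑ n ∈ Finset.Icc 0 ⌊x⌋₊, (Real.log n ^ 2)⁻¹ * ((vonMangoldt n - 1) * Real.log n ^ 2) =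
      ∑ n ∈ Finset.Ioc 0 ⌊x⌋₊, (Real.log n ^ 2)⁻¹ * ((vonMangoldt n - 1) * Real.log n ^ 2) := by
    rw [← Finset.Ioc_insert_left (Nat.zero_le _), Finset.sum_insert (by simp)]
    simp
  have h3 : ∑ n ∈ Finset.Ioc 0 ⌊x⌋₊, ((vonMangoldt n - 1) -
      (Real.log n ^ 2)⁻¹ * ((vonMangoldt n - 1) * Real.log n ^ 2)) = -1 := by
    rw [Finset.sum_eq_single_of_mem 1 h1]
    · simp
    · intro n hn hn1
      have hn0 := (Finset.mem_Ioc.1 hn).1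
      have : Real.log n ≠ 0 := (Real.log_pos (by exact_mod_cast (by omega : 1 < n))).ne'
      field_simp
      ring
  rw [Finset.sum_sub_distrib, Finset.sum_sub_distrib] at h3
  simp only [Finset.sum_const, Nat.card_Ioc, nsmul_eq_mul, tsub_zero, mul_one] at h3
  rw [h2, Chebyshev.psi]
  linarith

/-- The prime number theorem for `ψ` with a logarithmic saving. -/
theorem isBigO_psi_sub_self : (fun x => Chebyshev.psi x - x) =O[atTop] fun x => x / Real.log x := by
  obtain ⟨C, hC, hD⟩ := exists_abs_partialSum_le_of_two_le
  set c : ℕ → ℝ := fun n => (vonMangoldt n - 1) * Real.log n ^ 2 with hc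
  have hI := Chebyshev.integral_one_div_log_sq_isBigO
  have hlogx : (fun x : ℝ => x / Real.log x ^ 2) =O[atTop] fun x => x / Real.log x := by
    refine IsBigO.of_bound 1 ?_
    filter_upwards [eventually_ge_atTop 3] with x hx
    have hl : 1 ≤ Real.log x := by
      rw [Real.le_log_iff_exp_le (by linarith)]; linarith [Real.exp_one_lt_d9]
    rw [Real.norm_of_nonneg (by positivity), Real.norm_of_nonneg (by positivity), one_mul]
    gcongr
    nlinarith
  have hone : (fun _ : ℝ => (1 : ℝ)) =O[atTop] fun x => x / Real.log x := by
    refine IsBigO.of_bound 1 ?_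
    filter_upwards [eventually_ge_atTop 3] with x hx
    have hl : 1 ≤ Real.log x := by
      rw [Real.le_log_iff_exp_le (by linarith)]; linarith [Real.exp_one_lt_d9]
    rw [Real.norm_of_nonneg zero_le_one, Real.norm_of_nonneg (by positivity), one_mul,
      one_le_div (by linarith)]
    linarith [Real.log_le_sub_one_of_pos (by linarith : 0 < x)]
  have hmaj : (fun x : ℝ => C * (x / Real.log x) + 2 * C * (∫ t in 2..x, 1 / Real.log t ^ 2) + 2)
      =O[atTop] fun x => x / Real.log x :=
    (((isBigO_refl _ _).const_mul_left C).add ((hI.trans hlogx).const_mul_left _)).add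
      ((hone.const_mul_left 2).congr_left (by simp))
  refine IsBigO.trans (IsBigO.of_bound 1 ?_) hmaj
  filter_upwards [eventually_ge_atTop 3] with x hx
  have hl : 1 ≤ Real.log x := by
    rw [Real.le_log_iff_exp_le (by linarith)]; linarith [Real.exp_one_lt_d9]
  have hne : ∀ t ∈ Set.Icc 2 x, t * Real.log t ^ 3 ≠ 0 := fun t ht =>
    (mul_pos (by linarith [ht.1]) (pow_pos (Real.log_pos (by linarith [ht.1])) 3)).ne'
  have habel := sum_mul_eq_sub_integral_mul₁ (f := fun t => (Real.log t ^ 2)⁻¹) c (by simp [hc])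
    (by simp [hc]) x (fun t ht => (hasDerivAt_inv_log_sq (by linarith [ht.1])).differentiableAt)
    (by
      have hcont : ContinuousOn (fun t : ℝ => -(2 * (t * Real.log t ^ 3)⁻¹)) (Set.Icc 2 x) := by
        refine (continuousOn_const.mul (ContinuousOn.inv₀ ?_ hne)).neg
        refine continuousOn_id.mul (ContinuousOn.pow (ContinuousOn.log continuousOn_id ?_) 3)
        intro t ht
        have := ht.1
        simp only [id]
        linarith
      refine hcont.integrableOn_Icc.congr_fun ?_ measurableSet_Icc
      intro t ht
      exact (hasDerivAt_inv_log_sq (by linarith [ht.1])).deriv.symm)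
  have hbound : ‖∫ t in Set.Ioc 2 x, deriv (fun t => (Real.log t ^ 2)⁻¹) t *
      ∑ k ∈ Finset.Icc 0 ⌊t⌋₊, c k‖ ≤ 2 * C * (∫ t in 2..x, 1 / Real.log t ^ 2) := by
    rw [intervalIntegral.integral_of_le (by linarith), ← integral_const_mul]
    have hii := (Chebyshev.intervalIntegrable_one_div_log_sq (a := 2) (b := x)
      (by norm_num) (by linarith))
    rw [intervalIntegrable_iff_integrableOn_Ioc_of_le (by linarith)] at hii
    refine norm_integral_le_of_norm_le (hii.const_mul _) ?_
    refine (ae_restrict_iff' measurableSet_Ioc).2 (Eventually.of_forall fun t ht => ?_)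
    have ht1 : 2 < t := ht.1
    have hlt := Real.log_pos (by linarith : 1 < t)
    rw [(hasDerivAt_inv_log_sq (by linarith)).deriv, norm_mul, norm_neg,
      Real.norm_of_nonneg (by positivity), Real.norm_eq_abs]
    calc _ ≤ 2 * (t * Real.log t ^ 3)⁻¹ * (C * (t * Real.log t)) := by
          gcongr; exact hD t ht1.le
      _ = _ := by field_simp
  have hDx := hD x (by linarith)
  have hmain : |(Real.log x ^ 2)⁻¹ * ∑ k ∈ Finset.Icc 0 ⌊x⌋₊, c k| ≤ C * (x / Real.log x) := by
    rw [abs_mul, abs_of_nonneg (by positivity)]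
    calc _ ≤ (Real.log x ^ 2)⁻¹ * (C * (x * Real.log x)) := by gcongr; exact hDx
      _ = _ := by field_simp
  have hps := psi_sub_floor_eq (x := x) (by linarith)
  have hfl1 := Nat.floor_le (a := x) (by linarith)
  have hfl2 := Nat.lt_floor_add_one x
  rw [Real.norm_eq_abs] at hbound
  rw [habel] at hps
  rw [one_mul]
  refine le_trans ?_ (le_abs_self _)
  rw [Real.norm_eq_abs, abs_le]
  have h1 := abs_le.1 hbound
  have h2 := abs_le.1 hmain
  constructor <;> linarith

/-- The prime number theorem with error term `O(x / (log x) ^ 2)`. -/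
theorem isBigO_primeCounting_sub :
    (fun x : ℝ => (Nat.primeCounting ⌊x⌋₊ : ℝ) - x / Real.log x) =O[atTop]
      fun x => x / Real.log x ^ 2 := by
  have h1 := Chebyshev.primeCounting_sub_theta_div_log_isBigO
  have hsqrt : Real.sqrt =O[atTop] fun x => x / Real.log x := by
    refine IsBigO.of_bound 2 ?_
    filter_upwards [eventually_ge_atTop 3] with x hx
    have hl : 0 < Real.log x := Real.log_pos (by linarith)
    rw [Real.norm_of_nonneg (by positivity), Real.norm_of_nonneg (by positivity), mul_div_assoc',
      le_div_iff₀ hl]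
    have hs : 0 < √x := Real.sqrt_pos.2 (by linarith)
    have : Real.log x = 2 * Real.log √x := by
      rw [Real.log_sqrt (by linarith)]; ring
    have h2 := Real.log_le_sub_one_of_pos hs
    have h3 := Real.mul_self_sqrt (show 0 ≤ x by linarith)
    rw [this]
    nlinarith
  have h2 : (fun x => Chebyshev.theta x - x) =O[atTop] fun x => x / Real.log x := by
    have := isBigO_psi_sub_self.sub (Chebyshev.isBigO_psi_sub_theta_sqrt.trans hsqrt)
    refine this.congr_left fun x => ?_
    simp
  have h3 : (fun x => (Chebyshev.theta x - x) * (Real.log x)⁻¹) =O[atTop]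
      fun x => x / Real.log x ^ 2 :=
    (h2.mul (isBigO_refl (fun x => (Real.log x)⁻¹) atTop)).congr_right fun x => by
      rw [div_eq_mul_inv, div_eq_mul_inv, sq, mul_inv, mul_assoc]
  refine (h1.add h3).congr_left fun x => ?_
  ring

end PrimeNumberTheorem

lemma pos_of_mem_Psigma {r : ℕ} {β : Fin r → ℕ} {m : ℕ} (hm : m ∈ Psigma β) : 0 < m := by
  obtain ⟨p, hp, rfl⟩ := hm
  exact Finset.prod_pos fun i _ => pow_pos (hp i).pos _

lemma mem_Psigma_append_iff {r α : ℕ} {β : Fin r → ℕ} {n : ℕ} :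
    n ∈ Psigma (Fin.append (fun _ : Fin 1 => α) β) ↔
      ∃ q m, q.Prime ∧ m ∈ Psigma β ∧ n = q ^ α * m := by
  constructor
  · rintro ⟨p, hp, rfl⟩
    refine ⟨p (Fin.castAdd r 0), ∏ i, p (Fin.natAdd 1 i) ^ β i, hp _, ⟨_, fun i => hp _, rfl⟩, ?_⟩
    rw [Fin.prod_univ_add]
    simp [Fin.append_left, Fin.append_right]
  · rintro ⟨q, m, hq, ⟨p, hp, rfl⟩, rfl⟩
    refine ⟨Fin.append (fun _ => q) p, fun i => ?_, ?_⟩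
    · refine Fin.addCases (fun i => ?_) (fun i => ?_) i
      · rwa [Fin.append_left]
      · rw [Fin.append_right]; exact hp i
    · rw [Fin.prod_univ_add]
      simp [Fin.append_left, Fin.append_right]

lemma pow_succ_dvd_of_mem_Psigma {r α : ℕ} {β : Fin r → ℕ} (h : ∀ i, α < β i) {m q : ℕ}
    (hm : m ∈ Psigma β) (hq : q.Prime) (hqm : q ∣ m) : q ^ (α + 1) ∣ m := by
  obtain ⟨p, hp, rfl⟩ := hm
  obtain ⟨i, -, hi⟩ := (Prime.dvd_finsetProd_iff hq.prime _).1 hqm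
  have : q = p i := (Nat.prime_dvd_prime_iff_eq hq (hp i)).1 (hq.dvd_of_dvd_pow hi)
  rw [this]
  exact (pow_dvd_pow _ (h i)).trans (Finset.dvd_prod_of_mem (fun i => p i ^ β i) (Finset.mem_univ i))

lemma card_primeFactors_le_of_mem_Psigma {r : ℕ} {β : Fin r → ℕ} {m : ℕ} (hm : m ∈ Psigma β) :
    m.primeFactors.card ≤ r := by
  obtain ⟨p, hp, rfl⟩ := hm
  have : (∏ i, p i ^ β i).primeFactors ⊆ Finset.univ.image p := by
    intro q hq
    have hqp := Nat.prime_of_mem_primeFactors hq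
    obtain ⟨i, -, hi⟩ := (Prime.dvd_finsetProd_iff hqp.prime _).1 (Nat.dvd_of_mem_primeFactors hq)
    rw [(Nat.prime_dvd_prime_iff_eq hqp (hp i)).1 (hqp.dvd_of_dvd_pow hi)]
    exact Finset.mem_image_of_mem _ (Finset.mem_univ i)
  calc _ ≤ _ := Finset.card_le_card this
    _ ≤ _ := Finset.card_image_le
    _ = r := by simp

lemma eq_of_pow_mul_eq {r α : ℕ} (hα : 0 < α) {β : Fin r → ℕ} (h : ∀ i, α < β i)
    {q m q' m' : ℕ} (hq : q.Prime) (hm' : m' ∈ Psigma β) (hqm : ¬ q ∣ m) (hq' : q'.Prime)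
    (e : q ^ α * m = q' ^ α * m') : q = q' ∧ m = m' := by
  have hqq : q = q' := by
    by_contra hne
    have h1 : q ∣ q' ^ α * m' := e ▸ (dvd_pow_self q hα.ne').mul_right m
    have h2 : q ∣ m' := (hq.dvd_mul.1 h1).resolve_left fun hd =>
      hne ((Nat.prime_dvd_prime_iff_eq hq hq').1 (hq.dvd_of_dvd_pow hd))
    have h3 : q ^ α * q ∣ q ^ α * m := by
      rw [e, ← pow_succ]
      exact (pow_succ_dvd_of_mem_Psigma h hm' hq h2).mul_left _
    exact hqm (Nat.dvd_of_mul_dvd_mul_left (pow_pos hq.pos _) h3)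
  subst hqq
  exact ⟨rfl, Nat.eq_of_mul_eq_mul_left (pow_pos hq.pos _) e⟩

lemma summable_Psigma {r : ℕ} {β : Fin r → ℕ} {s : ℝ} (hs : ∀ i, 1 < β i * s) :
    Summable fun m : Psigma β => ((m : ℕ) : ℝ) ^ (-s) := by
  set f : Fin r → Nat.Primes → ℝ := fun i p => ((p : ℕ) : ℝ) ^ (-(β i * s)) with hf
  have hf0 : ∀ i p, 0 ≤ f i p := fun i p => by positivity
  have hfs : ∀ i, Summable (f i) := fun i => Nat.Primes.summable_rpow.2 (by linarith [hs i])
  have hg : Summable fun p : Fin r → Nat.Primes => ∏ i, f i (p i) := by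
    refine summable_of_sum_le (c := ∏ i, ∑' p, f i p)
      (fun p => Finset.prod_nonneg fun i _ => hf0 i _) fun u => ?_
    calc ∑ p ∈ u, ∏ i, f i (p i)
        ≤ ∑ p ∈ Fintype.piFinset fun i => u.image fun p => p i, ∏ i, f i (p i) := by
          refine Finset.sum_le_sum_of_subset_of_nonneg (fun p hp => ?_)
            fun p _ _ => Finset.prod_nonneg fun i _ => hf0 i _
          exact Fintype.mem_piFinset.2 fun i => Finset.mem_image_of_mem (fun p => p i) hp
      _ = ∏ i, ∑ p ∈ u.image fun p => p i, f i p := (Finset.prod_univ_sum _ _).symm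
      _ ≤ _ := Finset.prod_le_prod (fun i _ => Finset.sum_nonneg fun p _ => hf0 i p)
          fun i _ => (hfs i).sum_le_tsum _ fun p _ => hf0 i p
  have hex : ∀ m : Psigma β, ∃ p : Fin r → Nat.Primes, (m : ℕ) = ∏ i, (p i : ℕ) ^ β i := by
    rintro ⟨m, p, hp, rfl⟩
    exact ⟨fun i => ⟨p i, hp i⟩, rfl⟩
  choose σ hσ using hex
  have hinj : Function.Injective σ := fun m m' e => Subtype.ext (by rw [hσ m, hσ m', e])
  refine (hg.comp_injective hinj).congr fun m => ?_
  rw [Function.comp_apply, hσ m]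
  push_cast
  rw [← Real.finsetProd_rpow _ _ fun i _ => by positivity]
  refine Finset.prod_congr rfl fun i _ => ?_
  rw [← Real.rpow_natCast, ← Real.rpow_mul (by positivity), mul_neg]

/-- Uniform estimate for the number of primes `q` with `q ^ α * m ≤ x`. -/
lemma exists_abs_primeCounting_sub_le {α : ℕ} (hα : 0 < α) {s : ℝ} (hs : s < 1 / α) :
    ∃ C : ℝ, 0 < C ∧ ∀ᶠ x : ℝ in atTop, ∀ m : ℝ, 1 ≤ m →
      |(Nat.primeCounting ⌊(x / m) ^ (1 / α : ℝ)⌋₊ : ℝ) -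
        α * x ^ (1 / α : ℝ) / Real.log x * m ^ (-1 / α : ℝ)| ≤
      C * (x ^ (1 / α : ℝ) / Real.log x ^ 2) * m ^ (-s) := by
  obtain ⟨K, hK, hpnt⟩ := isBigO_primeCounting_sub.exists_pos
  obtain ⟨Y, hY⟩ := eventually_atTop.1 hpnt.bound
  have hα0 : (0 : ℝ) < α := by exact_mod_cast hα
  set a : ℝ := 1 / α with ha
  have ha0 : 0 < a := by positivity
  have hαa : α * a = 1 := by rw [ha]; field_simp
  set δ : ℝ := a - s with hδ
  have hδ0 : 0 < δ := by linarith
  refine ⟨2 * α / δ + 4 * K * α ^ 2 + (1 + α), by positivity, ?_⟩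
  have ev1 := (isLittleO_log_rpow_atTop (r := δ / 4) (by positivity)).bound zero_lt_one
  have ev2 := (tendsto_rpow_atTop (y := a / 2) (by positivity)).eventually_ge_atTop (max Y 2)
  filter_upwards [ev1, ev2, eventually_ge_atTop 3] with x h1 h2 h3 m hm
  have hx0 : 0 < x := by linarith
  have hm0 : 0 < m := by linarith
  have hl : 1 ≤ Real.log x := by
    rw [Real.le_log_iff_exp_le (by linarith)]; linarith [Real.exp_one_lt_d9]
  rw [Real.norm_of_nonneg (by linarith), Real.norm_of_nonneg (by positivity), one_mul] at h1
  have hlogm : 0 ≤ Real.log m := Real.log_nonneg hm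
  set y : ℝ := (x / m) ^ a with hy
  have hy0 : 0 < y := by positivity
  have hyeq : y = x ^ a * m ^ (-1 / α : ℝ) := by
    rw [hy, Real.div_rpow hx0.le hm0.le, neg_div, ← ha, Real.rpow_neg hm0.le, div_eq_mul_inv]
  have hyδ : y * m ^ δ = x ^ a * m ^ (-s) := by
    rw [hyeq, mul_assoc, ← Real.rpow_add hm0, neg_div, ← ha, hδ]
    congr 2
    ring
  have hmδ : 1 ≤ m ^ δ := Real.one_le_rpow hm hδ0.le
  have e1 : α * x ^ a / Real.log x * m ^ (-1 / α : ℝ) = α * y / Real.log x := by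
    rw [hyeq]; ring
  have e2 : ∀ c : ℝ, c * (x ^ a / Real.log x ^ 2) * m ^ (-s) = c * (y * m ^ δ) / Real.log x ^ 2 := by
    intro c; rw [hyδ]; ring
  rw [e1, e2]
  rcases le_or_gt m (x ^ (1 / 2 : ℝ)) with hmx | hmx
  · have hxm : x ^ (1 / 2 : ℝ) ≤ x / m := by
      rw [le_div_iff₀ hm0]
      calc _ ≤ x ^ (1 / 2 : ℝ) * x ^ (1 / 2 : ℝ) := by gcongr
        _ = x := by rw [← Real.rpow_add hx0]; norm_num
    have hyY : max Y 2 ≤ y := by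
      refine h2.trans ?_
      calc x ^ (a / 2) = (x ^ (1 / 2 : ℝ)) ^ a := by rw [← Real.rpow_mul hx0.le]; ring_nf
        _ ≤ y := Real.rpow_le_rpow (by positivity) hxm ha0.le
    have hlogy : Real.log y = a * (Real.log x - Real.log m) := by
      rw [hy, Real.log_rpow (by positivity), Real.log_div hx0.ne' hm0.ne']
    have hlm : Real.log m ≤ Real.log x / 2 := by
      have := Real.log_le_log hm0 hmx
      rw [Real.log_rpow hx0] at this
      linarith
    set d : ℝ := Real.log x - Real.log m with hd
    have hd2 : Real.log x / 2 ≤ d := by linarith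
    have hd0 : 0 < d := by linarith
    have hp := hY y ((le_max_left _ _).trans hyY)
    rw [Real.norm_eq_abs, Real.norm_of_nonneg (by positivity), hlogy] at hp
    have t1 : y / (a * d) = α * y / d := by
      rw [div_eq_div_iff (by positivity) (by positivity)]
      linear_combination (-(y * d)) * hαa
    have t2 : K * (y / (a * d) ^ 2) ≤ 4 * K * α ^ 2 * (y * m ^ δ) / Real.log x ^ 2 := by
      have : y / (a * d) ^ 2 = α ^ 2 * y / d ^ 2 := by
        rw [div_eq_div_iff (by positivity) (by positivity)]
        linear_combination (-(y * d ^ 2) * (α * a + 1)) * hαa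
      rw [this]
      calc _ ≤ K * (α ^ 2 * (y * m ^ δ) / (Real.log x / 2) ^ 2) := by
            gcongr
            exact le_mul_of_one_le_right hy0.le hmδ
        _ = _ := by field_simp; ring
    have t3 : |α * y / d - α * y / Real.log x| ≤ 2 * α / δ * (y * m ^ δ) / Real.log x ^ 2 := by
      have hlm2 : Real.log m ≤ m ^ δ / δ := Real.log_le_rpow_div hm0.le hδ0
      have e : α * y / d - α * y / Real.log x = α * y * Real.log m / (d * Real.log x) := by
        field_simp
        rw [hd]; ring
      rw [e, abs_of_nonneg (by positivity)]
      calc _ ≤ α * y * (m ^ δ / δ) / (Real.log x / 2 * Real.log x) := by gcongr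
        _ = _ := by field_simp
    rw [t1] at hp
    have t4 : 0 ≤ (1 + α) * (y * m ^ δ) / Real.log x ^ 2 := by positivity
    calc _ ≤ _ := abs_sub_le _ (α * y / d) _
      _ ≤ _ := add_le_add (hp.trans t2) t3
      _ ≤ 4 * K * α ^ 2 * (y * m ^ δ) / Real.log x ^ 2 +
          2 * α / δ * (y * m ^ δ) / Real.log x ^ 2 + (1 + α) * (y * m ^ δ) / Real.log x ^ 2 := by
        linarith
      _ = _ := by ring
  · have hpi : (Nat.primeCounting ⌊y⌋₊ : ℝ) ≤ y := by
      refine le_trans ?_ (Nat.floor_le hy0.le)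
      rw [← Nat.primesLE_card_eq_primeCounting, Nat.primesLE_eq_filter_Icc_one]
      exact_mod_cast (Finset.card_filter_le _ _).trans (by simp)
    have hlx : Real.log x ^ 2 ≤ m ^ δ := by
      calc Real.log x ^ 2 ≤ (x ^ (δ / 4)) ^ 2 := by gcongr
        _ = (x ^ (1 / 2 : ℝ)) ^ δ := by
          rw [← Real.rpow_natCast, ← Real.rpow_mul hx0.le, ← Real.rpow_mul hx0.le]
          congr 1
          push_cast
          ring
        _ ≤ m ^ δ := by gcongr
    have hy1 : α * y / Real.log x ≤ α * y := div_le_self (by positivity) hl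
    have hy2 : 0 ≤ α * y / Real.log x := by positivity
    have hpi0 : (0 : ℝ) ≤ (Nat.primeCounting ⌊y⌋₊ : ℝ) := Nat.cast_nonneg _
    calc _ ≤ (1 + α) * y := by
          have := mul_pos hα0 hy0
          rw [abs_le]
          constructor <;> linarith
      _ ≤ (1 + α) * (y * m ^ δ) / Real.log x ^ 2 := by
        rw [le_div_iff₀ (by positivity), ← mul_assoc]
        gcongr
      _ ≤ _ := by
        have : 0 ≤ 2 * α / δ + 4 * K * α ^ 2 := by positivity
        gcongr ?_ * _ / _
        linarith

lemma mem_primesLE_floor_rpow_iff {α : ℕ} (hα : 0 < α) {x : ℝ} (hx : 0 ≤ x) {m q : ℕ}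
    (hm : 0 < m) :
    q ∈ Nat.primesLE ⌊(x / m) ^ (1 / α : ℝ)⌋₊ ↔ q.Prime ∧ ((q ^ α * m : ℕ) : ℝ) ≤ x := by
  have hm' : (0 : ℝ) < m := by exact_mod_cast hm
  have hα' : (0 : ℝ) < α := by exact_mod_cast hα
  rw [Nat.mem_primesLE, and_comm, Nat.le_floor_iff (by positivity), one_div,
    Real.le_rpow_inv_iff_of_pos (by positivity) (by positivity) hα', Real.rpow_natCast,
    le_div_iff₀ hm']
  push_cast
  rfl

open scoped Classical in
/-- Elements of `Psigma β` up to `x`. -/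
noncomputable def psigmaUpTo {r : ℕ} (β : Fin r → ℕ) (x : ℝ) : Finset ℕ :=
  (Finset.Icc 1 ⌊x⌋₊).filter (· ∈ Psigma β)

lemma mem_psigmaUpTo_iff {r : ℕ} {β : Fin r → ℕ} {x : ℝ} (hx : 0 ≤ x) {m : ℕ} :
    m ∈ psigmaUpTo β x ↔ (m : ℝ) ≤ x ∧ m ∈ Psigma β := by
  classical
  rw [psigmaUpTo, Finset.mem_filter, Finset.mem_Icc, Nat.le_floor_iff hx]
  exact ⟨fun h => ⟨h.1.2, h.2⟩, fun h => ⟨⟨pos_of_mem_Psigma h.2, h.1⟩, h.2⟩⟩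

lemma setOf_Psigma_append_eq_image {r α : ℕ} (hα : 0 < α) (β : Fin r → ℕ) {x : ℝ} (hx : 0 ≤ x) :
    {n : ℕ | (n : ℝ) ≤ x ∧ n ∈ Psigma (Fin.append (fun _ : Fin 1 => α) β)} =
      ((((psigmaUpTo β x).sigma fun m => Nat.primesLE ⌊(x / m) ^ (1 / α : ℝ)⌋₊).image
        fun y => y.2 ^ α * y.1 : Finset ℕ) : Set ℕ) := by
  ext n
  simp only [Set.mem_ofPred_eq, Finset.coe_image, Set.mem_image, Finset.mem_coe, Finset.mem_sigma,
    mem_Psigma_append_iff]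
  constructor
  · rintro ⟨hn, q, m, hq, hm, rfl⟩
    have hm0 := pos_of_mem_Psigma hm
    refine ⟨⟨m, q⟩, ⟨(mem_psigmaUpTo_iff hx).2 ⟨le_trans ?_ hn, hm⟩,
      (mem_primesLE_floor_rpow_iff hα hx hm0).2 ⟨hq, hn⟩⟩, rfl⟩
    exact_mod_cast Nat.le_mul_of_pos_left m (pow_pos hq.pos α)
  · rintro ⟨⟨m, q⟩, ⟨hm, hq⟩, rfl⟩
    have hm' := ((mem_psigmaUpTo_iff hx).1 hm).2
    obtain ⟨hq1, hq2⟩ := (mem_primesLE_floor_rpow_iff hα hx (pos_of_mem_Psigma hm')).1 hq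
    exact ⟨hq2, q, m, hq1, hm', rfl⟩

lemma countIn_Psigma_append_le {r α : ℕ} (hα : 0 < α) (β : Fin r → ℕ) {x : ℝ} (hx : 0 ≤ x) :
    countIn (Psigma (Fin.append (fun _ : Fin 1 => α) β)) x ≤
      ∑ m ∈ psigmaUpTo β x, Nat.primeCounting ⌊(x / m) ^ (1 / α : ℝ)⌋₊ := by
  rw [countIn, setOf_Psigma_append_eq_image hα β hx, Nat.card_coe_set_eq, Set.ncard_coe_finset]
  refine Finset.card_image_le.trans ?_
  rw [Finset.card_sigma]
  simp

lemma le_countIn_Psigma_append {r α : ℕ} (hα : 0 < α) {β : Fin r → ℕ} (h : ∀ i, α < β i)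
    {x : ℝ} (hx : 0 ≤ x) :
    ∑ m ∈ psigmaUpTo β x, Nat.primeCounting ⌊(x / m) ^ (1 / α : ℝ)⌋₊ ≤
      countIn (Psigma (Fin.append (fun _ : Fin 1 => α) β)) x + (psigmaUpTo β x).card * r := by
  rw [countIn, setOf_Psigma_append_eq_image hα β hx, Nat.card_coe_set_eq, Set.ncard_coe_finset]
  set P := (psigmaUpTo β x).sigma fun m => Nat.primesLE ⌊(x / m) ^ (1 / α : ℝ)⌋₊ with hP
  have hcard : ∑ m ∈ psigmaUpTo β x, Nat.primeCounting ⌊(x / m) ^ (1 / α : ℝ)⌋₊ = P.card := by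
    rw [hP, Finset.card_sigma]
    simp
  have hmem : ∀ y ∈ P, y.1 ∈ Psigma β ∧ y.2.Prime := fun y hy =>
    ⟨((mem_psigmaUpTo_iff hx).1 (Finset.mem_sigma.1 hy).1).2,
      Nat.prime_of_mem_primesLE (Finset.mem_sigma.1 hy).2⟩
  rw [hcard, ← Finset.card_filter_add_card_filter_not (fun y : (Σ _ : ℕ, ℕ) => ¬ y.2 ∣ y.1)]
  gcongr
  · rw [← Finset.card_image_of_injOn (s := P.filter fun y => ¬ y.2 ∣ y.1)
      (f := fun y => y.2 ^ α * y.1)]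
    · exact Finset.card_le_card (Finset.image_subset_image (Finset.filter_subset _ _))
    · rintro ⟨m, q⟩ hy ⟨m', q'⟩ hy' e
      rw [Finset.mem_coe, Finset.mem_filter] at hy hy'
      obtain ⟨rfl, rfl⟩ := eq_of_pow_mul_eq hα h (hmem _ hy.1).2 (hmem _ hy'.1).1 hy.2
        (hmem _ hy'.1).2 e
      rfl
  · calc _ ≤ ((psigmaUpTo β x).sigma fun m => m.primeFactors).card := by
          refine Finset.card_le_card fun y hy => ?_
          rw [Finset.mem_filter, not_not] at hy
          exact Finset.mem_sigma.2 ⟨(Finset.mem_sigma.1 hy.1).1, Nat.mem_primeFactors.2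
            ⟨(hmem y hy.1).2, hy.2, (pos_of_mem_Psigma (hmem y hy.1).1).ne'⟩⟩
      _ = ∑ m ∈ psigmaUpTo β x, m.primeFactors.card := Finset.card_sigma _ _
      _ ≤ _ := Finset.sum_le_card_nsmul _ _ _ fun m hm =>
          card_primeFactors_le_of_mem_Psigma ((mem_psigmaUpTo_iff hx).1 hm).2

lemma hasSum_psigmaUpTo {r : ℕ} {β : Fin r → ℕ} {x : ℝ} (hx : 0 ≤ x) {f : ℕ → ℝ}
    (hf : ∀ m : ℕ, x < m → f m = 0) :
    HasSum (fun m : Psigma β => f m) (∑ m ∈ psigmaUpTo β x, f m) := by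
  classical
  have h1 : ∑ m ∈ psigmaUpTo β x, f m =
      ∑ m ∈ (psigmaUpTo β x).subtype (· ∈ Psigma β), f m := by
    rw [Finset.sum_subtype_of_mem f fun m hm => ((mem_psigmaUpTo_iff hx).1 hm).2]
  rw [h1]
  refine hasSum_sum_of_ne_finset_zero fun m hm => hf m ?_
  rw [Finset.mem_subtype, mem_psigmaUpTo_iff hx] at hm
  by_contra hle
  exact hm ⟨not_lt.1 hle, m.2⟩

/-- for `k = 1`,
`σ_α(x) = α x^{1/α} / log x ⋅ ∑_{m ∈ 𝒫_β^σ} m^{-1/α} + O(x^{1/α}/(log x)²)`. -/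
theorem sigma_alpha_with_error_k_eq_one (r α : ℕ) (hα : 0 < α)
    (β : Fin r → ℕ) (h : ∀ i, α < β i) :
    (fun x : ℝ =>
        (countIn (Psigma (Fin.append (fun _ : Fin 1 => α) β)) x : ℝ) -
          (α : ℝ) * x ^ ((1 : ℝ) / (α : ℝ)) / Real.log x *
            ∑' m : Psigma β, ((m : ℕ) : ℝ) ^ (-(1 : ℝ) / (α : ℝ)))
      =O[atTop]
      (fun x : ℝ => x ^ ((1 : ℝ) / (α : ℝ)) / Real.log x ^ 2) := by
  have hα0 : (0 : ℝ) < α := by exact_mod_cast hα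
  obtain ⟨s, hs1, hs2⟩ : ∃ s : ℝ, 1 / (α + 1 : ℝ) < s ∧ s < 1 / α :=
    exists_between (one_div_lt_one_div_of_lt hα0 (by linarith))
  have hs0 : 0 < s := lt_trans (by positivity) hs1
  have hβ : ∀ i, (α + 1 : ℝ) ≤ β i := fun i => by exact_mod_cast h i
  have hβs : ∀ i, 1 < β i * s := fun i => by
    rw [div_lt_iff₀ (by positivity)] at hs1
    nlinarith [hβ i]
  have hsum := summable_Psigma hβs
  have hsum' : Summable fun m : Psigma β => ((m : ℕ) : ℝ) ^ (-(1 : ℝ) / (α : ℝ)) := by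
    rw [neg_div]
    exact summable_Psigma fun i => (hβs i).trans (by gcongr; linarith [hβ i])
  obtain ⟨C, hC, hev⟩ := exists_abs_primeCounting_sub_le hα hs2
  set Z := ∑' m : Psigma β, ((m : ℕ) : ℝ) ^ (-s)
  have hZ : 0 ≤ Z := tsum_nonneg fun m => by positivity
  have ev1 := (isLittleO_log_rpow_atTop (r := (1 / α - s) / 2) (by linarith)).bound zero_lt_one
  refine IsBigO.of_bound (C * Z + r * Z) ?_
  filter_upwards [hev, ev1, eventually_ge_atTop 3] with x hx hlx hx3
  have hx0 : 0 < x := by linarith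
  have hl : 0 < Real.log x := Real.log_pos (by linarith)
  rw [Real.norm_of_nonneg hl.le, Real.norm_of_nonneg (by positivity), one_mul] at hlx
  set R : ℝ := x ^ (1 / α : ℝ) / Real.log x ^ 2 with hR
  have hR0 : 0 ≤ R := by positivity
  have hxs : x ^ s ≤ R := by
    rw [hR, le_div_iff₀ (by positivity)]
    calc x ^ s * Real.log x ^ 2 ≤ x ^ s * (x ^ ((1 / α - s) / 2)) ^ 2 := by gcongr
      _ = _ := by
        rw [← Real.rpow_natCast, ← Real.rpow_mul hx0.le, ← Real.rpow_add hx0]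
        congr 1
        push_cast
        ring
  set S : ℝ := ∑ m ∈ psigmaUpTo β x, (Nat.primeCounting ⌊(x / m) ^ (1 / α : ℝ)⌋₊ : ℝ) with hS
  have hSsum : HasSum (fun m : Psigma β =>
      (Nat.primeCounting ⌊(x / (m : ℕ)) ^ (1 / α : ℝ)⌋₊ : ℝ)) S := by
    refine hasSum_psigmaUpTo hx0.le
      (f := fun m => (Nat.primeCounting ⌊(x / m) ^ (1 / α : ℝ)⌋₊ : ℝ)) fun m hm => ?_
    have : ⌊(x / m) ^ (1 / α : ℝ)⌋₊ = 0 := by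
      rw [Nat.floor_eq_zero]
      exact Real.rpow_lt_one (by positivity) ((div_lt_one (hx0.trans hm)).2 hm) (by positivity)
    simp only [this, Nat.primeCounting_zero, Nat.cast_zero]
  have hmain : |S - α * x ^ (1 / α : ℝ) / Real.log x *
      ∑' m : Psigma β, ((m : ℕ) : ℝ) ^ (-(1 : ℝ) / (α : ℝ))| ≤ C * R * Z := by
    have hd := hSsum.sub (hsum'.hasSum.mul_left (α * x ^ (1 / α : ℝ) / Real.log x))
    rw [← hd.tsum_eq, ← Real.norm_eq_abs]
    refine tsum_of_norm_bounded (hsum.hasSum.mul_left (C * R)) fun m => ?_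
    exact hx m (by exact_mod_cast pos_of_mem_Psigma m.2)
  have hcard : ((psigmaUpTo β x).card : ℝ) ≤ R * Z := by
    calc ((psigmaUpTo β x).card : ℝ) = ∑ m ∈ psigmaUpTo β x, (1 : ℝ) := by simp
      _ ≤ ∑ m ∈ psigmaUpTo β x, (if (m : ℝ) ≤ x then x ^ s * (m : ℝ) ^ (-s) else 0) := by
        refine Finset.sum_le_sum fun m hm => ?_
        obtain ⟨hm1, hm2⟩ := (mem_psigmaUpTo_iff hx0.le).1 hm
        have hm0 : (0 : ℝ) < m := by exact_mod_cast pos_of_mem_Psigma hm2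
        rw [if_pos hm1, Real.rpow_neg hm0.le, ← div_eq_mul_inv, ← Real.div_rpow hx0.le hm0.le]
        exact Real.one_le_rpow ((one_le_div hm0).2 hm1) hs0.le
      _ ≤ x ^ s * Z := by
        refine hasSum_le (fun m => ?_) (hasSum_psigmaUpTo hx0.le fun m hm => by
          rw [if_neg (not_le.2 hm)]) (hsum.hasSum.mul_left (x ^ s))
        split_ifs
        · exact le_rfl
        · positivity
      _ ≤ R * Z := by gcongr
  have hup : (countIn (Psigma (Fin.append (fun _ : Fin 1 => α) β)) x : ℝ) ≤ S := by
    rw [hS]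
    exact_mod_cast countIn_Psigma_append_le hα β hx0.le
  have hlo : S ≤ countIn (Psigma (Fin.append (fun _ : Fin 1 => α) β)) x +
      (psigmaUpTo β x).card * r := by
    rw [hS]
    exact_mod_cast le_countIn_Psigma_append hα h hx0.le
  have hcr : ((psigmaUpTo β x).card : ℝ) * r ≤ R * Z * r := by gcongr
  rw [Real.norm_of_nonneg hR0, Real.norm_eq_abs, abs_le]
  have hm := abs_le.1 hmain
  have h0 : 0 ≤ R * Z * r := by positivity
  constructor <;> linarith
end

section
/- The number of integers n ≤ x of the form n = p q³ with p, q primes (not necessarily distinct) is asymptotic to P(3) · x/log x as x → ∞. -/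
open Filter Asymptotics Real

/-- The Fejér kernel as the cosine transform of a triangle function. -/
theorem integral_triangle_mul_cos (u : ℝ) :
    ∫ y in (0 : ℝ)..1, 2 * (1 - y) * cos (u * y) = sinc (u / 2) ^ 2 := by
  rcases eq_or_ne u 0 with rfl | hu
  · simp only [zero_mul, cos_zero, mul_one, zero_div, sinc_zero, one_pow]
    rw [intervalIntegral.integral_const_mul, intervalIntegral.integral_sub (by simp) (by simp)]
    norm_num
  · have hd : ∀ y ∈ Set.uIcc (0 : ℝ) 1,
        HasDerivAt (fun y => 2 * (1 - y) * (sin (u * y) / u) - 2 * cos (u * y) / u ^ 2)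
          (2 * (1 - y) * cos (u * y)) y := by
      intro y _
      have h0 : HasDerivAt (fun y : ℝ => u * y) u y := by
        simpa using (hasDerivAt_id y).const_mul u
      have h1 := (((hasDerivAt_id y).const_sub 1).const_mul 2).mul (h0.sin.div_const u)
      have h2 := (h0.cos.const_mul 2).div_const (u ^ 2)
      refine (h1.sub h2).congr_deriv ?_
      simp only [id]
      field_simp
      ring
    rw [intervalIntegral.integral_eq_sub_of_hasDerivAt hd
      ((by fun_prop : Continuous _).intervalIntegrable _ _), sinc_of_ne_zero (by positivity)]
    have h := cos_sq' (u / 2)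
    rw [cos_sq, mul_div_cancel₀ u two_ne_zero] at h
    simp only [mul_one, mul_zero, sin_zero, cos_zero, sub_self, zero_mul, zero_div]
    field_simp
    linarith

theorem sinc_sq_le (u : ℝ) : sinc (u / 2) ^ 2 ≤ 5 * (1 + u ^ 2)⁻¹ := by
  rcases eq_or_ne u 0 with rfl | hu
  · norm_num
  · rw [← div_eq_mul_inv, le_div_iff₀ (by positivity)]
    have h1 : sinc (u / 2) ^ 2 ≤ 1 := by
      rw [sq_le_one_iff_abs_le_one]; exact abs_sinc_le_one _
    have h2 : sinc (u / 2) ^ 2 * u ^ 2 ≤ 4 := by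
      rw [sinc_of_ne_zero (by positivity)]
      field_simp
      nlinarith [sin_sq_le_one (u / 2)]
    linarith

theorem integrable_sinc_sq : MeasureTheory.Integrable fun u : ℝ => sinc (u / 2) ^ 2 := by
  refine (integrable_inv_one_add_sq.const_mul 5).mono'
    (by fun_prop : Continuous _).aestronglyMeasurable (.of_forall fun u => ?_)
  rw [norm_of_nonneg (by positivity)]
  exact sinc_sq_le u

theorem integral_sinc_sq_pos : 0 < ∫ u : ℝ, sinc (u / 2) ^ 2 := by
  exact MeasureTheory.integral_pos_of_integrable_nonneg_nonzero (x := 0) (by fun_prop)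
    integrable_sinc_sq (fun u => by positivity) (by simp)
section Tauberian

open MeasureTheory

variable {b : ℝ → ℝ} {M : ℝ} {g : ℂ → ℂ}

theorem integral_mul_exp_mul_sinc_sq (hb : Measurable b) (hM : ∀ u, |b u| ≤ M)
    (hgb : ∀ z : ℂ, 0 < z.re → g z = ∫ u in Set.Ioi (0 : ℝ), (b u : ℂ) * Complex.exp (-(z * u)))
    (r v : ℝ) {σ : ℝ} (hσ : 0 < σ) :
    ∫ u in Set.Ioi (0 : ℝ), b u * exp (-σ * u) * sinc (r * (v - u) / 2) ^ 2 =
      ∫ y in (0 : ℝ)..1,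
        2 * (1 - y) * (Complex.exp (r * y * v * Complex.I) * g (σ + r * y * Complex.I)).re := by
  have hexp : IntegrableOn (fun u : ℝ => b u * exp (-σ * u)) (Set.Ioi 0) :=
    (exp_neg_integrableOn_Ioi 0 hσ).bdd_mul hb.aestronglyMeasurable (.of_forall hM)
  have hint : Integrable (Function.uncurry fun u y : ℝ =>
      b u * exp (-σ * u) * (2 * (1 - y) * cos (r * (v - u) * y)))
      ((volume.restrict (Set.Ioi 0)).prod (volume.restrict (Set.Ioc 0 1))) := by
    have hy : IntegrableOn (fun y : ℝ => 2 * (1 - y)) (Set.Ioc 0 1) :=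
      ((by fun_prop : Continuous _).integrableOn_Icc).mono_set Set.Ioc_subset_Icc_self
    have h := (hexp.mul_prod hy).mul_bdd (g := fun p : ℝ × ℝ => cos (r * (v - p.1) * p.2)) (c := 1)
      (by fun_prop : Continuous _).aestronglyMeasurable (.of_forall fun p => abs_cos_le_one _)
    refine h.congr (.of_forall fun p => ?_)
    simp only [Function.uncurry]
    ring
  simp_rw [← integral_triangle_mul_cos, intervalIntegral.integral_of_le zero_le_one,
    ← integral_const_mul]
  rw [integral_integral_swap hint]
  refine setIntegral_congr_fun measurableSet_Ioc fun y _ => ?_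
  have hz : 0 < (σ + r * y * Complex.I : ℂ).re := by simpa using hσ
  have hexpc : IntegrableOn (fun u : ℝ => (b u : ℂ) * Complex.exp (-((σ + r * y * Complex.I) * u)))
      (Set.Ioi 0) := by
    have h := integrableOn_exp_mul_complex_Ioi (a := -(σ + r * y * Complex.I)) (by simpa using hσ) 0
    simp only [neg_mul] at h
    exact h.bdd_mul (c := M) (by fun_prop) (.of_forall fun u => by simpa using hM u)
  rw [hgb _ hz, ← integral_const_mul]
  have hre := integral_re (hexpc.const_mul (Complex.exp (r * y * v * Complex.I)))
  simp only [RCLike.re_to_complex] at hre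
  rw [← hre, ← integral_const_mul]
  refine integral_congr_ae (.of_forall fun u => ?_)
  have h1 : Complex.exp (r * y * v * Complex.I) *
      ((b u : ℂ) * Complex.exp (-((σ + r * y * Complex.I) * u))) =
      (b u : ℂ) * Complex.exp ((-σ * u : ℝ) + (r * (v - u) * y : ℝ) * Complex.I) := by
    rw [mul_left_comm, ← Complex.exp_add]
    congr 2
    push_cast
    ring
  simp only [h1]
  rw [Complex.re_ofReal_mul, Complex.exp_re]
  simp
  ring

theorem integral_mul_sinc_sq (hb : Measurable b) (hM : ∀ u, |b u| ≤ M)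
    (hg : ContinuousOn g {z | 0 ≤ z.re})
    (hgb : ∀ z : ℂ, 0 < z.re → g z = ∫ u in Set.Ioi (0 : ℝ), (b u : ℂ) * Complex.exp (-(z * u)))
    {r : ℝ} (hr : 0 < r) (v : ℝ) :
    ∫ u in Set.Ioi (0 : ℝ), b u * sinc (r * (v - u) / 2) ^ 2 =
      ∫ y in (0 : ℝ)..1,
        2 * (1 - y) * (Complex.exp (r * y * v * Complex.I) * g (r * y * Complex.I)).re := by
  have hk : Integrable fun u : ℝ => sinc (r * (v - u) / 2) ^ 2 :=
    (integrable_sinc_sq.comp_mul_left' hr.ne').comp_sub_left v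
  have hL : Tendsto (fun σ : ℝ =>
      ∫ u in Set.Ioi (0 : ℝ), b u * exp (-σ * u) * sinc (r * (v - u) / 2) ^ 2)
      (nhdsWithin 0 (Set.Ioi 0))
      (nhds (∫ u in Set.Ioi (0 : ℝ), b u * sinc (r * (v - u) / 2) ^ 2)) := by
    refine tendsto_integral_filter_of_dominated_convergence
      (fun u => M * sinc (r * (v - u) / 2) ^ 2) (.of_forall fun σ => ?_) ?_
      (hk.const_mul M).integrableOn (.of_forall fun u => ?_)
    · exact (by fun_prop : Measurable _).aestronglyMeasurable
    · filter_upwards [self_mem_nhdsWithin] with σ hσ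
      refine (ae_restrict_mem measurableSet_Ioi).mono fun u hu => ?_
      rw [norm_mul, norm_mul, norm_of_nonneg (exp_pos _).le,
        norm_of_nonneg (sq_nonneg (sinc (r * (v - u) / 2)))]
      gcongr
      have h1 : exp (-σ * u) ≤ 1 := by
        rw [exp_le_one_iff]
        have := mul_pos (Set.mem_Ioi.mp hσ) (Set.mem_Ioi.mp hu)
        linarith
      exact (mul_le_of_le_one_right (norm_nonneg _) h1).trans (hM u)
    · have hc : Continuous fun σ : ℝ => b u * exp (-σ * u) * sinc (r * (v - u) / 2) ^ 2 := by
        fun_prop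
      simpa using (hc.tendsto 0).mono_left nhdsWithin_le_nhds
  have hcont : ContinuousOn (fun p : ℝ × ℝ => g (p.1 + r * p.2 * Complex.I))
      (Set.Icc 0 1 ×ˢ Set.Icc 0 1) :=
    hg.comp (by fun_prop) fun p hp => by simpa using hp.1.1
  obtain ⟨C, hC⟩ := (isCompact_Icc.prod isCompact_Icc).exists_bound_of_continuousOn hcont
  have hR : Tendsto (fun σ : ℝ => ∫ y in (0 : ℝ)..1,
        2 * (1 - y) * (Complex.exp (r * y * v * Complex.I) * g (σ + r * y * Complex.I)).re)
      (nhdsWithin 0 (Set.Ioi 0))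
      (nhds (∫ y in (0 : ℝ)..1,
        2 * (1 - y) * (Complex.exp (r * y * v * Complex.I) * g (r * y * Complex.I)).re)) := by
    have hslice : ∀ σ ∈ Set.Icc (0 : ℝ) 1,
        ContinuousOn (fun y : ℝ => g (σ + r * y * Complex.I)) (Set.Icc 0 1) := fun σ hσ =>
      hcont.comp (f := fun y : ℝ => (σ, y)) (by fun_prop) fun y hy => ⟨hσ, hy⟩
    refine intervalIntegral.tendsto_integral_filter_of_dominated_convergence
      (fun _ => 2 * C) ?_ ?_ (by simp) (.of_forall fun y hy => ?_)
    · filter_upwards [Ioo_mem_nhdsGT zero_lt_one] with σ hσ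
      rw [Set.uIoc_of_le zero_le_one]
      have hc := hslice σ (Set.Ioo_subset_Icc_self hσ)
      refine ContinuousOn.aestronglyMeasurable ?_ measurableSet_Ioc
      refine ContinuousOn.mono ?_ Set.Ioc_subset_Icc_self
      exact (by fun_prop : Continuous fun y : ℝ => 2 * (1 - y)).continuousOn.mul
        (Complex.continuous_re.comp_continuousOn
          ((by fun_prop : Continuous fun y : ℝ =>
            Complex.exp (r * y * v * Complex.I)).continuousOn.mul hc))
    · filter_upwards [Ioo_mem_nhdsGT zero_lt_one] with σ hσ
      refine .of_forall fun y hy => ?_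
      rw [Set.uIoc_of_le zero_le_one] at hy
      have h1 := hC (σ, y) ⟨Set.Ioo_subset_Icc_self hσ, Set.Ioc_subset_Icc_self hy⟩
      have h2 : ‖Complex.exp (r * y * v * Complex.I)‖ = 1 := by
        have := Complex.norm_exp_ofReal_mul_I (r * y * v)
        push_cast at this
        exact this
      rw [norm_mul]
      have h3 : ‖2 * (1 - y)‖ ≤ 2 := by
        rw [norm_of_nonneg (by linarith [hy.2])]
        linarith [hy.1]
      have h4 : ‖(Complex.exp (r * y * v * Complex.I) * g (σ + r * y * Complex.I)).re‖ ≤ C := by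
        refine (Complex.abs_re_le_norm _).trans ?_
        rwa [norm_mul, h2, one_mul]
      exact mul_le_mul h3 h4 (norm_nonneg _) zero_le_two
    · have h1 : Tendsto (fun σ : ℝ => (σ + r * y * Complex.I : ℂ)) (nhdsWithin 0 (Set.Ioi 0))
          (nhdsWithin (r * y * Complex.I) {z | 0 ≤ z.re}) := by
        refine tendsto_nhdsWithin_iff.mpr ⟨?_, ?_⟩
        · have hc : Continuous fun σ : ℝ => (σ + r * y * Complex.I : ℂ) := by fun_prop
          simpa using (hc.tendsto 0).mono_left nhdsWithin_le_nhds
        · filter_upwards [self_mem_nhdsWithin] with σ hσ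
          simpa using (Set.mem_Ioi.mp hσ).le
      have h2 := (hg (r * y * Complex.I) (by simp)).tendsto.comp h1
      exact ((Complex.continuous_re.tendsto _).comp (h2.const_mul _)).const_mul _
  refine tendsto_nhds_unique (hL.congr' ?_) hR
  filter_upwards [self_mem_nhdsWithin] with σ hσ
  exact integral_mul_exp_mul_sinc_sq hb hM hgb r v hσ

theorem tendsto_integral_mul_sinc_sq (hb : Measurable b) (hM : ∀ u, |b u| ≤ M)
    (hg : ContinuousOn g {z | 0 ≤ z.re})
    (hgb : ∀ z : ℂ, 0 < z.re → g z = ∫ u in Set.Ioi (0 : ℝ), (b u : ℂ) * Complex.exp (-(z * u)))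
    {r : ℝ} (hr : 0 < r) :
    Tendsto (fun v : ℝ => ∫ u in Set.Ioi (0 : ℝ), b u * sinc (r * (v - u) / 2) ^ 2)
      atTop (nhds 0) := by
  simp_rw [integral_mul_sinc_sq hb hM hg hgb hr]
  let f : ℝ → ℂ := (Set.Ioc (0 : ℝ) 1).indicator fun y => 2 * (1 - y) * g (r * y * Complex.I)
  have hscale : Tendsto (fun v : ℝ => -(r / (2 * π)) * v) atTop (cocompact ℝ) :=
    (tendsto_id.const_mul_atTop_of_neg (by simpa using by positivity)).mono_right atBot_le_cocompact
  have h := (Complex.continuous_re.tendsto _).comp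
    ((Real.tendsto_integral_exp_smul_cocompact f).comp hscale)
  rw [Complex.zero_re] at h
  refine h.congr fun v => ?_
  have hint : IntegrableOn (fun y : ℝ =>
      Complex.exp (r * y * v * Complex.I) * (2 * (1 - y) * g (r * y * Complex.I)))
      (Set.Ioc 0 1) := by
    refine (ContinuousOn.integrableOn_Icc ?_).mono_set Set.Ioc_subset_Icc_self
    have hc : ContinuousOn (fun y : ℝ => g (r * y * Complex.I)) (Set.Icc 0 1) :=
      hg.comp (by fun_prop) fun y _ => by simp
    exact (by fun_prop : Continuous fun y : ℝ => Complex.exp (r * y * v * Complex.I)).continuousOn.mul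
      ((by fun_prop : Continuous fun y : ℝ => (2 * (1 - y) : ℂ)).continuousOn.mul hc)
  have hre := integral_re hint
  simp only [RCLike.re_to_complex] at hre
  rw [intervalIntegral.integral_of_le zero_le_one]
  simp only [Function.comp_apply]
  have hind : ∀ y : ℝ, Real.fourierChar (-(y * (-(r / (2 * π)) * v))) • f y =
      (Set.Ioc (0 : ℝ) 1).indicator (fun y : ℝ =>
        Complex.exp (r * y * v * Complex.I) * (2 * (1 - y) * g (r * y * Complex.I))) y := by
    intro y
    by_cases hy : y ∈ Set.Ioc (0 : ℝ) 1
    · simp only [f, Set.indicator_of_mem hy, Circle.smul_def, Real.fourierChar_apply, smul_eq_mul]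
      congr 3
      push_cast
      field_simp
    · simp [f, hy]
  simp_rw [hind]
  rw [integral_indicator measurableSet_Ioc, ← hre]
  refine integral_congr_ae (.of_forall fun y => ?_)
  simp only []
  rw [mul_left_comm, ← Complex.re_ofReal_mul]
  push_cast
  rfl

end Tauberian

section WienerIkehara

open MeasureTheory

variable {a : ℝ → ℝ} {M : ℝ}

/-- If `a` is averaged to `1` by arbitrarily concentrated kernels and `u ↦ a u * exp u` is
monotone, then `a` tends to `1`. -/
theorem tendsto_one_of_concentrated_averages (ha : Measurable a) (ha0 : ∀ u, 0 ≤ a u)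
    (hM : ∀ u, a u ≤ M) (hmono : Monotone fun u => a u * exp u)
    (hker : ∀ δ > 0, ∃ K : ℝ → ℝ, (∀ w, 0 ≤ K w) ∧ Integrable K ∧ ∫ w, K w = 1 ∧
      1 - δ ≤ ∫ w in Set.Icc (-δ) δ, K w ∧
      Tendsto (fun v => ∫ w, a (v - w) * K w) atTop (nhds 1)) :
    Tendsto a atTop (nhds 1) := by
  have hM0 : 0 ≤ M := (ha0 0).trans (hM 0)
  have hcmp : ∀ s t d, s ≤ t → t ≤ s + d → a s ≤ exp d * a t := by
    intro s t d hst htd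
    have h1 := hmono hst
    have h2 : exp t ≤ exp d * exp s := by
      rw [← exp_add]
      exact exp_le_exp.mpr (by linarith)
    have h3 : a s * exp s ≤ exp d * a t * exp s := by
      calc a s * exp s ≤ a t * exp t := h1
        _ ≤ a t * (exp d * exp s) := mul_le_mul_of_nonneg_left h2 (ha0 t)
        _ = _ := by ring
    exact le_of_mul_le_mul_right h3 (exp_pos s)
  have bounds : ∀ δ > 0, ∀ᶠ v in atTop,
      a v * (1 - δ) ≤ exp (2 * δ) * (1 + δ) ∧ 1 - δ ≤ exp (2 * δ) * a v + M * δ := by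
    intro δ hδ
    obtain ⟨K, hK0, hKi, hK1, hKδ, hKt⟩ := hker δ hδ
    have hai : ∀ v, Integrable fun w => a (v - w) * K w := fun v =>
      hKi.bdd_mul (c := M) (by fun_prop : Measurable _).aestronglyMeasurable
        (.of_forall fun w => by rw [norm_of_nonneg (ha0 _)]; exact hM _)
    have hout : ∫ w in (Set.Icc (-δ) δ)ᶜ, K w ≤ δ := by
      have := integral_add_compl (measurableSet_Icc (a := -δ) (b := δ)) hKi
      linarith
    have hup : ∀ᶠ v in atTop, ∫ w, a (v + δ - w) * K w < 1 + δ :=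
      (hKt.comp (tendsto_atTop_add_const_right _ δ tendsto_id)).eventually_lt_const (by linarith)
    have hlow : ∀ᶠ v in atTop, 1 - δ < ∫ w, a (v - δ - w) * K w :=
      (hKt.comp (tendsto_atTop_add_const_right _ (-δ) tendsto_id)).eventually_const_lt
        (by linarith)
    filter_upwards [hup, hlow] with v h1 h2
    constructor
    · have h3 : a v * ∫ w in Set.Icc (-δ) δ, K w ≤ exp (2 * δ) * ∫ w, a (v + δ - w) * K w := by
        rw [← integral_const_mul, ← integral_const_mul]
        refine (setIntegral_mono_on (hKi.const_mul _).integrableOn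
          ((hai (v + δ)).const_mul _).integrableOn measurableSet_Icc fun w hw => ?_).trans
          (setIntegral_le_integral ((hai (v + δ)).const_mul _) (.of_forall fun w => ?_))
        · rw [← mul_assoc]
          exact mul_le_mul_of_nonneg_right
            (hcmp v _ _ (by linarith [hw.2]) (by linarith [hw.1])) (hK0 w)
        · exact mul_nonneg (exp_pos _).le (mul_nonneg (ha0 _) (hK0 w))
      calc a v * (1 - δ) ≤ a v * ∫ w in Set.Icc (-δ) δ, K w :=
            mul_le_mul_of_nonneg_left hKδ (ha0 v)
        _ ≤ _ := h3
        _ ≤ _ := mul_le_mul_of_nonneg_left h1.le (exp_pos _).le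
    · have h3 : ∫ w in Set.Icc (-δ) δ, a (v - δ - w) * K w ≤ exp (2 * δ) * a v := by
        calc _ ≤ ∫ w in Set.Icc (-δ) δ, exp (2 * δ) * a v * K w :=
              setIntegral_mono_on (hai _).integrableOn (hKi.const_mul _).integrableOn
                measurableSet_Icc fun w hw => mul_le_mul_of_nonneg_right
                  (hcmp _ v _ (by linarith [hw.1]) (by linarith [hw.2])) (hK0 w)
          _ ≤ ∫ w, exp (2 * δ) * a v * K w :=
              setIntegral_le_integral (hKi.const_mul _) (.of_forall fun w =>
                mul_nonneg (mul_nonneg (exp_pos _).le (ha0 _)) (hK0 w))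
          _ = _ := by rw [integral_const_mul, hK1, mul_one]
      have h4 : ∫ w in (Set.Icc (-δ) δ)ᶜ, a (v - δ - w) * K w ≤ M * δ := by
        calc _ ≤ ∫ w in (Set.Icc (-δ) δ)ᶜ, M * K w :=
              setIntegral_mono (hai _).integrableOn (hKi.const_mul _).integrableOn
                fun w => mul_le_mul_of_nonneg_right (hM _) (hK0 w)
          _ ≤ _ := by
              rw [integral_const_mul]
              exact mul_le_mul_of_nonneg_left hout hM0
      have h5 := integral_add_compl (measurableSet_Icc (a := -δ) (b := δ)) (hai (v - δ))
      linarith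
  rw [tendsto_order]
  constructor
  · intro c hc
    have ht : Tendsto (fun δ : ℝ => exp (2 * δ) * c + M * δ - (1 - δ)) (nhdsWithin 0 (Set.Ioi 0))
        (nhds (c - 1)) := by
      have hcont : Continuous fun δ : ℝ => exp (2 * δ) * c + M * δ - (1 - δ) := by fun_prop
      simpa using (hcont.tendsto 0).mono_left nhdsWithin_le_nhds
    obtain ⟨δ, hδ, hδ0⟩ := ((ht.eventually_lt_const (sub_neg.mpr hc)).and
      self_mem_nhdsWithin).exists
    filter_upwards [bounds δ hδ0] with v hv
    have : exp (2 * δ) * c < exp (2 * δ) * a v := by linarith [hv.2]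
    exact lt_of_mul_lt_mul_left this (exp_pos _).le
  · intro c hc
    have ht : Tendsto (fun δ : ℝ => exp (2 * δ) * (1 + δ) - c * (1 - δ))
        (nhdsWithin 0 (Set.Ioi 0)) (nhds (1 - c)) := by
      have hcont : Continuous fun δ : ℝ => exp (2 * δ) * (1 + δ) - c * (1 - δ) := by fun_prop
      simpa using (hcont.tendsto 0).mono_left nhdsWithin_le_nhds
    obtain ⟨δ, hδ, hδ0⟩ := ((ht.eventually_lt_const (sub_neg.mpr hc)).and
      (Ioo_mem_nhdsGT zero_lt_one)).exists
    filter_upwards [bounds δ hδ0.1] with v hv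
    have : a v * (1 - δ) < c * (1 - δ) := by linarith [hv.1]
    exact lt_of_mul_lt_mul_right this (by linarith [hδ0.2])

/-- A Wiener–Ikehara theorem for the Laplace transform of a bounded function: the transform of
`a - 1` extends continuously to the closed right half plane, so `a` tends to `1`. -/
theorem tendsto_one_of_laplace_continuousOn {g : ℂ → ℂ} (ha : Measurable a) (ha0 : ∀ u, 0 ≤ a u)
    (hM : ∀ u, a u ≤ M) (hneg : ∀ u ≤ 0, a u = 0) (hmono : Monotone fun u => a u * exp u)
    (hg : ContinuousOn g {z | 0 ≤ z.re})
    (hga : ∀ z : ℂ, 0 < z.re →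
      g z = ∫ u in Set.Ioi (0 : ℝ), ((a u - 1 : ℝ) : ℂ) * Complex.exp (-(z * u))) :
    Tendsto a atTop (nhds 1) := by
  refine tendsto_one_of_concentrated_averages ha ha0 hM hmono fun δ hδ => ?_
  set I := ∫ u : ℝ, sinc (u / 2) ^ 2 with hI
  have hI0 : 0 < I := integral_sinc_sq_pos
  obtain ⟨r, hr, hrδ⟩ : ∃ r : ℝ, 0 < r ∧
      I - δ * I ≤ ∫ u in Set.Icc (-(r * δ)) (r * δ), sinc (u / 2) ^ 2 := by
    have hat : Tendsto (fun r : ℝ => r * δ) atTop atTop := tendsto_id.atTop_mul_const hδ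
    have h := (aecover_Icc (μ := volume) (tendsto_neg_atTop_atBot.comp hat)
      hat).integral_tendsto_of_countably_generated integrable_sinc_sq
    have hlt : I - δ * I < I := by linarith [mul_pos hδ hI0]
    obtain ⟨r, h1, h2⟩ := ((h.eventually_const_lt hlt).and (eventually_gt_atTop 0)).exists
    exact ⟨r, h2, h1.le⟩
  have hki : Integrable fun w : ℝ => sinc (r * w / 2) ^ 2 :=
    integrable_sinc_sq.comp_mul_left' hr.ne'
  have hkI : ∫ w : ℝ, sinc (r * w / 2) ^ 2 = I / r := by
    rw [Measure.integral_comp_mul_left (fun u => sinc (u / 2) ^ 2) r, abs_of_pos (inv_pos.mpr hr),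
      smul_eq_mul, hI]
    ring
  refine ⟨fun w => r / I * sinc (r * w / 2) ^ 2, fun w => by positivity, hki.const_mul _, ?_, ?_,
    ?_⟩
  · rw [integral_const_mul, hkI]
    field_simp
  · have h : ∫ w in Set.Icc (-δ) δ, sinc (r * w / 2) ^ 2 =
        r⁻¹ * ∫ u in Set.Icc (-(r * δ)) (r * δ), sinc (u / 2) ^ 2 := by
      rw [integral_Icc_eq_integral_Ioc, integral_Icc_eq_integral_Ioc,
        ← intervalIntegral.integral_of_le (by linarith),
        ← intervalIntegral.integral_of_le (by linarith [mul_pos hr hδ]),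
        intervalIntegral.integral_comp_mul_left (fun u => sinc (u / 2) ^ 2) hr.ne']
      simp
    rw [integral_const_mul, h, ← mul_assoc]
    have h2 : r / I * r⁻¹ = I⁻¹ := by field_simp
    rw [h2, inv_mul_eq_div, le_div_iff₀ hI0]
    linarith
  · have hb := tendsto_integral_mul_sinc_sq (b := fun u => a u - 1) (M := M + 1) (by fun_prop)
      (fun u => by rw [abs_le]; constructor <;> linarith [ha0 u, hM u]) hg hga hr
    have hc := (aecover_Iio (μ := volume) (tendsto_id (α := ℝ)
      (x := atTop))).integral_tendsto_of_countably_generated hki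
    have hsum := (hb.add hc).const_mul (r / I)
    have hone : r / I * (0 + ∫ w : ℝ, sinc (r * w / 2) ^ 2) = 1 := by
      rw [hkI]
      field_simp
      ring
    rw [hone] at hsum
    refine hsum.congr fun v => ?_
    have hkv : Integrable fun u : ℝ => sinc (r * (v - u) / 2) ^ 2 := hki.comp_sub_left v
    have h1 : ∫ w in Set.Iio v, sinc (r * w / 2) ^ 2 =
        ∫ u in Set.Ioi (0 : ℝ), sinc (r * (v - u) / 2) ^ 2 := by
      rw [← integral_indicator measurableSet_Iio, ← integral_indicator measurableSet_Ioi,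
        ← integral_sub_left_eq_self _ volume v]
      refine integral_congr_ae (.of_forall fun u => ?_)
      simp [Set.indicator_apply]
    have hav : Integrable fun u : ℝ => a u * sinc (r * (v - u) / 2) ^ 2 :=
      hkv.bdd_mul (c := M) ha.aestronglyMeasurable
        (.of_forall fun u => by rw [norm_of_nonneg (ha0 _)]; exact hM _)
    have h2 : ∫ u in Set.Ioi (0 : ℝ), a u * sinc (r * (v - u) / 2) ^ 2 =
        ∫ u, a u * sinc (r * (v - u) / 2) ^ 2 := by
      refine setIntegral_eq_integral_of_forall_compl_eq_zero fun u hu => ?_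
      rw [hneg u (not_lt.mp hu), zero_mul]
    simp only [id]
    rw [h1]
    simp_rw [sub_mul, one_mul]
    rw [integral_sub hav.integrableOn hkv.integrableOn, sub_add_cancel, h2,
      ← integral_sub_left_eq_self _ volume v, ← integral_const_mul]
    refine integral_congr_ae (.of_forall fun u => ?_)
    simp only [sub_sub_cancel]
    ring

end WienerIkehara

section PrimeNumberTheorem

open MeasureTheory ArithmeticFunction Chebyshev

theorem residueClass_zmod_one (n : ℕ) :
    vonMangoldt.residueClass (1 : ZMod 1) n = vonMangoldt n := by
  simp [vonMangoldt.residueClass, Subsingleton.elim _ (1 : ZMod 1)]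

theorem LSeries_vonMangoldt_eq_laplace {z : ℂ} (hz : 0 < z.re) :
    LSeries (fun n => (vonMangoldt n : ℂ)) (z + 1) =
      (z + 1) * ∫ u in Set.Ioi (0 : ℝ),
        ((psi (exp u) * exp (-u) : ℝ) : ℂ) * Complex.exp (-(z * u)) := by
  have hO : (fun n : ℕ => ∑ k ∈ Finset.Icc 1 n, vonMangoldt k) =O[atTop]
      fun n : ℕ => (n : ℝ) ^ (1 : ℝ) := by
    refine IsBigO.of_bound (Real.log 4 + 4) (.of_forall fun n => ?_)
    have h1 : ∑ k ∈ Finset.Icc 1 n, vonMangoldt k = psi n := by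
      rw [psi, Nat.floor_natCast]
      rfl
    rw [h1, rpow_one, norm_of_nonneg (psi_nonneg _), norm_of_nonneg (Nat.cast_nonneg n)]
    exact psi_le_const_mul_self (Nat.cast_nonneg n)
  rw [LSeries_eq_mul_integral_of_nonneg _ zero_le_one (by simpa using hz) hO
    fun _ => vonMangoldt_nonneg]
  congr 1
  rw [← exp_zero, ← integral_comp_exp_Ioi]
  refine setIntegral_congr_fun measurableSet_Ioi fun u _ => ?_
  have h1 : (∑ k ∈ Finset.Icc 1 ⌊exp u⌋₊, (vonMangoldt k : ℂ)) = (psi (exp u) : ℂ) := by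
    rw [psi]
    push_cast
    rfl
  have h2 : ((exp u : ℝ) : ℂ) ^ (-(z + 1 + 1)) = Complex.exp (-(z + 1 + 1) * u) := by
    rw [Complex.cpow_def_of_ne_zero (by exact_mod_cast (exp_pos u).ne'), ← Complex.ofReal_log
      (exp_pos u).le, log_exp, mul_comm]
  simp only [h1, h2, Complex.real_smul]
  push_cast
  rw [mul_left_comm, ← Complex.exp_add, mul_assoc, ← Complex.exp_add]
  congr 2
  ring

theorem tendsto_psi_exp_mul_exp_neg :
    Tendsto (fun u => psi (exp u) * exp (-u)) atTop (nhds 1) := by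
  have hbd : ∀ u, psi (exp u) * exp (-u) ≤ Real.log 4 + 4 := fun u => by
    rw [exp_neg, ← div_eq_mul_inv, div_le_iff₀ (exp_pos u)]
    exact psi_le_const_mul_self (exp_pos u).le
  have hmeas : Measurable fun u => psi (exp u) * exp (-u) :=
    (psi_mono.measurable.comp measurable_exp).mul (by fun_prop)
  have hnn : ∀ u, 0 ≤ psi (exp u) * exp (-u) := fun u =>
    mul_nonneg (psi_nonneg _) (exp_pos _).le
  refine tendsto_one_of_laplace_continuousOn (M := Real.log 4 + 4)
    (g := fun z => (vonMangoldt.LFunctionResidueClassAux (1 : ZMod 1) (z + 1) - 1) / (z + 1))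
    hmeas hnn hbd (fun u hu => ?_) (fun s t hst => ?_) ?_ fun z hz => ?_
  · rw [psi_eq_zero_of_le_one (exp_le_one_iff.mpr hu), zero_mul]
  · simp only [mul_assoc, ← exp_add, neg_add_cancel, exp_zero, mul_one]
    exact psi_mono (exp_le_exp.mpr hst)
  · refine ContinuousOn.div (ContinuousOn.sub ?_ continuousOn_const) (by fun_prop) fun z hz h => ?_
    · exact (vonMangoldt.continuousOn_LFunctionResidueClassAux (1 : ZMod 1)).comp
        (by fun_prop) fun z hz => by simpa using hz
    · have h1 := congrArg Complex.re h
      have h2 : 0 ≤ z.re := hz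
      simp at h1
      linarith
  · have hz0 : z ≠ 0 := fun h => by simp [h] at hz
    have hs0 : z + 1 ≠ 0 := fun h => by
      have h1 := congrArg Complex.re h
      simp at h1
      linarith
    have haux := vonMangoldt.eqOn_LFunctionResidueClassAux (a := (1 : ZMod 1)) isUnit_one
      (x := z + 1) (by simpa using hz)
    simp only [residueClass_zmod_one, LSeries_vonMangoldt_eq_laplace hz] at haux
    have he : IntegrableOn (fun u : ℝ => Complex.exp (-(z * u))) (Set.Ioi 0) := by
      simpa using integrableOn_exp_mul_complex_Ioi (a := -z) (by simpa using hz) 0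
    have hI : ∫ u in Set.Ioi (0 : ℝ), Complex.exp (-(z * u)) = 1 / z := by
      have := integral_exp_mul_complex_Ioi (a := -z) (by simpa using hz) 0
      simpa using this
    have hai : IntegrableOn (fun u : ℝ =>
        ((psi (exp u) * exp (-u) : ℝ) : ℂ) * Complex.exp (-(z * u))) (Set.Ioi 0) :=
      he.bdd_mul (c := Real.log 4 + 4)
        (Complex.measurable_ofReal.comp hmeas).aestronglyMeasurable (.of_forall fun u => by
          rw [Complex.norm_real, norm_of_nonneg (hnn u)]; exact hbd u)
    simp_rw [Complex.ofReal_sub, sub_mul, Complex.ofReal_one, one_mul]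
    rw [integral_sub hai he, hI, haux]
    simp only [Nat.totient_one, Nat.cast_one, inv_one, add_sub_cancel_right]
    field_simp
    ring

theorem tendsto_psi_div_self : Tendsto (fun x => psi x / x) atTop (nhds 1) := by
  refine (tendsto_psi_exp_mul_exp_neg.comp tendsto_log_atTop).congr' ?_
  filter_upwards [eventually_gt_atTop 0] with x hx
  simp only [Function.comp_apply, exp_neg, exp_log hx, div_eq_mul_inv]

theorem tendsto_theta_div_self : Tendsto (fun x => theta x / x) atTop (nhds 1) := by
  have h0 : Tendsto (fun x => (psi x - theta x) / x) atTop (nhds 0) := by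
    have h1 : (psi - theta) =o[atTop] (id : ℝ → ℝ) := by
      refine isBigO_psi_sub_theta_sqrt.trans_isLittleO ?_
      refine (isLittleO_iff_tendsto' ?_).mpr ?_
      · filter_upwards [eventually_gt_atTop 0] with x hx h
        exact absurd h hx.ne'
      · refine (tendsto_inv_atTop_zero.comp tendsto_sqrt_atTop).congr fun x => ?_
        simp only [Function.comp_apply, id, sqrt_div_self', one_div]
    exact h1.tendsto_div_nhds_zero
  have h := tendsto_psi_div_self.sub h0
  rw [sub_zero] at h
  refine h.congr fun x => ?_
  ring

/-- The **prime number theorem**. -/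
theorem tendsto_primeCounting_mul_log_div :
    Tendsto (fun x : ℝ => Nat.primeCounting ⌊x⌋₊ * log x / x) atTop (nhds 1) := by
  have h := tendsto_theta_div_self.add integral_theta_div_log_sq_isLittleO.tendsto_div_nhds_zero
  rw [add_zero] at h
  refine h.congr' ?_
  filter_upwards [eventually_ge_atTop 2] with x hx
  rw [primeCounting_eq_theta_div_log_add_integral hx]
  have hl : 0 < log x := log_pos (by linarith)
  field_simp

end PrimeNumberTheorem

section Counting

theorem mul_prime_pow_three_inj {p q r s : ℕ} (hq : q.Prime) (hr : r.Prime) (hs : s.Prime)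
    (h : p * q ^ 3 = r * s ^ 3) : p = r ∧ q = s := by
  have hqs : q = s := by
    by_contra hne
    have hco : Nat.Coprime (q ^ 3) (s ^ 3) :=
      Nat.Coprime.pow 3 3 ((Nat.coprime_primes hq hs).mpr hne)
    have hdvd : q ^ 3 ∣ r := hco.dvd_of_dvd_mul_right (h ▸ dvd_mul_left _ _)
    rcases (Nat.dvd_prime hr).mp hdvd with h1 | h1
    · exact hq.ne_one ((Nat.pow_eq_one.mp h1).resolve_right three_ne_zero)
    · exact Nat.Prime.not_prime_pow (by norm_num : 2 ≤ 3) (h1 ▸ hr)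
  subst hqs
  exact ⟨Nat.eq_of_mul_eq_mul_right (pow_pos hq.pos 3) h, rfl⟩

theorem card_mul_prime_pow_three (x : ℝ) (hx : 0 ≤ x) :
    (Nat.card {n : ℕ | (n : ℝ) ≤ x ∧ ∃ p q : ℕ, p.Prime ∧ q.Prime ∧ n = p * q ^ 3} : ℝ) =
      ∑' q : {q : ℕ // q.Prime}, (Nat.primeCounting ⌊x / (q : ℝ) ^ 3⌋₊ : ℝ) := by
  classical
  have hle : ∀ {p q : ℕ}, q.Prime →
      (p ≤ ⌊x / (q : ℝ) ^ 3⌋₊ ↔ ((p * q ^ 3 : ℕ) : ℝ) ≤ x) := fun {p q} hq => by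
    have hq0 : (0 : ℝ) < (q : ℝ) ^ 3 := pow_pos (by exact_mod_cast hq.pos) 3
    rw [Nat.le_floor_iff (by positivity), le_div_iff₀ hq0]
    push_cast
    rfl
  have hset : {n : ℕ | (n : ℝ) ≤ x ∧ ∃ p q : ℕ, p.Prime ∧ q.Prime ∧ n = p * q ^ 3} =
      ((Nat.primesLE ⌊x⌋₊).biUnion fun q =>
        (Nat.primesLE ⌊x / (q : ℝ) ^ 3⌋₊).image (· * q ^ 3) : Finset ℕ) := by
    ext n
    simp only [Set.mem_ofPred_eq, Finset.coe_biUnion, Finset.mem_coe, Set.mem_iUnion,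
      Nat.mem_primesLE, exists_prop, Finset.coe_image, Set.mem_image]
    constructor
    · rintro ⟨hn, p, q, hp, hq, rfl⟩
      refine ⟨q, ⟨Nat.le_floor (le_trans ?_ hn), hq⟩, p, ⟨(hle hq).mpr hn, hp⟩, rfl⟩
      have h1 : q ≤ p * q ^ 3 :=
        (Nat.le_self_pow three_ne_zero q).trans (Nat.le_mul_of_pos_left _ hp.pos)
      exact_mod_cast h1
    · rintro ⟨q, ⟨-, hq⟩, p, ⟨hpx, hp⟩, rfl⟩
      exact ⟨(hle hq).mp hpx, p, q, hp, hq, rfl⟩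
  have hcard : Nat.card {n : ℕ | (n : ℝ) ≤ x ∧ ∃ p q : ℕ, p.Prime ∧ q.Prime ∧ n = p * q ^ 3} =
      ∑ q ∈ Nat.primesLE ⌊x⌋₊, Nat.primeCounting ⌊x / (q : ℝ) ^ 3⌋₊ := by
    rw [hset, Nat.card_coe_set_eq, Set.ncard_coe_finset, Finset.card_biUnion]
    · refine Finset.sum_congr rfl fun q hq => ?_
      rw [Finset.card_image_of_injective _ (mul_left_injective₀
        (pow_ne_zero 3 (Nat.mem_primesLE.mp hq).2.ne_zero)), Nat.primesLE_card_eq_primeCounting]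
    · intro q hq s hs hqs
      refine Finset.disjoint_left.mpr fun n hn hn' => hqs ?_
      obtain ⟨p, hp, rfl⟩ := Finset.mem_image.mp hn
      obtain ⟨r, hr, hrs⟩ := Finset.mem_image.mp hn'
      exact ((mul_prime_pow_three_inj (Nat.mem_primesLE.mp hs).2 (Nat.mem_primesLE.mp hp).2
        (Nat.mem_primesLE.mp hq).2 hrs).2).symm
  rw [hcard, Nat.cast_sum]
  refine Eq.trans ?_ (tsum_subtype {q : ℕ | q.Prime}
    fun q => (Nat.primeCounting ⌊x / (q : ℝ) ^ 3⌋₊ : ℝ)).symm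
  rw [tsum_eq_sum (s := Nat.primesLE ⌊x⌋₊)]
  · refine Finset.sum_congr rfl fun q hq => ?_
    rw [Set.indicator_of_mem (show q ∈ {q : ℕ | q.Prime} from (Nat.mem_primesLE.mp hq).2)]
  · intro q hq
    by_cases hp : q.Prime
    · rw [Set.indicator_of_mem (show q ∈ {q : ℕ | q.Prime} from hp)]
      have hxq : x < q := by
        by_contra! h
        exact hq (Nat.mem_primesLE.mpr ⟨Nat.le_floor h, hp⟩)
      have h1 : ⌊x / (q : ℝ) ^ 3⌋₊ ≤ 1 := by
        refine Nat.floor_le_one_of_le_one ?_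
        have hq1 : (1 : ℝ) ≤ q := by exact_mod_cast hp.one_le
        rw [div_le_one (by positivity)]
        exact hxq.le.trans (le_self_pow₀ hq1 three_ne_zero)
      rw [Nat.primeCounting_eq_zero_iff.mpr h1, Nat.cast_zero]
    · exact Set.indicator_of_notMem hp _

theorem exists_primeCounting_mul_log_le :
    ∃ C : ℝ, 0 ≤ C ∧ ∀ y : ℝ, 1 ≤ y → Nat.primeCounting ⌊y⌋₊ * log y ≤ C * y := by
  refine ⟨2 * log 4 + 2, by positivity, fun y hy => ?_⟩
  rcases hy.eq_or_lt with rfl | hy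
  · simp
    positivity
  have h := Chebyshev.pi_le_log4_mul_div hy
  have hl : 0 < log y := log_pos hy
  rw [log_sqrt (by linarith)] at h
  have hs : √y * log y ≤ 2 * y := by
    have h1 : log √y ≤ √y := log_le_self (sqrt_nonneg y)
    rw [log_sqrt (by linarith)] at h1
    have h2 := mul_self_sqrt (show 0 ≤ y by linarith)
    nlinarith [sqrt_nonneg y]
  calc (Nat.primeCounting ⌊y⌋₊ : ℝ) * log y
      ≤ (log 4 * y / (log y / 2) + √y) * log y := mul_le_mul_of_nonneg_right h hl.le
    _ = 2 * log 4 * y + √y * log y := by field_simp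
    _ ≤ _ := by linarith

theorem exists_primeCounting_div_mul_log_le :
    ∃ C : ℝ, ∀ x : ℝ, 1 ≤ x → ∀ q : ℕ, q.Prime →
      Nat.primeCounting ⌊x / (q : ℝ) ^ 3⌋₊ * log x / x ≤ C * ((q : ℝ) ^ 2)⁻¹ := by
  obtain ⟨C, hC0, hC⟩ := exists_primeCounting_mul_log_le
  refine ⟨C + 3, fun x hx q hq => ?_⟩
  have hq1 : (1 : ℝ) ≤ q := by exact_mod_cast hq.one_le
  set y := x / (q : ℝ) ^ 3 with hy
  rcases lt_or_ge y 1 with hy1 | hy1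
  · rw [Nat.floor_eq_zero.mpr hy1, Nat.primeCounting_zero]
    simp only [Nat.cast_zero, zero_mul, zero_div]
    positivity
  have hxy : x = y * (q : ℝ) ^ 3 := by rw [hy]; field_simp
  have hlog : log x = log y + 3 * log q := by
    rw [hxy, log_mul (by positivity) (by positivity), log_pow]
    norm_num
  have hpi : (Nat.primeCounting ⌊y⌋₊ : ℝ) ≤ y := by
    refine le_trans ?_ (Nat.floor_le (by linarith))
    have h : Nat.primeCounting ⌊y⌋₊ ≤ ⌊y⌋₊ := by
      rw [← Nat.primesLE_card_eq_primeCounting]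
      refine (Finset.card_le_card (t := Finset.Icc 1 ⌊y⌋₊) fun p hp => ?_).trans (by simp)
      have := Nat.mem_primesLE.mp hp
      exact Finset.mem_Icc.mpr ⟨this.2.one_le, this.1⟩
    exact_mod_cast h
  have hlq : log q ≤ q := log_le_self (by positivity)
  have hlq0 : 0 ≤ log q := log_nonneg hq1
  have hnum : Nat.primeCounting ⌊y⌋₊ * log x ≤ (C + 3) * y * q := by
    have h1 := hC y hy1
    have h2 : Nat.primeCounting ⌊y⌋₊ * log q ≤ y * q := by gcongr
    have h3 : C * y ≤ C * y * q := le_mul_of_one_le_right (by positivity) hq1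
    rw [hlog]
    linarith
  rw [div_le_iff₀ (by linarith)]
  refine hnum.trans (le_of_eq ?_)
  rw [hxy]
  field_simp

theorem tendsto_primeCounting_div_mul_log {c : ℝ} (hc : 0 < c) :
    Tendsto (fun x : ℝ => Nat.primeCounting ⌊x / c⌋₊ * log x / x) atTop (nhds c⁻¹) := by
  have hdiv : Tendsto (fun x : ℝ => x / c) atTop atTop := tendsto_id.atTop_div_const hc
  have hpnt := tendsto_primeCounting_mul_log_div.comp hdiv
  have hlog : Tendsto (fun x : ℝ => 1 + log c / log (x / c)) atTop (nhds (1 + 0)) :=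
    ((tendsto_log_atTop.comp hdiv).const_div_atTop (log c)).const_add 1
  have h := (hpnt.mul hlog).mul_const c⁻¹
  simp only [add_zero, one_mul] at h
  refine h.congr' ?_
  filter_upwards [hdiv.eventually_gt_atTop 1, eventually_gt_atTop 0] with x hx hx0
  have hl : 0 < log (x / c) := log_pos hx
  have hlx : log x = log (x / c) + log c := by
    rw [← log_mul (by positivity) hc.ne', div_mul_cancel₀ x hc.ne']
  simp only [Function.comp_apply]
  rw [hlx]
  field_simp

end Counting

/-- the number of `n ≤ x` of the form `n = p q³` with `p, q` primes (not necessarily distinct) is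
asymptotic to `P(3) ⋅ x / log x`, where `P(3) = ∑ₚ p^{-3}`. -/
theorem count_pq3 :
    Tendsto
      (fun x : ℝ =>
        (Nat.card {n : ℕ | (n : ℝ) ≤ x ∧
            ∃ p q : ℕ, p.Prime ∧ q.Prime ∧ n = p * q ^ 3} : ℝ) /
          ((∑' p : {p : ℕ // p.Prime}, ((p : ℕ) : ℝ) ^ (-(3 : ℝ))) * (x / Real.log x)))
      atTop (nhds 1) := by
  have hterm : ∀ q : ℕ, (q : ℝ) ^ (-(3 : ℝ)) = ((q : ℝ) ^ 3)⁻¹ := fun q => by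
    rw [rpow_neg (Nat.cast_nonneg q)]
    norm_cast
  simp only [hterm]
  set P := ∑' q : {q : ℕ // q.Prime}, (((q : ℕ) : ℝ) ^ 3)⁻¹ with hP
  have hsum2 : Summable fun q : {q : ℕ // q.Prime} => (((q : ℕ) : ℝ) ^ 2)⁻¹ :=
    (Real.summable_nat_pow_inv.mpr one_lt_two).comp_injective Subtype.val_injective
  have hsum3 : Summable fun q : {q : ℕ // q.Prime} => (((q : ℕ) : ℝ) ^ 3)⁻¹ :=
    (Real.summable_nat_pow_inv.mpr (by norm_num)).comp_injective Subtype.val_injective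
  have hP0 : 0 < P := hsum3.tsum_pos (fun q => by positivity) ⟨2, Nat.prime_two⟩ (by norm_num)
  obtain ⟨C, hC⟩ := exists_primeCounting_div_mul_log_le
  have hlim : Tendsto (fun x : ℝ => ∑' q : {q : ℕ // q.Prime},
      Nat.primeCounting ⌊x / ((q : ℕ) : ℝ) ^ 3⌋₊ * log x / x) atTop (nhds P) := by
    refine tendsto_tsum_of_dominated_convergence (hsum2.mul_left C) (fun q => ?_) ?_
    · exact tendsto_primeCounting_div_mul_log (pow_pos (by exact_mod_cast q.2.pos) 3)
    · filter_upwards [eventually_ge_atTop 1] with x hx q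
      have hl := log_nonneg hx
      rw [norm_of_nonneg (by positivity)]
      exact hC x hx q q.2
  have h := hlim.div_const P
  rw [div_self hP0.ne'] at h
  refine h.congr' ?_
  filter_upwards [eventually_gt_atTop 1] with x hx
  have hl := log_pos hx
  rw [card_mul_prime_pow_three x (by linarith)]
  simp_rw [mul_div_assoc]
  rw [tsum_mul_right]
  field_simp
end

section
/- Let α < α₁ ≤ ⋯ ≤ α_r be positive integers and k > 1. The number of (k+r)-tuples of primes (q₁, …, q_k, p₁, …, p_r) with q₁, …, q_k distinct, p₁, …, p_r distinct, q₁^α⋯q_k^α p₁^{α₁}⋯p_r^{α_r} ≤ x, and gcd(q₁⋯q_k, p₁^{α₁}⋯p_r^{α_r}) > 1 is O(x^{1/α}(log log x)^{k-2}/log x). -/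
open Filter Asymptotics Real

/-- Chebyshev's upper bound for the prime counting function, with an explicit constant. -/
lemma primeCounting_floor_le_div_log {x : ℝ} (hx : 1 < x) :
    (Nat.primeCounting ⌊x⌋₊ : ℝ) ≤ (2 * log 4 + 2) * (x / log x) := by
  have hlog : 0 < log x := log_pos hx
  have hsqrt : √x ≤ 2 * (x / log x) := by
    have hle : log √x ≤ √x := log_le_self (sqrt_nonneg x)
    rw [log_sqrt (by linarith)] at hle
    rw [mul_div_assoc', le_div_iff₀ hlog]
    nlinarith [mul_self_sqrt (show 0 ≤ x by linarith), sqrt_nonneg x]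
  have hpi := Chebyshev.pi_le_log4_mul_div hx
  rw [log_sqrt (by linarith)] at hpi
  have : log 4 * x / (log x / 2) = 2 * log 4 * (x / log x) := by field_simp
  linarith

/-- The reciprocals of the primes below `2 ^ n` sum to at most a constant times `harmonic n`. -/
lemma sum_inv_primesBelow_two_pow_le (n : ℕ) :
    ∑ p ∈ Nat.primesBelow (2 ^ n), (p : ℝ)⁻¹ ≤
      (2 * (2 * log 4 + 2) / log 2) * (harmonic n : ℝ) := by
  induction n with
  | zero => simp
  | succ n ih =>
    have hsub : Nat.primesBelow (2 ^ n) ⊆ Nat.primesBelow (2 ^ (n + 1)) :=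
      Nat.primesBelow_mono (Nat.pow_le_pow_right two_pos n.le_succ)
    have hcard : ((Nat.primesBelow (2 ^ (n + 1)) \ Nat.primesBelow (2 ^ n)).card : ℝ) ≤
        (2 * log 4 + 2) * (2 ^ (n + 1) / ((n + 1) * log 2)) := by
      have hx : (1 : ℝ) < 2 ^ (n + 1) := one_lt_pow₀ (by norm_num) (by simp)
      have hpi := primeCounting_floor_le_div_log hx
      rw [log_pow] at hpi
      push_cast at hpi
      refine le_trans ?_ hpi
      have hfloor : ⌊(2 : ℝ) ^ (n + 1)⌋₊ = 2 ^ (n + 1) := by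
        exact_mod_cast Nat.floor_natCast (R := ℝ) (2 ^ (n + 1))
      rw [hfloor, ← Nat.primesLE_card_eq_primeCounting]
      exact_mod_cast Finset.card_le_card
        (Finset.sdiff_subset.trans (Nat.primesBelow_mono (Nat.le_succ _)))
    have hblock : ∑ p ∈ Nat.primesBelow (2 ^ (n + 1)) \ Nat.primesBelow (2 ^ n), (p : ℝ)⁻¹ ≤
        (2 * (2 * log 4 + 2) / log 2) * ((n : ℝ) + 1)⁻¹ := by
      calc _ ≤ ∑ p ∈ Nat.primesBelow (2 ^ (n + 1)) \ Nat.primesBelow (2 ^ n),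
              ((2 : ℝ) ^ n)⁻¹ := by
            refine Finset.sum_le_sum fun p hp => ?_
            simp only [Finset.mem_sdiff, Nat.mem_primesBelow, not_and'] at hp
            have : 2 ^ n ≤ p := not_lt.mp (hp.2 hp.1.2)
            gcongr
            exact_mod_cast this
        _ = ((Nat.primesBelow (2 ^ (n + 1)) \ Nat.primesBelow (2 ^ n)).card : ℝ) *
              ((2 : ℝ) ^ n)⁻¹ := by simp
        _ ≤ (2 * log 4 + 2) * (2 ^ (n + 1) / ((n + 1) * log 2)) * ((2 : ℝ) ^ n)⁻¹ := by
            gcongr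
        _ = _ := by
            have : 0 < log 2 := log_pos (by norm_num)
            field_simp
            ring
    rw [← Finset.sum_sdiff hsub, harmonic_succ]
    push_cast
    linarith

/-- The upper bound in Mertens' second theorem: `∑_{p ≤ x} 1 / p = O(log log x)`. -/
lemma sum_inv_primesLE_isBigO_log_log :
    (fun x : ℝ => ∑ p ∈ Nat.primesLE ⌊x⌋₊, (p : ℝ)⁻¹) =O[atTop]
      (fun x : ℝ => log (log x)) := by
  set K : ℝ := 2 * (2 * log 4 + 2) / log 2
  have hlog2 : 0 < log 2 := log_pos (by norm_num)
  have hK : 0 ≤ K := by positivity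
  have hone : (fun _ : ℝ => K * (1 + log 3)) =O[atTop] (fun x : ℝ => log (log x)) :=
    (isLittleO_const_left.mpr (Or.inr (tendsto_norm_atTop_atTop.comp
      (tendsto_log_atTop.comp tendsto_log_atTop)))).isBigO
  refine IsBigO.trans (IsBigO.of_bound 1 ?_)
    (hone.add ((isBigO_refl (fun x : ℝ => log (log x)) atTop).const_mul_left K))
  filter_upwards [eventually_ge_atTop (exp 1)] with x hx
  have hlogx : 1 ≤ log x := by rwa [le_log_iff_exp_le (by linarith [exp_pos 1])]
  have hx1 : 1 ≤ x := by linarith [one_le_exp (show (0 : ℝ) ≤ 1 by norm_num)]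
  have hfl : ⌊x⌋₊ ≠ 0 := by simpa using hx1
  set n := Nat.log 2 ⌊x⌋₊ + 1
  have hn : (n : ℝ) ≤ 3 * log x := by
    have h1 : (2 : ℝ) ^ Nat.log 2 ⌊x⌋₊ ≤ x :=
      le_trans (by exact_mod_cast Nat.pow_log_le_self 2 hfl) (Nat.floor_le (by linarith))
    have h2 := log_le_log (by positivity) h1
    rw [log_pow] at h2
    have : (0.5 : ℝ) < log 2 := by linarith [log_two_gt_d9]
    have : ((Nat.log 2 ⌊x⌋₊ : ℕ) : ℝ) * 0.5 ≤ Nat.log 2 ⌊x⌋₊ * log 2 := by gcongr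
    simp only [n]
    push_cast
    linarith
  have hsum : ∑ p ∈ Nat.primesLE ⌊x⌋₊, (p : ℝ)⁻¹ ≤ K * (1 + log 3) + K * log (log x) := by
    calc _ ≤ ∑ p ∈ Nat.primesBelow (2 ^ n), (p : ℝ)⁻¹ := by
          refine Finset.sum_le_sum_of_subset_of_nonneg
            (Nat.primesBelow_mono (Nat.lt_pow_succ_log_self one_lt_two _)) ?_
          intros; positivity
      _ ≤ K * (harmonic n : ℝ) := sum_inv_primesBelow_two_pow_le n
      _ ≤ K * (1 + log (3 * log x)) := by
          gcongr
          exact (harmonic_le_one_add_log n).trans (by gcongr)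
      _ = _ := by rw [log_mul (by norm_num) (by linarith)]; ring
  have h0 : 0 ≤ ∑ p ∈ Nat.primesLE ⌊x⌋₊, (p : ℝ)⁻¹ :=
    Finset.sum_nonneg fun _ _ => by positivity
  rw [norm_of_nonneg h0, norm_of_nonneg (h0.trans hsum), one_mul]
  exact hsum

/-- If `m a^α Q^α ≤ x` for some `Q ≥ 2` with `a ≤ Q^l`, then the number of primes up to
`(x / m)^{1/α} / a` saves a full factor `log x`, at the cost of a small power of `m`. -/
lemma exists_primeCounting_le_of_mul_pow_le (α l : ℕ) (hα : 0 < α) :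
    ∃ C : ℝ, 0 ≤ C ∧ ∀ x m a Q : ℝ, 1 < x → 1 ≤ m → 1 ≤ a → 2 ≤ Q → a ≤ Q ^ l →
      m * a ^ α * Q ^ α ≤ x →
      (Nat.primeCounting ⌊(x / m) ^ (1 / (α : ℝ)) / a⌋₊ : ℝ) ≤
        C * (x ^ (1 / (α : ℝ)) / log x) *
          (m ^ (-((1 + 1 / (2 * (α : ℝ))) / (α + 1))) * a⁻¹) := by
  have hα' : (0 : ℝ) < α := by exact_mod_cast hα
  have hlog2 : 0 < log 2 := log_pos (by norm_num)
  have hlog4 : 0 < log 4 := log_pos (by norm_num)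
  set δ : ℝ := 1 / (2 * α * (α + 1)) with hδ
  have hδ0 : 0 < δ := by positivity
  refine ⟨(2 * log 4 + 2) * (l + 1) * (α + 1 / (δ * log 2)), by positivity, ?_⟩
  intro x m a Q hx hm ha hQ haQ hle
  have hm0 : 0 < m := by linarith
  have ha0 : 0 < a := by linarith
  have hx0 : 0 < x := by linarith
  set y : ℝ := (x / m) ^ (1 / (α : ℝ)) with hy
  have hy0 : 0 < y := by positivity
  set Y : ℝ := y / a with hY
  have hQY : Q ≤ Y := by
    rw [hY, le_div_iff₀ ha0, hy, one_div, Real.le_rpow_inv_iff_of_pos (by positivity)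
      (by positivity) hα', rpow_natCast, le_div_iff₀ hm0, mul_pow]
    linarith
  have hY2 : 2 ≤ Y := hQ.trans hQY
  have haY : y ≤ Y ^ (l + 1) := by
    have : a ≤ Y ^ l := haQ.trans (by gcongr)
    calc y = Y * a := by rw [hY]; field_simp
      _ ≤ Y * Y ^ l := by gcongr
      _ = Y ^ (l + 1) := by ring
  have hY_le : Y ≤ y := div_le_self hy0.le ha
  have hlogY : 0 < log Y := log_pos (by linarith)
  have hlogy : log 2 ≤ log y := log_le_log (by norm_num) (by linarith)
  have hlogy_le : log y ≤ (l + 1) * log Y := by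
    have := log_le_log hy0 haY
    rw [log_pow] at this
    exact_mod_cast this
  have hlogx : 0 < log x := log_pos hx
  have hlog_eq : log x = log m + α * log y := by
    rw [hy, log_rpow (by positivity), log_div hx0.ne' hm0.ne']
    field_simp
    ring
  have hmδ : 1 ≤ m ^ δ := one_le_rpow hm hδ0.le
  have hlogm : log m ≤ m ^ δ / δ := log_le_rpow_div hm0.le hδ0
  have hlogx_le : log x ≤ log y * ((α + 1 / (δ * log 2)) * m ^ δ) := by
    have h1 : log m ≤ log y * (1 / (δ * log 2) * m ^ δ) := by
      calc log m ≤ m ^ δ / δ := hlogm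
        _ = log 2 * (1 / (δ * log 2) * m ^ δ) := by field_simp
        _ ≤ _ := by gcongr
    have h2 : α * log y ≤ log y * (α * m ^ δ) := by
      nlinarith [mul_le_mul_of_nonneg_left hmδ (mul_nonneg hα'.le (hlog2.le.trans hlogy))]
    rw [hlog_eq]
    linarith
  have hinv : 1 / log Y ≤ (l + 1) * ((α + 1 / (δ * log 2)) * m ^ δ) / log x := by
    rw [div_le_div_iff₀ hlogY hlogx, one_mul]
    calc log x ≤ log y * ((α + 1 / (δ * log 2)) * m ^ δ) := hlogx_le
      _ ≤ ((l + 1) * log Y) * ((α + 1 / (δ * log 2)) * m ^ δ) := by gcongr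
      _ = _ := by ring
  have hexp : y * m ^ δ = x ^ (1 / (α : ℝ)) *
      m ^ (-((1 + 1 / (2 * (α : ℝ))) / (α + 1))) := by
    have : -((1 + 1 / (2 * (α : ℝ))) / (α + 1)) = δ - 1 / α := by
      rw [hδ]; field_simp; ring
    rw [this, rpow_sub hm0, hy, div_rpow hx0.le hm0.le]
    ring
  calc (Nat.primeCounting ⌊Y⌋₊ : ℝ) ≤ (2 * log 4 + 2) * (Y / log Y) :=
        primeCounting_floor_le_div_log (by linarith)
    _ = (2 * log 4 + 2) * Y * (1 / log Y) := by ring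
    _ ≤ (2 * log 4 + 2) * Y * ((l + 1) * ((α + 1 / (δ * log 2)) * m ^ δ) / log x) := by
        gcongr
    _ = (2 * log 4 + 2) * (l + 1) * (α + 1 / (δ * log 2)) * ((y * m ^ δ) / log x) * a⁻¹ := by
        rw [hY]; ring
    _ = _ := by rw [hexp]; ring

lemma prod_eq_mul_mul_prod_subtype_ne {ι M : Type*} [Fintype ι] [DecidableEq ι] [CommMonoid M]
    {i i' : ι} (hne : i' ≠ i) (f : ι → M) :
    ∏ l, f l = f i * (f i' * ∏ l : {l // l ≠ i ∧ l ≠ i'}, f l) := by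
  rw [← Finset.mul_prod_erase _ _ (Finset.mem_univ i),
    ← Finset.mul_prod_erase _ _ (Finset.mem_erase.mpr ⟨hne, Finset.mem_univ i'⟩),
    Finset.prod_subtype ((Finset.univ.erase i).erase i') (p := fun l => l ≠ i ∧ l ≠ i')
      (by simp [and_comm])]

lemma card_subtype_ne_and_ne {k : ℕ} {i i' : Fin k} (hne : i' ≠ i) :
    Fintype.card {l // l ≠ i ∧ l ≠ i'} = k - 2 := by
  rw [Fintype.card_of_subtype ((Finset.univ.erase i).erase i') (by simp [and_comm]),
    Finset.card_erase_of_mem (by simp [hne]), Finset.card_erase_of_mem (by simp)]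
  simp [Nat.sub_sub]

/-- The tuples `(q, p)` of primes at most `x` with `∏ qᵢ^α ∏ pⱼ^{βⱼ} ≤ x` for which `q i = p j`,
and for which `q i'` is the largest entry of `q` away from the index `i`. -/
noncomputable def overlapFinset {k r : ℕ} (α : ℕ) (β : Fin r → ℕ) (x : ℝ) (i i' : Fin k) (j : Fin r) :
    Finset ((Fin k → ℕ) × (Fin r → ℕ)) :=
  open Classical in
  {qp ∈ Fintype.piFinset (fun _ : Fin k => Nat.primesLE ⌊x⌋₊) ×ˢ
      Fintype.piFinset (fun _ : Fin r => Nat.primesLE ⌊x⌋₊) |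
    qp.1 i = qp.2 j ∧ (∀ l, l ≠ i → qp.1 l ≤ qp.1 i') ∧
      (((∏ i, qp.1 i ^ α) * ∏ j, qp.2 j ^ β j : ℕ) : ℝ) ≤ x}

/-- A bound for the number of tuples in `overlapFinset` with prescribed `p` and prescribed `q l`
for `l ≠ i, i'`. -/
lemma card_overlapFinset_fiber_le {k r α : ℕ} {β : Fin r → ℕ} (h : ∀ i, α < β i) {C : ℝ}
    (hC0 : 0 ≤ C)
    (hC : ∀ x m a Q : ℝ, 1 < x → 1 ≤ m → 1 ≤ a → 2 ≤ Q → a ≤ Q ^ (k - 2) →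
      m * a ^ α * Q ^ α ≤ x →
      (Nat.primeCounting ⌊(x / m) ^ (1 / (α : ℝ)) / a⌋₊ : ℝ) ≤
        C * (x ^ (1 / (α : ℝ)) / log x) *
          (m ^ (-((1 + 1 / (2 * (α : ℝ))) / (α + 1))) * a⁻¹))
    (hα : 0 < α) {x : ℝ} (hx : 1 < x) {i i' : Fin k} (hne : i' ≠ i) (j : Fin r)
    (q' : {l // l ≠ i ∧ l ≠ i'} → ℕ) (p : Fin r → ℕ) :
    (({qp ∈ overlapFinset α β x i i' j | ((fun l => qp.1 l.1), qp.2) = (q', p)}).card : ℝ) ≤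
      C * (x ^ (1 / (α : ℝ)) / log x) *
        ((∏ j, (p j : ℝ) ^ (-(1 + 1 / (2 * (α : ℝ))))) * ∏ l, (q' l : ℝ)⁻¹) := by
  have hα' : (0 : ℝ) < α := by exact_mod_cast hα
  have hlogx : 0 < log x := log_pos hx
  set F := {qp ∈ overlapFinset α β x i i' j | ((fun l => qp.1 l.1), qp.2) = (q', p)} with hF
  set m : ℕ := p j ^ α * ∏ j, p j ^ β j with hm
  set a : ℕ := ∏ l, q' l with ha
  have hmem : ∀ qp ∈ F, (∀ l, (qp.1 l).Prime) ∧ (∀ j, (p j).Prime) ∧ qp.1 i = p j ∧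
      (∀ l, q' l = qp.1 l.1) ∧ qp.2 = p ∧ a ≤ qp.1 i' ^ (k - 2) ∧
      (m : ℝ) * (a : ℝ) ^ α * (qp.1 i' : ℝ) ^ α ≤ x := by
    intro qp hqp
    simp only [hF, overlapFinset, Finset.mem_filter, Finset.mem_product, Fintype.mem_piFinset,
      Prod.mk.injEq, Nat.mem_primesLE] at hqp
    obtain ⟨⟨⟨hq, hp⟩, hij, hmax, hle⟩, rfl, rfl⟩ := hqp
    refine ⟨fun l => (hq l).2, fun l => (hp l).2, hij, fun _ => rfl, rfl, ?_, ?_⟩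
    · calc a ≤ ∏ _l : {l // l ≠ i ∧ l ≠ i'}, qp.1 i' :=
            Finset.prod_le_prod' fun l _ => hmax l.1 l.2.1
        _ = _ := by
            rw [Finset.prod_const, Finset.card_univ, card_subtype_ne_and_ne hne]
    · refine le_of_eq_of_le ?_ hle
      rw [prod_eq_mul_mul_prod_subtype_ne hne, hij, Finset.prod_pow, hm, ha]
      push_cast
      ring
  rcases F.eq_empty_or_nonempty with hempty | ⟨qp₀, hqp₀⟩
  · rw [hempty]
    simp only [Finset.card_empty, Nat.cast_zero]
    positivity
  obtain ⟨hq₀, hp, -, hq', -, hmax₀, hle₀⟩ := hmem qp₀ hqp₀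
  have ha1 : 1 ≤ a := Nat.succ_le_of_lt
    (Finset.prod_pos fun l _ => (hq' l).symm ▸ (hq₀ _).pos)
  have hm1 : 1 ≤ m := Nat.mul_pos (pow_pos (hp j).pos _)
    (Finset.prod_pos fun l _ => pow_pos (hp l).pos _)
  have hm0 : (0 : ℝ) < m := by exact_mod_cast hm1
  have ha0 : (0 : ℝ) < a := by exact_mod_cast ha1
  have hcard : F.card ≤ Nat.primeCounting ⌊(x / m) ^ (1 / (α : ℝ)) / a⌋₊ := by
    rw [← Nat.primesLE_card_eq_primeCounting]
    refine Finset.card_le_card_of_injOn (fun qp => qp.1 i') ?_ ?_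
    · intro qp hqp
      obtain ⟨hq, -, -, -, -, -, hle⟩ := hmem qp hqp
      refine Finset.mem_coe.mpr (Nat.mem_primesLE.mpr ⟨Nat.le_floor ?_, hq i'⟩)
      rw [le_div_iff₀ ha0, one_div, Real.le_rpow_inv_iff_of_pos (by positivity)
        (by positivity) hα', rpow_natCast, le_div_iff₀ hm0, mul_pow]
      linarith
    · intro qp hqp qp' hqp' heq
      obtain ⟨-, -, hi, hl, h2, -, -⟩ := hmem qp hqp
      obtain ⟨-, -, hi', hl', h2', -, -⟩ := hmem qp' hqp'
      refine Prod.ext (funext fun l => ?_) (h2.trans h2'.symm)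
      by_cases h1 : l = i
      · rw [h1, hi, hi']
      by_cases h3 : l = i'
      · rw [h3]; exact heq
      exact (hl ⟨l, h1, h3⟩).symm.trans (hl' ⟨l, h1, h3⟩)
  have hmain := hC x m a (qp₀.1 i') hx (by exact_mod_cast hm1) (by exact_mod_cast ha1)
    (by exact_mod_cast (hq₀ i').two_le) (by exact_mod_cast hmax₀) hle₀
  have hmpow : (m : ℝ) ^ (-((1 + 1 / (2 * (α : ℝ))) / (α + 1))) ≤
      ∏ j, (p j : ℝ) ^ (-(1 + 1 / (2 * (α : ℝ)))) := by
    have hlow : (∏ j, p j) ^ (α + 1) ≤ m := by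
      rw [hm, ← Finset.prod_pow]
      refine (Finset.prod_le_prod' fun l _ => Nat.pow_le_pow_right (hp l).pos (h l)).trans ?_
      exact Nat.le_mul_of_pos_left _ (pow_pos (hp j).pos _)
    have hprod : (0 : ℝ) < ∏ j, (p j : ℝ) :=
      Finset.prod_pos fun l _ => by exact_mod_cast (hp l).pos
    have hlow' : (∏ j, (p j : ℝ)) ^ (α + 1) ≤ m := by exact_mod_cast hlow
    calc (m : ℝ) ^ (-((1 + 1 / (2 * (α : ℝ))) / (α + 1)))
        ≤ ((∏ j, (p j : ℝ)) ^ (α + 1)) ^ (-((1 + 1 / (2 * (α : ℝ))) / (α + 1))) :=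
          rpow_le_rpow_of_nonpos (by positivity) hlow' (neg_nonpos.mpr (by positivity))
      _ = (∏ j, (p j : ℝ)) ^ (-(1 + 1 / (2 * (α : ℝ)))) := by
          rw [← rpow_natCast, ← rpow_mul hprod.le]
          congr 1
          push_cast
          field_simp
      _ = _ := (finsetProd_rpow _ _ (fun _ _ => by positivity) _).symm
  calc (F.card : ℝ) ≤ Nat.primeCounting ⌊(x / m) ^ (1 / (α : ℝ)) / a⌋₊ := by
        exact_mod_cast hcard
    _ ≤ _ := hmain
    _ ≤ C * (x ^ (1 / (α : ℝ)) / log x) *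
        ((∏ j, (p j : ℝ) ^ (-(1 + 1 / (2 * (α : ℝ))))) * (a : ℝ)⁻¹) := by gcongr
    _ = _ := by rw [ha]; push_cast; rw [Finset.prod_inv_distrib]

lemma exists_card_overlapFinset_le (k : ℕ) {r α : ℕ} (hα : 0 < α) {β : Fin r → ℕ}
    (h : ∀ i, α < β i) :
    ∃ C : ℝ, 0 ≤ C ∧ ∀ x : ℝ, 1 < x → ∀ i i' : Fin k, i' ≠ i → ∀ j : Fin r,
      ((overlapFinset α β x i i' j).card : ℝ) ≤
        C * (x ^ (1 / (α : ℝ)) / log x * (∑ p ∈ Nat.primesLE ⌊x⌋₊, (p : ℝ)⁻¹) ^ (k - 2)) := by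
  obtain ⟨C, hC0, hC⟩ := exists_primeCounting_le_of_mul_pow_le α (k - 2) hα
  set s : ℝ := 1 + 1 / (2 * (α : ℝ)) with hs
  have hα' : (0 : ℝ) < α := by exact_mod_cast hα
  have hsum : Summable fun n : ℕ => (n : ℝ) ^ (-s) := by
    rw [Real.summable_nat_rpow]
    have : 0 < 1 / (2 * (α : ℝ)) := by positivity
    linarith
  refine ⟨C * (∑' n : ℕ, (n : ℝ) ^ (-s)) ^ r,
    mul_nonneg hC0 (pow_nonneg (tsum_nonneg fun _ => by positivity) _), ?_⟩
  intro x hx i i' hne j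
  have hlogx : 0 < log x := log_pos hx
  set P := Nat.primesLE ⌊x⌋₊ with hP
  have hmaps : Set.MapsTo
      (fun qp : (Fin k → ℕ) × (Fin r → ℕ) =>
        ((fun l : {l // l ≠ i ∧ l ≠ i'} => qp.1 l.1), qp.2))
      (overlapFinset α β x i i' j)
      (Fintype.piFinset (fun _ : {l // l ≠ i ∧ l ≠ i'} => P) ×ˢ
        Fintype.piFinset (fun _ : Fin r => P) : Finset _) := by
    intro qp hqp
    simp only [overlapFinset, Finset.coe_filter, Set.mem_ofPred_eq, Finset.mem_product,
      Fintype.mem_piFinset] at hqp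
    simp only [Finset.mem_coe, Finset.mem_product, Fintype.mem_piFinset]
    exact ⟨fun l => hqp.1.1 l.1, hqp.1.2⟩
  rw [Finset.card_eq_sum_card_fiberwise hmaps]
  push_cast
  calc _ ≤ ∑ b ∈ Fintype.piFinset (fun _ : {l // l ≠ i ∧ l ≠ i'} => P) ×ˢ
          Fintype.piFinset (fun _ : Fin r => P),
          C * (x ^ (1 / (α : ℝ)) / log x) *
            ((∏ j, (b.2 j : ℝ) ^ (-s)) * ∏ l, (b.1 l : ℝ)⁻¹) :=
        Finset.sum_le_sum fun b _ => card_overlapFinset_fiber_le h hC0 hC hα hx hne j b.1 b.2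
    _ = C * (x ^ (1 / (α : ℝ)) / log x) *
          ((∑ p ∈ P, (p : ℝ) ^ (-s)) ^ r * (∑ p ∈ P, (p : ℝ)⁻¹) ^ (k - 2)) := by
        rw [← Finset.mul_sum, Finset.sum_product_right]
        simp only [← Finset.mul_sum, ← Finset.sum_mul]
        rw [← Finset.prod_univ_sum (fun _ : Fin r => P) (fun _ p => (p : ℝ) ^ (-s)),
          ← Finset.prod_univ_sum (fun _ : {l // l ≠ i ∧ l ≠ i'} => P) (fun _ p => (p : ℝ)⁻¹)]
        simp [Finset.prod_const, -ne_eq, card_subtype_ne_and_ne hne]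
    _ ≤ C * (x ^ (1 / (α : ℝ)) / log x) *
          ((∑' n : ℕ, (n : ℝ) ^ (-s)) ^ r * (∑ p ∈ P, (p : ℝ)⁻¹) ^ (k - 2)) := by
        gcongr
        exact hsum.sum_le_tsum P fun _ _ => by positivity
    _ = _ := by ring

/-- for `k > 1`, the number of tuples `(q₁,…,q_k, p₁,…,p_r)` of primes with
the `qᵢ` distinct, the `pⱼ` distinct, `q₁^α ⋯ q_k^α p₁^{α₁} ⋯ p_r^{α_r} ≤ x`, and some
`qᵢ = pⱼ`, is `O(x^{1/α} (log log x)^{k-2} / log x)`. -/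
theorem gcd_overlap_count (k r α : ℕ) (hk : 1 < k) (hα : 0 < α)
    (β : Fin r → ℕ) (hmono : Monotone β) (h : ∀ i, α < β i) :
    (fun x : ℝ =>
        (Nat.card {qp : (Fin k → ℕ) × (Fin r → ℕ) |
            (∀ i, (qp.1 i).Prime) ∧ Function.Injective qp.1 ∧
            (∀ j, (qp.2 j).Prime) ∧ Function.Injective qp.2 ∧
            (((∏ i, qp.1 i ^ α) * ∏ j, qp.2 j ^ β j : ℕ) : ℝ) ≤ x ∧
            ∃ i j, qp.1 i = qp.2 j} : ℝ))
      =O[atTop]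
      (fun x : ℝ =>
        x ^ ((1 : ℝ) / (α : ℝ)) * Real.log (Real.log x) ^ (k - 2) / Real.log x) := by
  obtain ⟨C, hC0, hC⟩ := exists_card_overlapFinset_le k hα h
  set I : Finset (Fin k × Fin k × Fin r) := {t | t.2.1 ≠ t.1} with hI
  have hbound : (fun x : ℝ => x ^ ((1 : ℝ) / (α : ℝ)) / log x *
      (∑ p ∈ Nat.primesLE ⌊x⌋₊, (p : ℝ)⁻¹) ^ (k - 2)) =O[atTop]
      (fun x : ℝ => x ^ ((1 : ℝ) / (α : ℝ)) * log (log x) ^ (k - 2) / log x) :=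
    ((isBigO_refl (fun x : ℝ => x ^ ((1 : ℝ) / (α : ℝ)) / log x) atTop).mul
      (sum_inv_primesLE_isBigO_log_log.pow (k - 2))).congr_right fun x => by ring
  refine IsBigO.trans (IsBigO.of_bound (I.card * C) ?_) hbound
  filter_upwards [eventually_gt_atTop 1] with x hx
  have hlogx : 0 < log x := log_pos hx
  rw [norm_of_nonneg (Nat.cast_nonneg _), norm_of_nonneg (by positivity)]
  have hsub : {qp : (Fin k → ℕ) × (Fin r → ℕ) |
      (∀ i, (qp.1 i).Prime) ∧ Function.Injective qp.1 ∧
      (∀ j, (qp.2 j).Prime) ∧ Function.Injective qp.2 ∧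
      (((∏ i, qp.1 i ^ α) * ∏ j, qp.2 j ^ β j : ℕ) : ℝ) ≤ x ∧
      ∃ i j, qp.1 i = qp.2 j} ⊆
      (I.biUnion fun t => overlapFinset α β x t.1 t.2.1 t.2.2 : Finset _) := by
    rintro ⟨q, p⟩ ⟨hq, -, hp, -, hle, i, j, hij⟩
    dsimp only at hq hp hle hij
    have hfloor := Nat.le_floor hle
    have hqpos : 0 < ∏ i, q i ^ α := Finset.prod_pos fun l _ => pow_pos (hq l).pos _
    have hppos : 0 < ∏ j, p j ^ β j := Finset.prod_pos fun l _ => pow_pos (hp l).pos _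
    have hqx : ∀ l, q l ≤ ⌊x⌋₊ := fun l =>
      calc q l ≤ q l ^ α := Nat.le_self_pow hα.ne' _
        _ ≤ ∏ i, q i ^ α := Nat.le_of_dvd hqpos (Finset.dvd_prod_of_mem _ (Finset.mem_univ l))
        _ ≤ _ := Nat.le_mul_of_pos_right _ hppos
        _ ≤ _ := hfloor
    have hpx : ∀ l, p l ≤ ⌊x⌋₊ := fun l =>
      calc p l ≤ p l ^ β l := Nat.le_self_pow (hα.trans (h l)).ne' _
        _ ≤ ∏ j, p j ^ β j := Nat.le_of_dvd hppos (Finset.dvd_prod_of_mem _ (Finset.mem_univ l))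
        _ ≤ _ := Nat.le_mul_of_pos_left _ hqpos
        _ ≤ _ := hfloor
    have : Nontrivial (Fin k) := Fin.nontrivial_iff_two_le.mpr hk
    obtain ⟨l₀, hl₀⟩ := exists_ne i
    obtain ⟨i', hi', hmax⟩ := (Finset.univ.erase i).exists_max_image q
      ⟨l₀, Finset.mem_erase.mpr ⟨hl₀, Finset.mem_univ _⟩⟩
    simp only [Finset.coe_biUnion, Set.mem_iUnion, Finset.mem_coe]
    refine ⟨(i, i', j), by simpa [hI] using hi', ?_⟩
    simp only [overlapFinset, Finset.mem_filter, Finset.mem_product, Fintype.mem_piFinset,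
      Nat.mem_primesLE]
    exact ⟨⟨fun l => ⟨hqx l, hq l⟩, fun l => ⟨hpx l, hp l⟩⟩, hij,
      fun l hl => hmax l (by simp [hl]), hle⟩
  have hcard := (Nat.card_mono (Finset.finite_toSet _) hsub).trans_eq
    (Nat.card_eq_card_toFinset _)
  rw [Finset.toFinset_coe] at hcard
  calc _ ≤ ((I.biUnion fun t => overlapFinset α β x t.1 t.2.1 t.2.2).card : ℝ) := by
        exact_mod_cast hcard
    _ ≤ ∑ t ∈ I, ((overlapFinset α β x t.1 t.2.1 t.2.2).card : ℝ) := by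
        exact_mod_cast Finset.card_biUnion_le
    _ ≤ ∑ _t ∈ I, C * (x ^ ((1 : ℝ) / (α : ℝ)) / log x *
          (∑ p ∈ Nat.primesLE ⌊x⌋₊, (p : ℝ)⁻¹) ^ (k - 2)) :=
        Finset.sum_le_sum fun t ht =>
          hC x hx t.1 t.2.1 (by simpa [hI] using ht) t.2.2
    _ = _ := by rw [Finset.sum_const, nsmul_eq_mul]; ring
end
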